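/- arXiv:2410.12970 — 6 statements merged into one kernel-verified Lean document; each statement's English description precedes it below -/
import Mathlib

section
/- Let δ be an algebraic number with δ ∉ ℚ, let a, b, c, d ∈ ℤ with ad − bc = ±1, and set λ = (aδ + b)/(cδ + d) (note cδ + d ≠ 0 and λ ≠ 0 since δ ∉ ℚ). Then, as subrings of the number field ℚ(δ), ℤ[δ] ∩ ℤ[δ^{-1}] = ℤ[λ] ∩ ℤ[λ^{-1}]. -/
section LinearSpans

open Submodule

variable {K : Type*} [Field K]

lemma span_pair_eq_sup_one (t : K) : span ℤ {t, 1} = span ℤ {t} ⊔ 1 := by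
  rw [span_insert, one_eq_span]

lemma one_le_span_pair (t : K) : (1 : Submodule ℤ K) ≤ span ℤ {t, 1} :=
  span_pair_eq_sup_one t ▸ le_sup_right

lemma singleton_mul_span_pair (u s t : K) :
    span ℤ {u} * span ℤ {s, t} = span ℤ {u * s, u * t} := by
  rw [span_mul_span, Set.singleton_mul, Set.image_pair]

lemma mem_subring_closure_singleton_iff_exists_pow (t x : K) :
    x ∈ Subring.closure {t} ↔ ∃ k : ℕ, x ∈ span ℤ {t, 1} ^ k := by
  have mono : Monotone fun k : ℕ ↦ span ℤ {t, 1} ^ k := pow_right_mono₀ (one_le_span_pair t)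
  constructor
  · intro hx
    induction hx using Subring.closure_induction with
    | mem y hy =>
      obtain rfl : y = t := hy
      exact ⟨1, by simpa using subset_span (Set.mem_insert y {1})⟩
    | zero => exact ⟨0, zero_mem _⟩
    | one => exact ⟨0, one_le.mp (pow_zero _).ge⟩
    | add y z _ _ hy hz =>
      obtain ⟨m, hm⟩ := hy
      obtain ⟨n, hn⟩ := hz
      exact ⟨m + n, add_mem (mono (m.le_add_right n) hm) (mono (n.le_add_left m) hn)⟩
    | neg y _ hy =>
      obtain ⟨m, hm⟩ := hy
      exact ⟨m, neg_mem hm⟩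
    | mul y z _ _ hy hz =>
      obtain ⟨m, hm⟩ := hy
      obtain ⟨n, hn⟩ := hz
      exact ⟨m + n, pow_add (span ℤ {t, 1}) m n ▸ mul_mem_mul hm hn⟩
  · rintro ⟨k, hk⟩
    have ht : t ∈ Subring.closure {t} := Subring.subset_closure rfl
    induction k generalizing x with
    | zero =>
      rw [pow_zero, mem_one] at hk
      obtain ⟨n, rfl⟩ := hk
      simp
    | succ k ih =>
      rw [pow_succ] at hk
      induction hk using Submodule.mul_induction_on' with
      | mem_mul_mem y hy z hz =>
        refine mul_mem (ih y hy) ?_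
        obtain ⟨m, n, rfl⟩ := mem_span_pair.mp hz
        exact add_mem (zsmul_mem ht m) (zsmul_mem (one_mem _) n)
      | add y _ z _ hy hz => exact add_mem hy hz

lemma span_pair_pow_mul_le {t : K} {S T : Submodule ℤ K} {k : ℕ}
    (h : ∀ i ≤ k, span ℤ {t} ^ i * S ≤ T) : span ℤ {t, 1} ^ k * S ≤ T := by
  induction k generalizing S with
  | zero => simpa using h 0 le_rfl
  | succ k ih =>
    rw [pow_succ, mul_assoc]
    refine ih fun i hi ↦ ?_
    rw [span_pair_eq_sup_one, Submodule.sup_mul, Submodule.mul_sup, one_mul, ← mul_assoc, ← pow_succ]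
    exact sup_le (h _ (by lia)) (h _ (by lia))

/-- Stability of a power of a module under multiplication by `x` is preserved by scaling. -/
lemma singleton_mul_pow_le_of_le {x : K} {P : Submodule ℤ K} {k : ℕ}
    (h : span ℤ {x} * P ^ k ≤ P ^ k) (U : Submodule ℤ K) :
    span ℤ {x} * (U * P) ^ k ≤ (U * P) ^ k := by
  rw [mul_pow, mul_left_comm]
  exact mul_le_mul_right h _

/-- An element lies in `ℤ[t] ∩ ℤ[t⁻¹]` iff it stabilizes the module spanned by `1, t, …, t ^ k`
for some `k`. -/
lemma mem_closure_inf_closure_inv_iff {t : K} (ht : t ≠ 0) (x : K) :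
    x ∈ Subring.closure {t} ⊓ Subring.closure {t⁻¹} ↔
      ∃ k : ℕ, span ℤ {x} * span ℤ {t, 1} ^ k ≤ span ℤ {t, 1} ^ k := by
  have mono : Monotone fun k : ℕ ↦ span ℤ {t, 1} ^ k := pow_right_mono₀ (one_le_span_pair t)
  have le_pow (i : ℕ) : span ℤ {t} ^ i ≤ span ℤ {t, 1} ^ i :=
    pow_le_pow_left' (span_mono (by simp)) i
  rw [Subring.mem_inf, mem_subring_closure_singleton_iff_exists_pow,
    mem_subring_closure_singleton_iff_exists_pow]
  constructor
  · rintro ⟨⟨m, hm⟩, n, hn⟩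
    rw [← span_singleton_le_iff_mem] at hm hn
    refine ⟨n + m, ?_⟩
    rw [mul_comm]
    refine span_pair_pow_mul_le fun i hi ↦ ?_
    rcases le_total i n with hin | hni
    · calc span ℤ {t} ^ i * span ℤ {x} ≤ span ℤ {t, 1} ^ i * span ℤ {t, 1} ^ m :=
            mul_le_mul' (le_pow i) hm
        _ = span ℤ {t, 1} ^ (i + m) := (pow_add _ _ _).symm
        _ ≤ span ℤ {t, 1} ^ (n + m) := mono (by lia)
    · obtain ⟨j, rfl⟩ := Nat.exists_eq_add_of_le' hni
      have hscale : span ℤ {t} * span ℤ {t⁻¹, 1} = span ℤ {t, 1} := by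
        rw [singleton_mul_span_pair, mul_inv_cancel₀ ht, mul_one, Set.pair_comm]
      calc span ℤ {t} ^ (j + n) * span ℤ {x}
          = span ℤ {t} ^ j * (span ℤ {t} ^ n * span ℤ {x}) := by rw [pow_add, mul_assoc]
        _ ≤ span ℤ {t, 1} ^ j * (span ℤ {t} ^ n * span ℤ {t⁻¹, 1} ^ n) :=
            mul_le_mul' (le_pow j) (mul_le_mul' le_rfl hn)
        _ = span ℤ {t, 1} ^ (j + n) := by rw [← mul_pow, hscale, pow_add]
        _ ≤ span ℤ {t, 1} ^ (n + m) := mono hi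
  · rintro ⟨k, hk⟩
    have mem_pow {s : K} (h : span ℤ {x} * span ℤ {s, 1} ^ k ≤ span ℤ {s, 1} ^ k) :
        x ∈ span ℤ {s, 1} ^ k := by
      rw [← span_singleton_le_iff_mem]
      exact (le_mul_of_one_le_right' (one_le_pow_of_one_le' (one_le_span_pair s) k)).trans h
    have hinv : span ℤ {t⁻¹} * span ℤ {t, 1} = span ℤ {t⁻¹, 1} := by
      rw [singleton_mul_span_pair, inv_mul_cancel₀ ht, mul_one, Set.pair_comm]
    exact ⟨⟨k, mem_pow hk⟩, k, mem_pow (hinv ▸ singleton_mul_pow_le_of_le hk _)⟩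

lemma span_pair_unimodular (s t : K) {a b c d : ℤ}
    (hdet : a * d - b * c = 1 ∨ a * d - b * c = -1) :
    span ℤ {a * s + b * t, c * s + d * t} = span ℤ {s, t} := by
  obtain ⟨e, he⟩ : ∃ e : ℤ, e * (a * d - b * c) = 1 := by
    rcases hdet with h | h
    · exact ⟨1, by rw [h]; rfl⟩
    · exact ⟨-1, by rw [h]; rfl⟩
  have he' : (e : K) * (a * d - b * c) = 1 := by
    exact_mod_cast congrArg (Int.cast : ℤ → K) he
  apply le_antisymm <;> rw [span_le, Set.pair_subset_iff] <;>
    simp only [SetLike.mem_coe, mem_span_pair, zsmul_eq_mul]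
  · exact ⟨⟨a, b, rfl⟩, c, d, rfl⟩
  · refine ⟨⟨e * d, -(e * b), ?_⟩, -(e * c), e * a, ?_⟩ <;> push_cast
    · linear_combination s * he'
    · linear_combination t * he'

end LinearSpans

/-- Let `δ` be an algebraic number (an element of a fixed algebraic
closure of ℚ) which is not rational, let `a b c d : ℤ` with `ad − bc = ±1`, and set
`λ = (aδ + b)/(cδ + d)`.  Then `ℤ[δ] ∩ ℤ[δ⁻¹] = ℤ[λ] ∩ ℤ[λ⁻¹]`, where `ℤ[α]` denotes
the smallest subring containing `α`. -/
theorem subring_closure_inter_invariant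
    (δ : AlgebraicClosure ℚ)
    (hδ : δ ∉ Set.range (algebraMap ℚ (AlgebraicClosure ℚ)))
    (a b c d : ℤ) (hdet : a * d - b * c = 1 ∨ a * d - b * c = -1) :
    Subring.closure {δ} ⊓ Subring.closure {δ⁻¹} =
      Subring.closure {((a : AlgebraicClosure ℚ) * δ + (b : AlgebraicClosure ℚ)) /
          ((c : AlgebraicClosure ℚ) * δ + (d : AlgebraicClosure ℚ))} ⊓
        Subring.closure {(((a : AlgebraicClosure ℚ) * δ + (b : AlgebraicClosure ℚ)) /
          ((c : AlgebraicClosure ℚ) * δ + (d : AlgebraicClosure ℚ)))⁻¹} := by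
  have ne_zero {m n : ℤ} (h : m ≠ 0 ∨ n ≠ 0) :
      (m : AlgebraicClosure ℚ) * δ + (n : AlgebraicClosure ℚ) ≠ 0 := by
    intro h0
    by_cases hm : m = 0
    · simp_all
    · refine hδ ⟨-n / m, ?_⟩
      have hm' : (m : AlgebraicClosure ℚ) ≠ 0 := by exact_mod_cast hm
      rw [map_div₀, map_neg, map_intCast, map_intCast, div_eq_iff hm']
      linear_combination -h0
  have hδ0 : δ ≠ 0 := by simpa using ne_zero (m := 1) (n := 0) (by simp)
  have hnum := ne_zero (m := a) (n := b) (by by_contra! h; simp [h.1, h.2] at hdet)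
  have hden := ne_zero (m := c) (n := d) (by by_contra! h; simp [h.1, h.2] at hdet)
  have hspan := span_pair_unimodular δ 1 hdet
  simp only [mul_one] at hspan
  set u : AlgebraicClosure ℚ := a * δ + b
  set v : AlgebraicClosure ℚ := c * δ + d
  have hfrom : Submodule.span ℤ {v⁻¹} * Submodule.span ℤ {δ, 1} =
      Submodule.span ℤ {u / v, 1} := by
    rw [← hspan, singleton_mul_span_pair, inv_mul_cancel₀ hden, inv_mul_eq_div]
  have hto : Submodule.span ℤ {v} * Submodule.span ℤ {u / v, 1} =
      Submodule.span ℤ {δ, 1} := by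
    rw [← hspan, singleton_mul_span_pair, mul_div_cancel₀ _ hden, mul_one]
  ext x
  rw [mem_closure_inf_closure_inv_iff hδ0,
    mem_closure_inf_closure_inv_iff (div_ne_zero hnum hden)]
  exact ⟨fun ⟨k, hk⟩ ↦ ⟨k, hfrom ▸ singleton_mul_pow_le_of_le hk _⟩,
    fun ⟨k, hk⟩ ↦ ⟨k, hto ▸ singleton_mul_pow_le_of_le hk _⟩⟩
end

section
/- Let n ≥ 2 and let f(X,Y) = a_n X^n + a_{n-1}X^{n-1}Y + ⋯ + a_0 Y^n be an integral binary form of degree n with a_n ≠ 0 and a_0 ≠ 0, and let ⟨B_0, …, B_{n-1}⟩ be the canonical basis of R_f in A = ℚ[X]/(f(X,1)). Then for every integer i with 1 ≤ i ≤ n−1 one has the identity B_{n-1}·B_{n-i} = −a_0·B_{n-i-1} + a_i·B_{n-1} in A. -/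
open Polynomial

noncomputable section

/-- `f(X,1) = aₙ Xⁿ + ⋯ + a₀` as a rational polynomial, where `a i` is the coefficient
of `Xⁱ Y^{n-i}` in the binary form `f`. -/
def binPoly (n : ℕ) (a : ℕ → ℤ) : Polynomial ℚ :=
  ∑ i ∈ Finset.range (n + 1), Polynomial.C (a i : ℚ) * Polynomial.X ^ i

/-- The ℚ-algebra `A = ℚ[X]/(f(X,1))`. -/
abbrev BinAlg (n : ℕ) (a : ℕ → ℤ) : Type :=
  Polynomial ℚ ⧸ Ideal.span {binPoly n a}

/-- `δ`, the image of `X` in `A`. -/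
def binDelta (n : ℕ) (a : ℕ → ℤ) : BinAlg n a :=
  Ideal.Quotient.mk _ Polynomial.X

/-- The canonical basis element `B_k = aₙ δᵏ + a_{n-1} δ^{k-1} + ⋯ + a_{n-k}`. -/
def canB (n : ℕ) (a : ℕ → ℤ) (k : ℕ) : BinAlg n a :=
  ∑ j ∈ Finset.range (k + 1), (a (n - k + j) : BinAlg n a) * binDelta n a ^ j

theorem canB_succ (n : ℕ) (a : ℕ → ℤ) (k : ℕ) (hk : k + 1 ≤ n) :
    canB n a (k + 1) = binDelta n a * canB n a k + (a (n - (k + 1)) : BinAlg n a) := by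
  unfold canB
  rw [Finset.sum_range_succ', Finset.mul_sum]
  congr 1
  · refine Finset.sum_congr rfl fun j _ => ?_
    rw [show n - (k + 1) + (j + 1) = n - k + j by omega]
    ring
  · simp

theorem canB_self (n : ℕ) (a : ℕ → ℤ) : canB n a n = 0 := by
  have h : Ideal.Quotient.mk (Ideal.span {binPoly n a}) (binPoly n a) = 0 :=
    Ideal.Quotient.eq_zero_iff_mem.mpr (Ideal.mem_span_singleton_self _)
  rw [← h]
  conv_rhs => arg 2; unfold binPoly
  simp [canB, binDelta, map_sum]

theorem binDelta_mul_canB_last (n : ℕ) (hn : 1 ≤ n) (a : ℕ → ℤ) :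
    binDelta n a * canB n a (n - 1) = -(a 0 : BinAlg n a) := by
  have h := canB_succ n a (n - 1) (by omega)
  rw [Nat.sub_add_cancel hn, canB_self, Nat.sub_self] at h
  exact eq_neg_of_add_eq_zero_left h.symm

/-- For `1 ≤ i ≤ n − 1` the identity
`B_{n-1} · B_{n-i} = −a₀ · B_{n-i-1} + a_i · B_{n-1}` holds in `A`. -/
theorem canB_mul_last (n : ℕ) (hn : 2 ≤ n) (a : ℕ → ℤ) (han : a n ≠ 0) (ha0 : a 0 ≠ 0)
    (i : ℕ) (hi1 : 1 ≤ i) (hi2 : i ≤ n - 1) :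
    canB n a (n - 1) * canB n a (n - i) =
      -(a 0 : BinAlg n a) * canB n a (n - i - 1) + (a i : BinAlg n a) * canB n a (n - 1) := by
  have h := canB_succ n a (n - i - 1) (by omega)
  rw [show n - i - 1 + 1 = n - i by omega, show n - (n - i) = i by omega] at h
  rw [h, ← binDelta_mul_canB_last n (by omega) a]
  ring
end
end

section
/- Let n ≥ 2, m ≥ 1, l be integers, and let a_0, a_1, …, a_{n-2} be integers with a_0 ≠ 0. Then for any integers B and C there exists a unique pair of integers (a_{n-1}, a_n) with B + 1 ≤ a_{n-1} ≤ B + m and C + 1 ≤ a_n ≤ C + m² such that the polynomial f(x) = a_0 x^n + a_1 x^{n-1} + ⋯ + a_{n-1} x + a_n is weakly divisible by m at l, i.e. m² ∣ f(l) and m ∣ f′(l). -/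
/-- Every half-open window of `m` consecutive integers contains exactly one solution of
`m ∣ s + x`. -/
theorem Int.existsUnique_dvd_add_of_window {m : ℤ} (hm : 0 < m) (s B : ℤ) :
    ∃! x : ℤ, (B + 1 ≤ x ∧ x ≤ B + m) ∧ m ∣ s + x := by
  refine ⟨B + 1 + (-(s + B + 1)) % m, ⟨⟨?_, ?_⟩, ?_⟩, ?_⟩
  · linarith [Int.emod_nonneg (-(s + B + 1)) hm.ne']
  · linarith [Int.emod_lt_of_pos (-(s + B + 1)) hm]
  · refine ⟨-(-(s + B + 1) / m), ?_⟩
    linarith [Int.emod_add_mul_ediv (-(s + B + 1)) m]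
  · rintro y ⟨⟨hy₁, hy₂⟩, k, hk⟩
    have hy : -(s + B + 1) = y - (B + 1) + m * (-k) := by linarith
    rw [hy, Int.add_mul_emod_self_left, Int.emod_eq_of_lt (by linarith) (by linarith)]
    ring

/-- Among the polynomials `p + b x + c`, with `b` and `c` ranging over windows of `m` and `m²`
consecutive integers, exactly one is weakly divisible by `m` at `l`. -/
theorem Polynomial.existsUnique_weaklyDivisible_add_linear
    (p : Polynomial ℤ) {m : ℤ} (hm : 0 < m) (l B C : ℤ) :
    ∃! q : ℤ × ℤ,
      (B + 1 ≤ q.1 ∧ q.1 ≤ B + m) ∧ (C + 1 ≤ q.2 ∧ q.2 ≤ C + m ^ 2) ∧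
      m ^ 2 ∣ (p + Polynomial.C q.1 * Polynomial.X + Polynomial.C q.2).eval l ∧
      m ∣ (Polynomial.derivative
        (p + Polynomial.C q.1 * Polynomial.X + Polynomial.C q.2)).eval l := by
  have hval (b c : ℤ) : (p + Polynomial.C b * Polynomial.X + Polynomial.C c).eval l
      = p.eval l + b * l + c := by simp
  have hder (b c : ℤ) : (Polynomial.derivative
      (p + Polynomial.C b * Polynomial.X + Polynomial.C c)).eval l
      = (Polynomial.derivative p).eval l + b := by simp
  simp only [hval, hder]
  obtain ⟨b, ⟨hb, hbd⟩, hbu⟩ :=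
    Int.existsUnique_dvd_add_of_window hm ((Polynomial.derivative p).eval l) B
  obtain ⟨c, ⟨hc, hcd⟩, hcu⟩ :=
    Int.existsUnique_dvd_add_of_window (pow_pos hm 2) (p.eval l + b * l) C
  refine ⟨(b, c), ⟨hb, hc, hcd, hbd⟩, ?_⟩
  rintro ⟨b', c'⟩ ⟨hb', hc', hcd', hbd'⟩
  obtain rfl : b' = b := hbu b' ⟨hb', hbd'⟩
  obtain rfl : c' = c := hcu c' ⟨hc', hcd'⟩
  rfl

/-- Given `n ≥ 2`, `m ≥ 1`, `l : ℤ`, and integers `a_0, …, a_{n-2}`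
with `a_0 ≠ 0`, for any integers `B` and `C` there is a unique pair `(a_{n-1}, a_n)`
with `B + 1 ≤ a_{n-1} ≤ B + m` and `C + 1 ≤ a_n ≤ C + m²` such that
`f(x) = a_0 xⁿ + ⋯ + a_{n-1} x + a_n` is weakly divisible by `m` at `l`,
i.e. `m² ∣ f(l)` and `m ∣ f′(l)`. -/
theorem exists_unique_last_two_coeffs
    (n : ℕ) (hn : 2 ≤ n) (m : ℤ) (hm : 1 ≤ m) (l : ℤ)
    (a : ℕ → ℤ) (ha0 : a 0 ≠ 0) (B C : ℤ) :
    ∃! q : ℤ × ℤ,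
      (B + 1 ≤ q.1 ∧ q.1 ≤ B + m) ∧ (C + 1 ≤ q.2 ∧ q.2 ≤ C + m ^ 2) ∧
      m ^ 2 ∣ ((∑ i ∈ Finset.range (n - 1), Polynomial.C (a i) * Polynomial.X ^ (n - i))
          + Polynomial.C q.1 * Polynomial.X + Polynomial.C q.2).eval l ∧
      m ∣ (Polynomial.derivative
          ((∑ i ∈ Finset.range (n - 1), Polynomial.C (a i) * Polynomial.X ^ (n - i))
            + Polynomial.C q.1 * Polynomial.X + Polynomial.C q.2)).eval l :=
  Polynomial.existsUnique_weaklyDivisible_add_linear _ (by linarith) l B C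
end

section
/- Fix n ≥ 4. There exists a constant C_n > 0 (depending only on n) such that for all real s, t ≥ 1 and every integer m ≥ 1 with m² ≤ s t^n, the cardinality of W(s:t:m) satisfies: | #W(s:t:m) − 2^{n-3} s^{n+1} t^{n(n+1)/2 − 1} / m² | ≤ C_n · (s^{n+1} t^{n(n+1)/2 − 1} / m²) · ( m²/(s t^n) + 1/s ). -/
open Polynomial

/-- `W(s:t)`: integer polynomials `f(x) = a_0 xⁿ + a_1 x^{n-1} + ⋯ + a_n` with
`0 ≤ a_1 ≤ s/2 ≤ a_0 ≤ s` and `|a_i| ≤ s·tⁱ` for `2 ≤ i ≤ n`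
(here `a_i = f.coeff (n - i)`). -/
def Wst (n : ℕ) (s t : ℝ) : Set (Polynomial ℤ) :=
  {f | f.natDegree ≤ n ∧
    0 ≤ f.coeff (n - 1) ∧ ((f.coeff (n - 1) : ℝ)) ≤ s / 2 ∧
    s / 2 ≤ (f.coeff n : ℝ) ∧ (f.coeff n : ℝ) ≤ s ∧
    ∀ i : ℕ, 2 ≤ i → i ≤ n → |(f.coeff (n - i) : ℝ)| ≤ s * t ^ i}

/-- `W(s:t:m)`: pairs `(f, l)` with `f ∈ W(s:t)`, `0 ≤ l < m`, and `f` weakly divisible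
by `m` at `l` (i.e. `m² ∣ f(l)` and `m ∣ f′(l)`). -/
def Wstm (n : ℕ) (s t : ℝ) (m : ℕ) : Set (Polynomial ℤ × ℤ) :=
  {p | p.1 ∈ Wst n s t ∧ 0 ≤ p.2 ∧ p.2 < (m : ℤ) ∧
    (m : ℤ) ^ 2 ∣ p.1.eval p.2 ∧ (m : ℤ) ∣ p.1.derivative.eval p.2}

/-- The integers `x ∈ [A, B]` with `x ≡ v (mod r)`. -/
noncomputable def residueIcc (A B : ℝ) (v r : ℤ) : Finset ℤ :=
  (Finset.Icc ⌈(A - v) / r⌉ ⌊(B - v) / r⌋).image fun y => v + r * y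

theorem mem_residueIcc {A B : ℝ} {v r x : ℤ} (hr : 0 < r) :
    x ∈ residueIcc A B v r ↔ A ≤ x ∧ (x : ℝ) ≤ B ∧ r ∣ x - v := by
  have hr' : (0 : ℝ) < r := by exact_mod_cast hr
  simp only [residueIcc, Finset.mem_image, Finset.mem_Icc, Int.ceil_le, Int.le_floor]
  constructor
  · rintro ⟨y, ⟨h1, h2⟩, rfl⟩
    rw [div_le_iff₀ hr'] at h1
    rw [le_div_iff₀ hr'] at h2
    refine ⟨?_, ?_, ⟨y, by ring⟩⟩ <;> push_cast <;> linarith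
  · rintro ⟨h1, h2, y, hy⟩
    have hx : x = v + r * y := by linarith
    subst hx
    push_cast at h1 h2
    refine ⟨y, ⟨?_, ?_⟩, rfl⟩
    · rw [div_le_iff₀ hr']; linarith
    · rw [le_div_iff₀ hr']; linarith

theorem abs_card_residueIcc_sub_le {A B : ℝ} (hAB : A ≤ B) (v : ℤ) {r : ℤ} (hr : 0 < r) :
    |((residueIcc A B v r).card : ℝ) - (B - A) / r| ≤ 1 := by
  have hr' : (0 : ℝ) < r := by exact_mod_cast hr
  have hinj : Function.Injective fun y : ℤ => v + r * y := fun a b h => by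
    have : r * a = r * b := by simpa using h
    exact mul_left_cancel₀ hr.ne' this
  rw [residueIcc, Finset.card_image_of_injective _ hinj, Int.card_Icc]
  have hle : (A - v) / r ≤ (B - v) / r := by gcongr
  have e : (B - A) / r = (B - v) / r - (A - v) / r := by ring
  rw [e]
  set a := (A - v) / (r : ℝ)
  set b := (B - v) / (r : ℝ)
  have h1 := Int.ceil_lt_add_one a
  have h2 := Int.le_ceil a
  have h3 := Int.floor_le b
  have h4 := Int.lt_floor_add_one b
  have hnn : 0 ≤ ⌊b⌋ + 1 - ⌈a⌉ := by
    have : (⌈a⌉ : ℝ) < ((⌊b⌋ + 2 : ℤ) : ℝ) := by push_cast; linarith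
    have := Int.cast_lt.mp this
    omega
  have hc : (((⌊b⌋ + 1 - ⌈a⌉).toNat : ℕ) : ℝ) = ⌊b⌋ + 1 - ⌈a⌉ := by
    have : (((⌊b⌋ + 1 - ⌈a⌉).toNat : ℤ) : ℝ) = ((⌊b⌋ + 1 - ⌈a⌉ : ℤ) : ℝ) := by
      rw [Int.toNat_of_nonneg hnn]
    push_cast at this
    exact this
  rw [hc, abs_le]
  constructor <;> linarith

theorem abs_mul_sub_mul_le {a X b Y d e : ℝ} (hX : 0 ≤ X) (hY : 0 ≤ Y)
    (ha : |a - X| ≤ d * X) (hb : |b - Y| ≤ e * Y) :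
    |a * b - X * Y| ≤ ((1 + d) * (1 + e) - 1) * (X * Y) := by
  have h : a * b - X * Y = (a - X) * (b - Y) + (a - X) * Y + X * (b - Y) := by ring
  have hm : |a - X| * |b - Y| ≤ (d * X) * (e * Y) :=
    mul_le_mul ha hb (abs_nonneg _) ((abs_nonneg _).trans ha)
  calc |a * b - X * Y| ≤ |(a - X) * (b - Y)| + |(a - X) * Y| + |X * (b - Y)| := by
        rw [h]; exact abs_add_three _ _ _
    _ = |a - X| * |b - Y| + |a - X| * Y + X * |b - Y| := by
        rw [abs_mul, abs_mul, abs_mul, abs_of_nonneg hX, abs_of_nonneg hY]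
    _ ≤ (d * X) * (e * Y) + (d * X) * Y + X * (e * Y) := by gcongr
    _ = _ := by ring

theorem abs_sum_sub_mul_le {ι : Type*} (S : Finset ι) (f : ι → ℝ) {M F d e : ℝ}
    (hF : 0 ≤ F) (he : 0 ≤ e) (hS : |(S.card : ℝ) - M| ≤ d * M)
    (hf : ∀ x ∈ S, |f x - F| ≤ e * F) :
    |∑ x ∈ S, f x - M * F| ≤ ((1 + d) * (1 + e) - 1) * (M * F) := by
  have h1 : |∑ x ∈ S, f x - S.card * F| ≤ S.card * (e * F) := by
    have : ∑ x ∈ S, f x - S.card * F = ∑ x ∈ S, (f x - F) := by simp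
    rw [this, ← nsmul_eq_mul]
    exact (Finset.abs_sum_le_sum_abs _ _).trans (Finset.sum_le_card_nsmul _ _ _ hf)
  have h2 : |S.card * F - M * F| ≤ d * M * F := by
    rw [← sub_mul, abs_mul, abs_of_nonneg hF]
    gcongr
  have h3 : (S.card : ℝ) ≤ (1 + d) * M := by
    have := (abs_le.mp hS).2
    linarith
  have h4 : S.card * (e * F) ≤ (1 + d) * M * (e * F) := by gcongr
  have h5 := abs_sub_le (∑ x ∈ S, f x) (S.card * F) (M * F)
  nlinarith

theorem abs_prod_sub_prod_le {k : ℕ} (a X : Fin k → ℝ) {d : ℝ} (hX : ∀ i, 0 ≤ X i)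
    (h : ∀ i, |a i - X i| ≤ d * X i) :
    |∏ i, a i - ∏ i, X i| ≤ ((1 + d) ^ k - 1) * ∏ i, X i := by
  induction k with
  | zero => simp
  | succ k ih =>
    rw [Fin.prod_univ_succ, Fin.prod_univ_succ, pow_succ']
    have := abs_mul_sub_mul_le (hX 0) (Finset.prod_nonneg fun i _ => hX (Fin.succ i)) (h 0)
      (ih (fun i => a i.succ) (fun i => X i.succ) (fun i => hX _) (fun i => h _))
    simpa using this

theorem one_add_pow_sub_one_le {x : ℝ} (h0 : 0 ≤ x) (h4 : x ≤ 4) (N : ℕ) :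
    (1 + x) ^ N - 1 ≤ x * 6 ^ N := by
  induction N with
  | zero => simpa using h0
  | succ N ih =>
    have h6 : (1 : ℝ) ≤ 6 ^ N := one_le_pow₀ (by norm_num)
    calc (1 + x) ^ (N + 1) - 1 = (1 + x) * ((1 + x) ^ N - 1) + x := by ring
      _ ≤ (1 + x) * (x * 6 ^ N) + x * 6 ^ N := by
        gcongr
        nlinarith
      _ = (2 + x) * (x * 6 ^ N) := by ring
      _ ≤ 6 * (x * 6 ^ N) := by
        gcongr
        linarith
      _ = _ := by ring

theorem prod_pow_mul_self (t : ℝ) (k : ℕ) :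
    (∏ j : Fin k, t ^ (k + 1 - (j : ℕ))) * t = t ^ ((k + 1) * (k + 2) / 2) := by
  induction k with
  | zero => simp
  | succ k ih =>
    rw [Fin.prod_univ_succ]
    have : ∀ j : Fin k, t ^ (k + 1 + 1 - ((j.succ : Fin (k + 1)) : ℕ)) = t ^ (k + 1 - (j : ℕ)) := by
      intro j
      congr 1
      simp
    simp only [this]
    rw [mul_assoc, ih, ← pow_add]
    congr 1
    have : (k + 1 + 1) * (k + 1 + 2) = (k + 1) * (k + 2) + (k + 2) * 2 := by ring
    rw [this, Nat.add_mul_div_right _ _ (by norm_num)]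
    simp
    ring

/-- Lower bound for the `j`-th coefficient of a polynomial in `W(s:t)`. -/
noncomputable def coeffLower (n : ℕ) (s t : ℝ) (j : ℕ) : ℝ :=
  if j = n then s / 2 else if j + 1 = n then 0 else -(s * t ^ (n - j))

/-- Upper bound for the `j`-th coefficient of a polynomial in `W(s:t)`. -/
noncomputable def coeffUpper (n : ℕ) (s t : ℝ) (j : ℕ) : ℝ :=
  if j = n then s else if j + 1 = n then s / 2 else s * t ^ (n - j)

theorem mem_Wst_iff {n : ℕ} (hn : 1 ≤ n) {s t : ℝ} {f : ℤ[X]} :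
    f ∈ Wst n s t ↔ f.natDegree ≤ n ∧
      ∀ j ≤ n, coeffLower n s t j ≤ f.coeff j ∧ (f.coeff j : ℝ) ≤ coeffUpper n s t j := by
  simp only [Wst, Set.mem_ofPred_eq]
  refine and_congr_right fun _ => ?_
  constructor
  · rintro ⟨h1, h2, h3, h4, h5⟩ j hj
    rw [coeffLower, coeffUpper]
    split_ifs with ha hb
    · subst ha; exact ⟨h3, h4⟩
    · have : j = n - 1 := by omega
      subst this
      exact ⟨by exact_mod_cast h1, h2⟩
    · have := h5 (n - j) (by omega) (by omega)
      rw [Nat.sub_sub_self hj] at this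
      exact abs_le.mp this
  · intro h
    have hn1 := h (n - 1) (by omega)
    have hn0 := h n le_rfl
    simp only [coeffLower, coeffUpper, if_true] at hn0
    simp only [coeffLower, coeffUpper, if_neg (show n - 1 ≠ n by omega),
      if_pos (show n - 1 + 1 = n by omega)] at hn1
    refine ⟨by exact_mod_cast hn1.1, hn1.2, hn0.1, hn0.2, fun i hi hin => ?_⟩
    have := h (n - i) (by omega)
    simp only [coeffLower, coeffUpper, if_neg (show n - i ≠ n by omega),
      if_neg (show n - i + 1 ≠ n by omega), Nat.sub_sub_self hin] at this
    exact abs_le.mpr this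

/-- The polynomial with constant term `b₀`, linear term `b₁` and higher coefficients `g`. -/
noncomputable def polyOfCoeffs {k : ℕ} (g : Fin k → ℤ) (b₁ b₀ : ℤ) : ℤ[X] :=
  X * (X * (∑ j : Fin k, C (g j) * X ^ (j : ℕ)) + C b₁) + C b₀

section polyOfCoeffs

variable {k : ℕ} (g : Fin k → ℤ) (b₁ b₀ : ℤ)

theorem coeff_zero_polyOfCoeffs : (polyOfCoeffs g b₁ b₀).coeff 0 = b₀ := by
  simp [polyOfCoeffs]

theorem coeff_one_polyOfCoeffs : (polyOfCoeffs g b₁ b₀).coeff 1 = b₁ := by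
  rw [polyOfCoeffs, coeff_add, ← zero_add 1, coeff_X_mul, coeff_C_succ]
  simp

theorem coeff_add_two_polyOfCoeffs (i : ℕ) :
    (polyOfCoeffs g b₁ b₀).coeff (i + 2) = if h : i < k then g ⟨i, h⟩ else 0 := by
  simp only [polyOfCoeffs, coeff_add, coeff_X_mul, coeff_C, finsetSum_coeff, coeff_C_mul,
    coeff_X_pow, Nat.succ_ne_zero, if_false, add_zero, mul_ite, mul_one, mul_zero]
  split_ifs with h
  · rw [Finset.sum_eq_single ⟨i, h⟩]
    · simp
    · intro b _ hb
      rw [if_neg]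
      rintro rfl
      exact hb rfl
    · simp
  · refine Finset.sum_eq_zero fun j _ => if_neg ?_
    have := j.2
    omega

theorem coeff_fin_add_two_polyOfCoeffs (j : Fin k) :
    (polyOfCoeffs g b₁ b₀).coeff (j + 2) = g j := by
  simp [coeff_add_two_polyOfCoeffs]

theorem natDegree_polyOfCoeffs_le : (polyOfCoeffs g b₁ b₀).natDegree ≤ k + 1 := by
  rw [natDegree_le_iff_coeff_eq_zero]
  intro N hN
  obtain ⟨i, rfl⟩ : ∃ i, N = i + 2 := ⟨N - 2, by omega⟩
  rw [coeff_add_two_polyOfCoeffs, dif_neg (by omega)]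

theorem polyOfCoeffs_coeff {f : ℤ[X]} (hf : f.natDegree ≤ k + 1) :
    polyOfCoeffs (fun j : Fin k => f.coeff (j + 2)) (f.coeff 1) (f.coeff 0) = f := by
  ext i
  match i with
  | 0 => rw [coeff_zero_polyOfCoeffs]
  | 1 => rw [coeff_one_polyOfCoeffs]
  | i + 2 =>
    rw [coeff_add_two_polyOfCoeffs]
    split_ifs with h
    · rfl
    · exact (coeff_eq_zero_of_natDegree_lt (by omega)).symm

theorem eval_polyOfCoeffs (l : ℤ) :
    (polyOfCoeffs g b₁ b₀).eval l = (polyOfCoeffs g b₁ 0).eval l + b₀ := by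
  simp [polyOfCoeffs]

theorem eval_derivative_polyOfCoeffs (l : ℤ) :
    (polyOfCoeffs g b₁ b₀).derivative.eval l = (polyOfCoeffs g 0 0).derivative.eval l + b₁ := by
  simp [polyOfCoeffs]
  ring

end polyOfCoeffs

/-- Admissible higher coefficients of polynomials in `W(s:t)` of degree at most `k + 1`. -/
noncomputable def higherCoeffs (k : ℕ) (s t : ℝ) : Finset (Fin k → ℤ) :=
  Fintype.piFinset fun j =>
    residueIcc (coeffLower (k + 1) s t (j + 2)) (coeffUpper (k + 1) s t (j + 2)) 0 1

/-- Admissible linear coefficients once `l` and the higher coefficients are fixed. -/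
noncomputable def linearCoeffs {k : ℕ} (s t : ℝ) (m : ℕ) (l : ℤ) (g : Fin k → ℤ) : Finset ℤ :=
  residueIcc (coeffLower (k + 1) s t 1) (coeffUpper (k + 1) s t 1)
    (-(polyOfCoeffs g 0 0).derivative.eval l) m

/-- Admissible constant coefficients once `l` and the other coefficients are fixed. -/
noncomputable def constCoeffs {k : ℕ} (s t : ℝ) (m : ℕ) (l : ℤ) (g : Fin k → ℤ) (b₁ : ℤ) :
    Finset ℤ :=
  residueIcc (coeffLower (k + 1) s t 0) (coeffUpper (k + 1) s t 0)
    (-(polyOfCoeffs g b₁ 0).eval l) ((m : ℤ) ^ 2)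

theorem polyOfCoeffs_mem_Wstm_iff {k : ℕ} {s t : ℝ} {m : ℕ} (hm : 1 ≤ m) (l : ℤ)
    (g : Fin k → ℤ) (b₁ b₀ : ℤ) :
    (polyOfCoeffs g b₁ b₀, l) ∈ Wstm (k + 1) s t m ↔
      l ∈ Finset.Ico (0 : ℤ) m ∧ g ∈ higherCoeffs k s t ∧ b₁ ∈ linearCoeffs s t m l g ∧
        b₀ ∈ constCoeffs s t m l g b₁ := by
  have hm' : (0 : ℤ) < m := by exact_mod_cast hm
  simp only [Wstm, Set.mem_ofPred_eq, mem_Wst_iff (Nat.succ_pos k), higherCoeffs, linearCoeffs,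
    constCoeffs, Fintype.mem_piFinset, mem_residueIcc one_pos, mem_residueIcc hm',
    mem_residueIcc (pow_pos hm' 2), Finset.mem_Ico, one_dvd, and_true, sub_neg_eq_add,
    natDegree_polyOfCoeffs_le, true_and]
  rw [eval_polyOfCoeffs, eval_derivative_polyOfCoeffs, add_comm b₁, add_comm b₀]
  constructor
  · rintro ⟨h, hl0, hlm, h0, h1⟩
    refine ⟨⟨hl0, hlm⟩, fun j => ?_, ?_, ?_⟩
    · simpa [coeff_fin_add_two_polyOfCoeffs] using h (j + 2) (by omega)
    · have := h 1 (by omega)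
      rw [coeff_one_polyOfCoeffs] at this
      exact ⟨this.1, this.2, h1⟩
    · have := h 0 (by omega)
      rw [coeff_zero_polyOfCoeffs] at this
      exact ⟨this.1, this.2, h0⟩
  · rintro ⟨⟨hl0, hlm⟩, hg, ⟨h11, h12, h13⟩, ⟨h01, h02, h03⟩⟩
    refine ⟨fun i hi => ?_, hl0, hlm, h03, h13⟩
    match i with
    | 0 => rw [coeff_zero_polyOfCoeffs]; exact ⟨h01, h02⟩
    | 1 => rw [coeff_one_polyOfCoeffs]; exact ⟨h11, h12⟩
    | i + 2 =>
      have := hg ⟨i, by omega⟩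
      rw [coeff_add_two_polyOfCoeffs, dif_pos (by omega)]
      exact this

theorem card_Wstm_eq_sum (k : ℕ) (s t : ℝ) {m : ℕ} (hm : 1 ≤ m) :
    Nat.card (Wstm (k + 1) s t m) = ∑ l ∈ Finset.Ico (0 : ℤ) m, ∑ g ∈ higherCoeffs k s t,
      ∑ b₁ ∈ linearCoeffs s t m l g, (constCoeffs s t m l g b₁).card := by
  let T : Finset (Σ _ : ℤ, Σ _ : Fin k → ℤ, Σ _ : ℤ, ℤ) :=
    (Finset.Ico (0 : ℤ) m).sigma fun l => (higherCoeffs k s t).sigma fun g =>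
      (linearCoeffs s t m l g).sigma fun b₁ => constCoeffs s t m l g b₁
  let F : (Σ _ : ℤ, Σ _ : Fin k → ℤ, Σ _ : ℤ, ℤ) → ℤ[X] × ℤ :=
    fun p => (polyOfCoeffs p.2.1 p.2.2.1 p.2.2.2, p.1)
  have hF : Function.Injective F := by
    rintro ⟨l, g, b₁, b₀⟩ ⟨l', g', b₁', b₀'⟩ h
    simp only [F, Prod.mk.injEq] at h
    obtain ⟨h, rfl⟩ := h
    have h0 := congrArg (fun f => coeff f 0) h
    have h1 := congrArg (fun f => coeff f 1) h
    simp only [coeff_zero_polyOfCoeffs, coeff_one_polyOfCoeffs] at h0 h1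
    have h2 : g = g' := by
      funext j
      have := congrArg (fun f => coeff f (j + 2)) h
      simpa only [coeff_fin_add_two_polyOfCoeffs] using this
    rw [h0, h1, h2]
  have himg : Wstm (k + 1) s t m = F '' (T : Set _) := by
    ext ⟨f, l⟩
    constructor
    · intro hfl
      have hdeg : f.natDegree ≤ k + 1 := hfl.1.1
      rw [← polyOfCoeffs_coeff hdeg, polyOfCoeffs_mem_Wstm_iff hm] at hfl
      refine ⟨⟨l, fun j => f.coeff (j + 2), f.coeff 1, f.coeff 0⟩, ?_, ?_⟩
      · simpa only [T, Finset.mem_coe, Finset.mem_sigma] using hfl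
      · simp only [F, polyOfCoeffs_coeff hdeg]
    · rintro ⟨⟨l', g, b₁, b₀⟩, hp, h⟩
      rw [← h]
      refine (polyOfCoeffs_mem_Wstm_iff hm l' g b₁ b₀).mpr ?_
      simpa only [T, Finset.mem_coe, Finset.mem_sigma] using hp
  rw [himg, Nat.card_coe_set_eq, Set.ncard_image_of_injective _ hF, Set.ncard_coe_finset]
  simp only [T, Finset.card_sigma]

theorem abs_card_Wstm_sub_le (k : ℕ) (s t : ℝ) {m : ℕ} (hm : 1 ≤ m) {δ : ℝ} (hδ : 0 ≤ δ)
    (X : ℕ → ℝ) (hX : ∀ j, X j = coeffUpper (k + 1) s t j - coeffLower (k + 1) s t j)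
    (hX0 : ∀ j ≤ k + 1, 0 ≤ X j) (h0 : 1 ≤ δ * (X 0 / (m : ℝ) ^ 2)) (h1 : 1 ≤ δ * (X 1 / m))
    (h2 : ∀ j : Fin k, 1 ≤ δ * X (j + 2)) :
    |(Nat.card (Wstm (k + 1) s t m) : ℝ)
        - m * ((∏ j : Fin k, X (j + 2)) * (X 1 / m * (X 0 / (m : ℝ) ^ 2)))|
      ≤ ((1 + δ) ^ (k + 2) - 1)
        * (m * ((∏ j : Fin k, X (j + 2)) * (X 1 / m * (X 0 / (m : ℝ) ^ 2)))) := by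
  have hm' : (0 : ℤ) < m := by exact_mod_cast hm
  have hle : ∀ j ≤ k + 1, coeffLower (k + 1) s t j ≤ coeffUpper (k + 1) s t j := fun j hj => by
    have := hX0 j hj
    rw [hX] at this
    linarith
  have hP : 0 ≤ ∏ j : Fin k, X (j + 2) := Finset.prod_nonneg fun j _ => hX0 _ (by omega)
  have hp : ∀ N, 0 ≤ (1 + δ) ^ N - 1 := fun N => sub_nonneg.mpr (one_le_pow₀ (by linarith))
  have hY0 : 0 ≤ X 0 / (m : ℝ) ^ 2 := div_nonneg (hX0 _ (by omega)) (by positivity)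
  have hY1 : 0 ≤ X 1 / (m : ℝ) := div_nonneg (hX0 _ (by omega)) (by positivity)
  have hconst : ∀ l (g : Fin k → ℤ) b₁, |((constCoeffs s t m l g b₁).card : ℝ)
      - X 0 / (m : ℝ) ^ 2| ≤ δ * (X 0 / (m : ℝ) ^ 2) := by
    intro l g b₁
    have := abs_card_residueIcc_sub_le (hle 0 (by omega))
      (-(polyOfCoeffs g b₁ 0).eval l) (pow_pos hm' 2)
    rw [← hX] at this
    push_cast at this
    exact this.trans h0
  have hlin : ∀ l (g : Fin k → ℤ), |((linearCoeffs s t m l g).card : ℝ)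
      - X 1 / m| ≤ δ * (X 1 / m) := by
    intro l g
    have := abs_card_residueIcc_sub_le (hle 1 (by omega))
      (-(polyOfCoeffs g 0 0).derivative.eval l) hm'
    rw [← hX] at this
    push_cast at this
    exact this.trans h1
  have hhigh : |((higherCoeffs k s t).card : ℝ) - ∏ j : Fin k, X (j + 2)|
      ≤ ((1 + δ) ^ k - 1) * ∏ j : Fin k, X (j + 2) := by
    rw [higherCoeffs, Fintype.card_piFinset, Nat.cast_prod]
    refine abs_prod_sub_prod_le _ _ (fun j => hX0 _ (by omega)) fun j => ?_
    have := abs_card_residueIcc_sub_le (hle (j + 2) (by omega)) 0 one_pos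
    rw [← hX, Int.cast_one, div_one] at this
    exact this.trans (h2 j)
  rw [card_Wstm_eq_sum k s t hm]
  push_cast
  have key := abs_sum_sub_mul_le (Finset.Ico (0 : ℤ) m)
    (fun l => ∑ g ∈ higherCoeffs k s t, ∑ b₁ ∈ linearCoeffs s t m l g,
      ((constCoeffs s t m l g b₁).card : ℝ)) (M := m)
    (F := (∏ j : Fin k, X (j + 2)) * (X 1 / m * (X 0 / (m : ℝ) ^ 2))) (d := 0)
    (e := (1 + δ) ^ (k + 2) - 1) (by positivity) (hp _) (by simp) ?_
  · simpa using key
  intro l _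
  have e1 : (1 + δ) ^ (k + 2) = (1 + ((1 + δ) ^ k - 1)) * (1 + ((1 + δ) ^ 2 - 1)) := by ring
  rw [e1]
  refine abs_sum_sub_mul_le _ _ (by positivity) (hp 2) hhigh fun g _ => ?_
  rw [sq (1 + δ)]
  exact abs_sum_sub_mul_le _ _ hY0 hδ (hlin l g) fun b₁ _ => hconst l g b₁

theorem prod_coeffUpper_sub_coeffLower (k : ℕ) (s t : ℝ) :
    (∏ j : Fin (k + 2), (coeffUpper (k + 3) s t (j + 2) - coeffLower (k + 3) s t (j + 2))) * t
      = 2 ^ k * s ^ (k + 2) / 4 * t ^ ((k + 1) * (k + 2) / 2) := by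
  have hj : ∀ j : Fin k, coeffUpper (k + 3) s t (j + 2) - coeffLower (k + 3) s t (j + 2)
      = 2 * s * t ^ (k + 1 - (j : ℕ)) := by
    intro j
    have := j.2
    rw [coeffUpper, coeffLower, if_neg (by omega), if_neg (by omega), if_neg (by omega),
      if_neg (by omega), show k + 3 - ((j : ℕ) + 2) = k + 1 - j by omega]
    ring
  rw [Fin.prod_univ_castSucc, Fin.prod_univ_castSucc]
  simp only [Fin.val_castSucc, Fin.val_last, hj]
  rw [Finset.prod_mul_distrib, ← prod_pow_mul_self]
  simp only [coeffUpper, coeffLower, Finset.prod_const, Finset.card_univ, Fintype.card_fin]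
  simp
  ring

theorem div_pow_pred_le {s t : ℝ} (hs : 1 ≤ s) (ht : 1 ≤ t) {m : ℝ} {n : ℕ}
    (hn : 2 ≤ n) : m / (s * t ^ (n - 1)) ≤ m ^ 2 / (s * t ^ n) + 1 / s := by
  have hs0 : 0 < s := by linarith
  have ht0 : 0 < t := by linarith
  have hpow : t ^ n ≤ (t ^ (n - 1)) ^ 2 := by
    rw [← pow_mul]
    exact pow_le_pow_right₀ ht (by omega)
  have h1 : m ^ 2 / (s * (t ^ (n - 1)) ^ 2) ≤ m ^ 2 / (s * t ^ n) := by gcongr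
  refine le_trans ?_ (add_le_add_left h1 _)
  set p := m / t ^ (n - 1) with hp
  have e1 : m / (s * t ^ (n - 1)) = p * (1 / s) := by rw [hp]; field_simp
  have e2 : m ^ 2 / (s * (t ^ (n - 1)) ^ 2) + 1 / s = (p ^ 2 + 1) * (1 / s) := by
    rw [hp]; field_simp
  rw [e1, e2]
  gcongr
  nlinarith [sq_nonneg (p - 1)]

/-- For `n ≥ 4` there is a constant `C_n > 0` such that for all
`s, t ≥ 1` and integers `m ≥ 1` with `m² ≤ s·tⁿ`,
`| #W(s:t:m) − 2^{n-3} s^{n+1} t^{n(n+1)/2 − 1} / m² |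
   ≤ C_n · (s^{n+1} t^{n(n+1)/2 − 1} / m²) · (m²/(s tⁿ) + 1/s)`. -/
theorem card_Wstm_asymptotic (n : ℕ) (hn : 4 ≤ n) :
    ∃ C : ℝ, 0 < C ∧ ∀ s t : ℝ, 1 ≤ s → 1 ≤ t → ∀ m : ℕ, 1 ≤ m → (m : ℝ) ^ 2 ≤ s * t ^ n →
      |(Nat.card (Wstm n s t m) : ℝ)
          - 2 ^ (n - 3) * s ^ (n + 1) * t ^ (n * (n + 1) / 2 - 1) / (m : ℝ) ^ 2|
        ≤ C * (s ^ (n + 1) * t ^ (n * (n + 1) / 2 - 1) / (m : ℝ) ^ 2)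
            * ((m : ℝ) ^ 2 / (s * t ^ n) + 1 / s) := by
  obtain ⟨k, rfl⟩ : ∃ k, n = k + 3 := ⟨n - 3, by omega⟩
  refine ⟨2 ^ k * (2 * 6 ^ (k + 4)), by positivity, fun s t hs ht m hm hmst => ?_⟩
  have hs0 : 0 < s := by linarith
  have ht0 : 0 < t := by linarith
  have hm0 : (0 : ℝ) < m := by exact_mod_cast hm
  set E := (m : ℝ) ^ 2 / (s * t ^ (k + 3)) + 1 / s with hE
  have hEs : 1 / s ≤ E := le_add_of_nonneg_left (by positivity)
  have hEm : (m : ℝ) ^ 2 / (s * t ^ (k + 3)) ≤ E := le_add_of_nonneg_right (by positivity)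
  have hE0 : 0 ≤ E := by positivity
  have hE2 : E ≤ 2 := by
    have h1 : (m : ℝ) ^ 2 / (s * t ^ (k + 3)) ≤ 1 := (div_le_one (by positivity)).mpr hmst
    have h2 : 1 / s ≤ 1 := (div_le_one hs0).mpr hs
    linarith
  let X : ℕ → ℝ := fun j => coeffUpper (k + 3) s t j - coeffLower (k + 3) s t j
  have hX0 : X 0 = 2 * s * t ^ (k + 3) := by
    simp only [X, coeffUpper, coeffLower]
    rw [if_neg (by omega), if_neg (by omega), if_neg (by omega), if_neg (by omega)]
    simp only [Nat.sub_zero]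
    ring
  have hX1 : X 1 = 2 * s * t ^ (k + 2) := by
    simp only [X, coeffUpper, coeffLower]
    rw [if_neg (by omega), if_neg (by omega), if_neg (by omega), if_neg (by omega)]
    simp only [show k + 3 - 1 = k + 2 by omega]
    ring
  have hXs : ∀ j, s / 2 ≤ X j := by
    intro j
    have ht1 : 1 ≤ t ^ (k + 3 - j) := one_le_pow₀ ht
    simp only [X, coeffUpper, coeffLower]
    split_ifs
    · linarith
    · linarith
    · nlinarith
  have h0 : 1 ≤ 2 * E * (X 0 / (m : ℝ) ^ 2) := by
    have : 1 = (m : ℝ) ^ 2 / (s * t ^ (k + 3)) * ((s * t ^ (k + 3)) / (m : ℝ) ^ 2) := by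
      field_simp
    have h' : 1 ≤ E * ((s * t ^ (k + 3)) / (m : ℝ) ^ 2) := by
      nth_rewrite 1 [this]
      gcongr
    rw [hX0]
    calc 1 ≤ 4 * (E * ((s * t ^ (k + 3)) / (m : ℝ) ^ 2)) := by linarith
      _ = _ := by ring
  have h1 : 1 ≤ 2 * E * (X 1 / m) := by
    have hle : (m : ℝ) / (s * t ^ (k + 2)) ≤ E := div_pow_pred_le hs ht (n := k + 3) (by omega)
    have : 1 = (m : ℝ) / (s * t ^ (k + 2)) * ((s * t ^ (k + 2)) / m) := by
      field_simp
    have h' : 1 ≤ E * ((s * t ^ (k + 2)) / m) := by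
      nth_rewrite 1 [this]
      gcongr
    rw [hX1]
    calc 1 ≤ 4 * (E * ((s * t ^ (k + 2)) / m)) := by linarith
      _ = _ := by ring
  have h2 : ∀ j : Fin (k + 2), 1 ≤ 2 * E * X (j + 2) := fun j => by
    calc 1 = 2 * (1 / s) * (s / 2) := by field_simp
      _ ≤ 2 * E * X (j + 2) := by
        gcongr
        exact hXs _
  have key := abs_card_Wstm_sub_le (k + 2) s t hm (δ := 2 * E) (by positivity) X (fun _ => rfl)
    (fun j _ => by linarith [hXs j]) h0 h1 h2
  have hexp : (k + 3) * (k + 3 + 1) / 2 - 1 + 1 = (k + 1) * (k + 2) / 2 + (k + 2) + (k + 3) := by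
    have : (k + 3) * (k + 3 + 1) = (k + 1) * (k + 2) + (k + 2 + (k + 3)) * 2 := by ring
    rw [this, Nat.add_mul_div_right _ _ (by norm_num)]
    omega
  have hmain : (m : ℝ) * ((∏ j : Fin (k + 2), X (j + 2)) * (X 1 / m * (X 0 / (m : ℝ) ^ 2)))
      = 2 ^ k * (s ^ (k + 3 + 1) * t ^ ((k + 3) * (k + 3 + 1) / 2 - 1) / (m : ℝ) ^ 2) := by
    have hprod := prod_coeffUpper_sub_coeffLower k s t
    have ht' : t ^ ((k + 3) * (k + 3 + 1) / 2 - 1) * t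
        = t ^ ((k + 1) * (k + 2) / 2) * t ^ (k + 2) * t ^ (k + 3) := by
      rw [← pow_succ, hexp, pow_add, pow_add]
    apply mul_right_cancel₀ ht0.ne'
    calc _ = ((∏ j : Fin (k + 2), X (j + 2)) * t) * (X 1 * X 0 / (m : ℝ) ^ 2) := by
          field_simp
      _ = 2 ^ k * s ^ (k + 2) / 4 * t ^ ((k + 1) * (k + 2) / 2)
            * (2 * s * t ^ (k + 2) * (2 * s * t ^ (k + 3)) / (m : ℝ) ^ 2) := by
          rw [hprod, hX0, hX1]
      _ = 2 ^ k * s ^ (k + 4) / (m : ℝ) ^ 2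
            * (t ^ ((k + 1) * (k + 2) / 2) * t ^ (k + 2) * t ^ (k + 3)) := by ring
      _ = _ := by rw [← ht']; ring
  rw [hmain] at key
  have hbound := one_add_pow_sub_one_le (x := 2 * E) (by positivity) (by linarith) (k + 4)
  set Q := s ^ (k + 3 + 1) * t ^ ((k + 3) * (k + 3 + 1) / 2 - 1) / (m : ℝ) ^ 2 with hQ
  have hQ0 : 0 ≤ Q := by positivity
  have e1 : 2 ^ (k + 3 - 3) * s ^ (k + 3 + 1) * t ^ ((k + 3) * (k + 3 + 1) / 2 - 1) / (m : ℝ) ^ 2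
      = 2 ^ k * Q := by
    rw [hQ, Nat.add_sub_cancel]
    ring
  rw [e1]
  calc _ ≤ ((1 + 2 * E) ^ (k + 4) - 1) * (2 ^ k * Q) := key
    _ ≤ 2 * E * 6 ^ (k + 4) * (2 ^ k * Q) := by gcongr
    _ = _ := by ring
end

section
/- Let n ≥ 4. There exist a constant c_n > 0 and X_0 > 0 such that for all real X ≥ X_0, the number of isomorphism classes of integral domains R such that R is a commutative ring that is free of rank n as a ℤ-module and |disc(R)| ≤ X is at least c_n · X^{1/2 + 1/(n − 4/3)} (note 1/(n − 4/3) = 3/(3n − 4)). -/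
noncomputable section

/-- The addition of a commutative ring structure `c` on a type `α`. -/
def structAdd {α : Type*} (c : CommRing α) (x y : α) : α :=
  letI := c; x + y

/-- The multiplication of a commutative ring structure `c` on a type `α`. -/
def structMul {α : Type*} (c : CommRing α) (x y : α) : α :=
  letI := c; x * y

/-- The ring `(α, c)` is an integral domain. -/
def StructIsDomain {α : Type*} (c : CommRing α) : Prop :=
  letI := c; IsDomain α

/-- The rings `(α, c)` and `(β, d)` are isomorphic as rings. -/
def StructIso {α β : Type*} (c : CommRing α) (d : CommRing β) : Prop :=
  letI := c; letI := d; Nonempty (α ≃+* β)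

/-- The discriminant of a commutative ring structure `c` on `ℤⁿ` whose addition is the
standard (coordinatewise) one: the determinant of the matrix `(Tr(e_i e_j))_{i,j}` of the
trace form in the standard ℤ-basis `e_i = Pi.single i 1`, where the trace of
multiplication by `x` is computed in that basis as `∑ k, (x * e_k) k`. -/
def structDisc (n : ℕ) (c : CommRing (Fin n → ℤ)) : ℤ :=
  Matrix.det (Matrix.of fun i j : Fin n =>
    ∑ k : Fin n,
      structMul c (structMul c (Pi.single i 1) (Pi.single j 1)) (Pi.single k 1) k)

open Polynomial Matrix in
/-- The companion matrix of `X ^ n + ∑ i, a i * X ^ i`. -/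
def companionMatrix {R : Type*} [CommRing R] {n : ℕ} (a : Fin n → R) :
    Matrix (Fin n) (Fin n) R :=
  Matrix.of fun i j => if (j : ℕ) + 1 = n then -a i else if (i : ℕ) = j + 1 then 1 else 0

/-- The `k`-th power sum of the roots of `X ^ n + ∑ i, a i * X ^ i`. -/
def powerSum {R : Type*} [CommRing R] {n : ℕ} (a : Fin n → R) (k : ℕ) : R :=
  Matrix.trace (companionMatrix a ^ k)

/-- The Hankel matrix of power sums, which is the matrix of the trace form. -/
def powerSumMatrix {R : Type*} [CommRing R] {n : ℕ} (a : Fin n → R) : Matrix (Fin n) (Fin n) R :=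
  Matrix.of fun i j => powerSum a (i + j)

theorem sum_mul_companionMatrix {R : Type*} [CommRing R] {n : ℕ} (a : Fin n → R) (x : R)
    (hx : x ^ n + ∑ i, a i * x ^ (i : ℕ) = 0) (j : Fin n) :
    ∑ l : Fin n, x ^ (l : ℕ) * companionMatrix a l j = x ^ ((j : ℕ) + 1) := by
  by_cases hj : (j : ℕ) + 1 = n
  · simp only [companionMatrix, Matrix.of_apply, hj, if_true]
    have : ∑ l : Fin n, x ^ (l : ℕ) * -a l = -∑ i, a i * x ^ (i : ℕ) := by
      rw [← Finset.sum_neg_distrib]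
      exact Finset.sum_congr rfl fun i _ => by ring
    rw [this]
    linear_combination -hx
  · simp only [companionMatrix, Matrix.of_apply, hj, if_false]
    have hlt : (j : ℕ) + 1 < n := by omega
    rw [Finset.sum_eq_single ⟨j + 1, hlt⟩]
    · simp
    · intro b _ hb
      have : (b : ℕ) ≠ j + 1 := fun h => hb (Fin.ext h)
      simp [this]
    · simp

theorem vandermonde_mul_companionMatrix {R : Type*} [CommRing R] {n : ℕ} (a v : Fin n → R)
    (hv : ∀ j, v j ^ n + ∑ i, a i * v j ^ (i : ℕ) = 0) :
    Matrix.vandermonde v * companionMatrix a = Matrix.diagonal v * Matrix.vandermonde v := by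
  ext i j
  rw [Matrix.mul_apply, Matrix.diagonal_mul]
  simp only [Matrix.vandermonde_apply]
  rw [sum_mul_companionMatrix a (v i) (hv i) j, pow_succ']

theorem powerSum_eq_sum_pow {F : Type*} [Field F] {n : ℕ} (a v : Fin n → F)
    (hv : ∀ j, v j ^ n + ∑ i, a i * v j ^ (i : ℕ) = 0) (hinj : Function.Injective v) (k : ℕ) :
    powerSum a k = ∑ j, v j ^ k := by
  have hdet : IsUnit (Matrix.vandermonde v).det :=
    isUnit_iff_ne_zero.2 (Matrix.det_vandermonde_ne_zero_iff.2 hinj)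
  have hmul : ∀ k, Matrix.vandermonde v * companionMatrix a ^ k =
      Matrix.diagonal v ^ k * Matrix.vandermonde v := by
    intro k
    induction k with
    | zero => simp
    | succ k ih =>
      rw [pow_succ, ← mul_assoc, ih, mul_assoc, vandermonde_mul_companionMatrix a v hv, pow_succ,
        mul_assoc]
  have h : companionMatrix a ^ k =
      (Matrix.vandermonde v)⁻¹ * (Matrix.diagonal v ^ k * Matrix.vandermonde v) := by
    rw [← hmul, Matrix.nonsing_inv_mul_cancel_left _ _ hdet]
  rw [powerSum, h, Matrix.trace_mul_comm, mul_assoc, Matrix.mul_nonsing_inv _ hdet, mul_one,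
    Matrix.diagonal_pow, Matrix.trace_diagonal]
  simp

theorem continuous_powerSum {n : ℕ} (k : ℕ) :
    Continuous fun a : Fin n → ℝ => powerSum a k := by
  unfold powerSum
  have : Continuous fun a : Fin n → ℝ => companionMatrix a := by
    refine continuous_matrix fun i j => ?_
    simp only [companionMatrix, Matrix.of_apply]
    split_ifs <;> fun_prop
  exact (this.pow k).matrix_trace

theorem powerSum_scale {F : Type*} [Field F] {n : ℕ} (a : Fin n → F) (h : F) (hh : h ≠ 0)
    (k : ℕ) :
    powerSum (fun i : Fin n => h ^ (n - (i : ℕ)) * a i) k = h ^ k * powerSum a k := by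
  set b : Fin n → F := fun i => h ^ (n - (i : ℕ)) * a i
  set P : Matrix (Fin n) (Fin n) F := Matrix.diagonal fun i => (h ^ (i : ℕ))⁻¹
  have hP : IsUnit P.det := by
    rw [isUnit_iff_ne_zero, Matrix.det_diagonal]
    exact Finset.prod_ne_zero_iff.2 fun i _ => inv_ne_zero (pow_ne_zero _ hh)
  have h1 : companionMatrix b * P = P * (h • companionMatrix a) := by
    ext i j
    rw [Matrix.mul_diagonal, Matrix.diagonal_mul, Matrix.smul_apply, smul_eq_mul]
    simp only [companionMatrix, Matrix.of_apply, b]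
    split_ifs with h1 h2
    · have hi : n - (i : ℕ) + i = (j : ℕ) + 1 := by omega
      have : h ^ (n - (i : ℕ)) * h ^ (i : ℕ) = h ^ (j : ℕ) * h := by
        rw [← pow_add, hi, pow_succ]
      field_simp
      linear_combination (-a i) * this
    · rw [h2, pow_succ]; field_simp
    · simp
  have h2 : ∀ k, companionMatrix b ^ k * P = P * (h • companionMatrix a) ^ k := by
    intro k
    induction k with
    | zero => simp
    | succ k ih => rw [pow_succ, mul_assoc, h1, ← mul_assoc, ih, mul_assoc, ← pow_succ]
  have h3 : companionMatrix b ^ k = P * ((h • companionMatrix a) ^ k * P⁻¹) := by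
    rw [← mul_assoc, ← h2, Matrix.mul_nonsing_inv_cancel_right _ _ hP]
  rw [powerSum, h3, Matrix.trace_mul_comm, mul_assoc, Matrix.nonsing_inv_mul _ hP, mul_one,
    smul_pow, Matrix.trace_smul, smul_eq_mul, powerSum]

theorem powerSum_map {R S : Type*} [CommRing R] [CommRing S] (φ : R →+* S) {n : ℕ}
    (a : Fin n → R) (k : ℕ) : powerSum (fun i => φ (a i)) k = φ (powerSum a k) := by
  have : companionMatrix (fun i => φ (a i)) = (companionMatrix a).map φ := by
    ext i j
    simp only [companionMatrix, Matrix.of_apply, Matrix.map_apply]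
    split_ifs <;> simp
  rw [powerSum, this, powerSum, ← Matrix.map_pow, AddMonoidHom.map_trace]

theorem exists_injective_sum_eq_zero {n : ℕ} (hn : 4 ≤ n) :
    ∃ v : Fin n → ℝ, Function.Injective v ∧ ∑ i, v i = 0 ∧ ∑ i, v i ^ 3 < 0 := by
  obtain ⟨m, rfl⟩ : ∃ m, n = m + 1 := ⟨n - 1, by omega⟩
  have hm : (3 : ℝ) ≤ m := by exact_mod_cast (by omega : 3 ≤ m)
  have s1 : ∀ m : ℕ, ∑ i : Fin m, ((i : ℕ) + 1 : ℝ) = m * (m + 1) / 2 := by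
    intro m
    induction m with
    | zero => simp
    | succ m ih => rw [Fin.sum_univ_castSucc]; simp [ih]; ring
  have s3 : ∀ m : ℕ, ∑ i : Fin m, ((i : ℕ) + 1 : ℝ) ^ 3 = (m * (m + 1) / 2) ^ 2 := by
    intro m
    induction m with
    | zero => simp
    | succ m ih => rw [Fin.sum_univ_castSucc]; simp [ih]; ring
  have hT : (1 : ℝ) < m * (m + 1) / 2 := by nlinarith
  refine ⟨Fin.snoc (α := fun _ => ℝ) (fun i : Fin m => ((i : ℕ) + 1 : ℝ)) (-(m * (m + 1) / 2)),
    ?_, ?_, ?_⟩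
  · intro i j
    refine Fin.lastCases ?_ (fun i => ?_) i <;> refine Fin.lastCases ?_ (fun j => ?_) j
    · simp
    · simp only [Fin.snoc_last, Fin.snoc_castSucc]
      intro h
      have : (0 : ℝ) ≤ (j : ℕ) := Nat.cast_nonneg _
      linarith
    · simp only [Fin.snoc_last, Fin.snoc_castSucc]
      intro h
      have : (0 : ℝ) ≤ (i : ℕ) := Nat.cast_nonneg _
      linarith
    · simp only [Fin.snoc_castSucc]
      intro h
      have : (i : ℕ) = j := by exact_mod_cast (add_right_cancel h)
      rw [Fin.ext this]
  · rw [Fin.sum_univ_castSucc]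
    simp [s1]
  · rw [Fin.sum_univ_castSucc]
    simp only [Fin.snoc_last, Fin.snoc_castSucc, s3]
    nlinarith [mul_pos (show (0 : ℝ) < m * (m + 1) / 2 - 1 by linarith)
      (show (0 : ℝ) < (m * (m + 1) / 2) ^ 2 by positivity)]

open Polynomial in
theorem exists_coeff_of_roots {n : ℕ} (hn : 1 ≤ n) (v : Fin n → ℝ) (hsum : ∑ i, v i = 0) :
    ∃ a : Fin n → ℝ, (∀ i : Fin n, (i : ℕ) + 1 = n → a i = 0) ∧
      ∀ j, v j ^ n + ∑ i, a i * v j ^ (i : ℕ) = 0 := by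
  set P : ℝ[X] := ∏ i, (X - C (v i))
  have hP : P.Monic := monic_prod_of_monic _ _ fun i _ => monic_X_sub_C _
  have hdeg : P.natDegree = n := by
    simp [P, natDegree_prod_of_monic _ _ fun i _ => monic_X_sub_C (v i)]
  refine ⟨fun i => P.coeff i, fun i hi => ?_, fun j => ?_⟩
  · have h := prod_X_sub_C_nextCoeff (s := Finset.univ) v
    rw [hsum, neg_zero] at h
    change P.nextCoeff = 0 at h
    rw [nextCoeff_of_natDegree_pos (by omega), hdeg] at h
    change P.coeff i = 0
    rwa [show (i : ℕ) = n - 1 by omega]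
  · have h0 : P.eval (v j) = 0 := by
      rw [eval_prod]
      exact Finset.prod_eq_zero (Finset.mem_univ j) (by simp)
    rw [eval_eq_sum_range, hdeg, Finset.sum_range_succ, ← hdeg, hP.coeff_natDegree, hdeg,
      one_mul, ← Fin.sum_univ_eq_sum_range (fun i => P.coeff i * v j ^ i)] at h0
    linarith

theorem exists_coercive_vandermonde {n : ℕ} (v : Fin n → ℝ) (hinj : Function.Injective v) :
    ∃ c : ℝ, 0 < c ∧ ∀ w : Fin n → ℝ, ∀ i,
      c * w i ^ 2 ≤ ∑ l, ∑ j, w l * w j * ∑ m, v m ^ ((l : ℕ) + j) := by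
  set V := Matrix.vandermonde v with hVdef
  have hdet : IsUnit V.det := isUnit_iff_ne_zero.2 (Matrix.det_vandermonde_ne_zero_iff.2 hinj)
  set K : ℝ := 1 + ∑ i, ∑ m, (V⁻¹ i m) ^ 2
  have hK : 0 < K := by positivity
  refine ⟨K⁻¹, by positivity, fun w i => ?_⟩
  have hq : ∑ l, ∑ j, w l * w j * ∑ m, v m ^ ((l : ℕ) + j) = ∑ m, (V.mulVec w m) ^ 2 := by
    have hsq : ∀ m, V.mulVec w m ^ 2 = ∑ l, ∑ j, w l * w j * v m ^ ((l : ℕ) + j) := by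
      intro m
      have : V.mulVec w m = ∑ l : Fin n, v m ^ (l : ℕ) * w l := rfl
      rw [this, sq, Finset.sum_mul_sum]
      exact Finset.sum_congr rfl fun l _ => Finset.sum_congr rfl fun j _ => by ring
    simp only [hsq, Finset.mul_sum]
    rw [Finset.sum_comm (s := Finset.univ (α := Fin n)) (t := Finset.univ)
      (f := fun m l => ∑ j, w l * w j * v m ^ ((l : ℕ) + j))]
    exact Finset.sum_congr rfl fun l _ => Finset.sum_comm
  rw [hq]
  have hw : w i = ∑ m, V⁻¹ i m * V.mulVec w m := by
    have : w = V⁻¹.mulVec (V.mulVec w) := by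
      rw [Matrix.mulVec_mulVec, Matrix.nonsing_inv_mul _ hdet, Matrix.one_mulVec]
    conv_lhs => rw [this]
    rfl
  have hcs : w i ^ 2 ≤ (∑ m, (V⁻¹ i m) ^ 2) * ∑ m, (V.mulVec w m) ^ 2 := by
    rw [hw]; exact Finset.sum_mul_sq_le_sq_mul_sq _ _ _
  have hle : ∑ m, (V⁻¹ i m) ^ 2 ≤ K := by
    have := Finset.single_le_sum (f := fun i => ∑ m, (V⁻¹ i m) ^ 2)
      (fun i _ => Finset.sum_nonneg fun m _ => sq_nonneg _) (Finset.mem_univ i)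
    simp only [K]; linarith
  have hnn : 0 ≤ ∑ m, (V.mulVec w m) ^ 2 := Finset.sum_nonneg fun m _ => sq_nonneg _
  rw [inv_mul_le_iff₀ hK]
  exact hcs.trans (mul_le_mul_of_nonneg_right hle hnn)

/-- Near a suitable totally real polynomial with vanishing trace, the power sums are bounded,
the trace form is uniformly positive definite and the third power sum is negative. -/
theorem exists_good_neighbourhood {n : ℕ} (hn : 4 ≤ n) :
    ∃ a₀ : Fin n → ℝ, (∀ i : Fin n, (i : ℕ) + 1 = n → a₀ i = 0) ∧
      ∃ ε > (0 : ℝ), ∃ c > (0 : ℝ), ∃ D > (0 : ℝ), ∀ a : Fin n → ℝ, (∀ i, |a i - a₀ i| ≤ ε) →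
        |(powerSumMatrix a).det| ≤ D ∧ powerSum a 2 ≤ D ∧ powerSum a 3 < 0 ∧
        ∀ w : Fin n → ℝ, ∀ i, c * w i ^ 2 ≤ ∑ l, ∑ j, w l * w j * powerSum a (l + j) := by
  obtain ⟨v, hinj, hsum, hcube⟩ := exists_injective_sum_eq_zero hn
  obtain ⟨a₀, ha₀, hroot⟩ := exists_coeff_of_roots (by omega) v hsum
  obtain ⟨c, hc, hcoer⟩ := exists_coercive_vandermonde v hinj
  have hps := powerSum_eq_sum_pow a₀ v hroot hinj
  set η : ℝ := c / (2 * (n : ℝ) ^ 2)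
  have hn0 : (0 : ℝ) < n := by exact_mod_cast (by omega : 0 < n)
  have hη : 0 < η := by positivity
  have hdetc : Continuous fun a : Fin n → ℝ => (powerSumMatrix a).det := by
    refine Continuous.matrix_det (continuous_matrix fun i j => ?_)
    simpa [powerSumMatrix] using continuous_powerSum ((i : ℕ) + j)
  have e1 : ∀ᶠ a in nhds a₀, |(powerSumMatrix a).det| < |(powerSumMatrix a₀).det| + 1 :=
    (hdetc.abs.tendsto a₀).eventually_lt_const (by linarith)
  have e2 : ∀ᶠ a in nhds a₀, powerSum a 2 < |powerSum a₀ 2| + 1 :=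
    ((continuous_powerSum 2).tendsto a₀).eventually_lt_const
      (by linarith [le_abs_self (powerSum a₀ 2)])
  have e3 : ∀ᶠ a in nhds a₀, powerSum a 3 < 0 :=
    ((continuous_powerSum 3).tendsto a₀).eventually_lt_const (by rw [hps]; exact hcube)
  have e4 : ∀ᶠ a in nhds a₀, ∀ l j : Fin n, |powerSum a (l + j) - powerSum a₀ (l + j)| < η := by
    rw [Filter.eventually_all]; intro l
    rw [Filter.eventually_all]; intro j
    have := (((continuous_powerSum (n := n) (l + j)).sub continuous_const).abs.tendsto a₀
      (f := fun a => |powerSum a (l + j) - powerSum a₀ (l + j)|))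
    exact this.eventually_lt_const (by simpa using hη)
  obtain ⟨δ, hδ, hball⟩ := Metric.eventually_nhds_iff.1 (e1.and (e2.and (e3.and e4)))
  refine ⟨a₀, ha₀, δ / 2, by positivity, c / 2, by positivity,
    |(powerSumMatrix a₀).det| + 1 + (|powerSum a₀ 2| + 1), by positivity, fun a ha => ?_⟩
  have hdist : dist a a₀ < δ := by
    refine lt_of_le_of_lt ((dist_pi_le_iff (by positivity)).2 fun i => ?_) (half_lt_self hδ)
    rw [Real.dist_eq]; exact ha i
  obtain ⟨h1, h2, h3, h4⟩ := hball hdist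
  refine ⟨?_, ?_, h3, fun w i => ?_⟩
  · linarith [abs_nonneg (powerSum a₀ 2)]
  · linarith [abs_nonneg (powerSumMatrix a₀).det]
  obtain ⟨i₀, -, hi₀⟩ := Finset.exists_max_image Finset.univ (fun i => |w i|) ⟨i, Finset.mem_univ i⟩
  have hmax : ∀ j, |w j| ≤ |w i₀| := fun j => hi₀ j (Finset.mem_univ j)
  have hbase := hcoer w i₀
  simp only [← hps] at hbase
  have hdiff : |∑ l : Fin n, ∑ j : Fin n, w l * w j * (powerSum a (l + j) - powerSum a₀ (l + j))|
      ≤ ∑ l : Fin n, ∑ j : Fin n, |w i₀| * |w i₀| * η := by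
    refine (Finset.abs_sum_le_sum_abs _ _).trans (Finset.sum_le_sum fun l _ => ?_)
    refine (Finset.abs_sum_le_sum_abs _ _).trans (Finset.sum_le_sum fun j _ => ?_)
    rw [abs_mul, abs_mul (w l)]
    exact mul_le_mul (mul_le_mul (hmax l) (hmax j) (abs_nonneg _) (abs_nonneg _)) (h4 l j).le
      (abs_nonneg _) (by positivity)
  have hconst : ∑ l : Fin n, ∑ j : Fin n, |w i₀| * |w i₀| * η = c / 2 * w i₀ ^ 2 := by
    simp only [Finset.sum_const, Finset.card_univ, Fintype.card_fin, nsmul_eq_mul, η,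
      abs_mul_abs_self]
    field_simp
  rw [hconst] at hdiff
  have hsplit : ∑ l : Fin n, ∑ j : Fin n, w l * w j * powerSum a (l + j) =
      ∑ l : Fin n, ∑ j : Fin n, w l * w j * powerSum a₀ (l + j) +
      ∑ l : Fin n, ∑ j : Fin n, w l * w j * (powerSum a (l + j) - powerSum a₀ (l + j)) := by
    rw [← Finset.sum_add_distrib]
    refine Finset.sum_congr rfl fun l _ => ?_
    rw [← Finset.sum_add_distrib]
    exact Finset.sum_congr rfl fun j _ => by ring
  have hwi : w i ^ 2 ≤ w i₀ ^ 2 := sq_le_sq.2 (hmax i)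
  rw [hsplit]
  have := neg_abs_le (∑ l : Fin n, ∑ j : Fin n,
    w l * w j * (powerSum a (l + j) - powerSum a₀ (l + j)))
  nlinarith

section DivOrder

open Polynomial

variable {K : Type*} [Field K] [CharZero K]

theorem exists_aeval_mul_div {q : ℤ[X]} {p r s : ℤ} {θ : K} (hp : p ≠ 0)
    (hf : aeval θ ((X - C r) * q + C (p ^ 2 * s)) = 0) (g : ℤ[X]) :
    ∃ g₁ : ℤ[X], aeval θ g * (aeval θ q / (p : K)) =
      p * aeval θ g₁ + (g.eval r : ℤ) * (aeval θ q / (p : K)) := by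
  have hpK : (p : K) ≠ 0 := Int.cast_ne_zero.2 hp
  have hg : g = (X - C r) * (g /ₘ (X - C r)) + C (g.eval r) := by
    conv_lhs => rw [← modByMonic_add_div g (X - C r), modByMonic_X_sub_C_eq_C_eval, add_comm]
  refine ⟨-(C s * (g /ₘ (X - C r))), ?_⟩
  have hg' := congrArg (aeval θ) hg
  generalize g /ₘ (X - C r) = g₀ at hg' ⊢
  simp only [map_add, map_mul, map_sub, aeval_X, map_neg, map_pow, eq_intCast,
    map_intCast] at hg' hf ⊢
  rw [hg']
  field_simp
  linear_combination (aeval θ g₀) * hf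

/-- The overring `ℤ[θ] + ℤ q(θ)/p` of `ℤ[θ]`, where `θ` is a root of `(X - r) q + p² s` and
`q(r) = p b`. -/
def divOrder (q : ℤ[X]) (p r s b : ℤ) (θ : K) (hp : p ≠ 0)
    (hf : aeval θ ((X - C r) * q + C (p ^ 2 * s)) = 0) (hb : q.eval r = p * b) : Subring K where
  carrier := {x | ∃ (g : ℤ[X]) (k : ℤ), x = aeval θ g + k * (aeval θ q / (p : K))}
  zero_mem' := ⟨0, 0, by simp⟩
  one_mem' := ⟨1, 0, by simp⟩
  add_mem' := by
    rintro _ _ ⟨g, k, rfl⟩ ⟨g', k', rfl⟩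
    exact ⟨g + g', k + k', by simp only [map_add]; push_cast; ring⟩
  neg_mem' := by
    rintro _ ⟨g, k, rfl⟩
    exact ⟨-g, -k, by simp only [map_neg]; push_cast; ring⟩
  mul_mem' := by
    rintro _ _ ⟨g, k, rfl⟩ ⟨g', k', rfl⟩
    obtain ⟨g₁, h₁⟩ := exists_aeval_mul_div hp hf g
    obtain ⟨g₂, h₂⟩ := exists_aeval_mul_div hp hf g'
    obtain ⟨g₃, h₃⟩ := exists_aeval_mul_div hp hf q
    have hpK : (p : K) ≠ 0 := Int.cast_ne_zero.2 hp
    rw [hb] at h₃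
    have h₄ : (aeval θ q / (p : K)) * (aeval θ q / (p : K)) =
        aeval θ g₃ + b * (aeval θ q / (p : K)) := by
      push_cast at h₃
      field_simp at h₃ ⊢
      linear_combination h₃
    refine ⟨g * g' + C (k' * p) * g₁ + C (k * p) * g₂ + C (k * k') * g₃,
      k' * g.eval r + k * g'.eval r + k * k' * b, ?_⟩
    simp only [map_add, map_mul, eq_intCast, map_intCast, Int.cast_mul, Int.cast_add]
    linear_combination (k' : K) * h₁ + (k : K) * h₂ + (k * k' : K) * h₄

variable {q : ℤ[X]} {p r s b : ℤ} {θ : K} {hp : p ≠ 0}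
  {hf : aeval θ ((X - C r) * q + C (p ^ 2 * s)) = 0} {hb : q.eval r = p * b}

theorem mem_divOrder {x : K} : x ∈ divOrder q p r s b θ hp hf hb ↔
    ∃ (g : ℤ[X]) (k : ℤ), x = aeval θ g + k * (aeval θ q / (p : K)) := Iff.rfl

theorem aeval_mem_divOrder (g : ℤ[X]) : aeval θ g ∈ divOrder q p r s b θ hp hf hb :=
  ⟨g, 0, by simp⟩

theorem root_mem_divOrder : θ ∈ divOrder q p r s b θ hp hf hb := by
  simpa using aeval_mem_divOrder (hp := hp) (hf := hf) (hb := hb) (X : ℤ[X])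

theorem div_mem_divOrder : aeval θ q / (p : K) ∈ divOrder q p r s b θ hp hf hb :=
  ⟨0, 1, by simp⟩

end DivOrder

section Companion

open Polynomial

variable {K : Type*} [Field K] [Algebra ℚ K] {n : ℕ}

/-- The monic polynomial `X ^ n + ∑ i, c i * X ^ i`. -/
def monicPoly {R : Type*} [CommRing R] {n : ℕ} (c : Fin n → R) : R[X] :=
  X ^ n + ∑ i, C (c i) * X ^ (i : ℕ)

theorem monicPoly_monic {R : Type*} [CommRing R] (c : Fin n → R) : (monicPoly c).Monic :=
  monic_X_pow_add (degree_sum_fin_lt c)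

theorem monicPoly_natDegree {R : Type*} [CommRing R] [Nontrivial R] (c : Fin n → R) :
    (monicPoly c).natDegree = n := by
  apply natDegree_eq_of_degree_eq_some
  rw [monicPoly, degree_add_eq_left_of_degree_lt, degree_X_pow]
  rw [degree_X_pow]
  exact degree_sum_fin_lt c

theorem monicPoly_coeff {R : Type*} [CommRing R] (c : Fin n → R) (i : Fin n) :
    (monicPoly c).coeff i = c i := by
  have : (i : ℕ) ≠ n := i.2.ne
  simp [monicPoly, coeff_X_pow, this, Fin.val_inj]

theorem monicPoly_map {R S : Type*} [CommRing R] [CommRing S] (φ : R →+* S) (c : Fin n → R) :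
    (monicPoly c).map φ = monicPoly fun i => φ (c i) := by
  simp [monicPoly, Polynomial.map_sum]

theorem leftMulMatrix_eq_companionMatrix {c : Fin n → ℚ} {θ : K}
    (hθ : aeval θ (monicPoly c) = 0) (B : Module.Basis (Fin n) ℚ K)
    (hB : ∀ i, B i = θ ^ (i : ℕ)) : Algebra.leftMulMatrix B θ = companionMatrix c := by
  ext i j
  rw [Algebra.leftMulMatrix_eq_repr_mul, hB, ← pow_succ']
  by_cases hj : (j : ℕ) + 1 = n
  · have h : θ ^ n = ∑ l, (-c l) • B l := by
      simp only [monicPoly, map_add, map_sum, map_mul, aeval_C, map_pow, aeval_X] at hθ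
      simp only [hB, Algebra.smul_def, map_neg, neg_mul, Finset.sum_neg_distrib]
      linear_combination hθ
    rw [hj, h, B.repr_sum_self]
    simp [companionMatrix, hj]
  · have : θ ^ ((j : ℕ) + 1) = B ⟨j + 1, by omega⟩ := by rw [hB]
    rw [this, B.repr_self]
    simp only [companionMatrix, Matrix.of_apply, hj, if_false, Finsupp.single_apply, Fin.ext_iff]
    simp only [eq_comm]

theorem trace_pow_eq_powerSum {c : Fin n → ℚ} {θ : K}
    (hθ : aeval θ (monicPoly c) = 0) (B : Module.Basis (Fin n) ℚ K)
    (hB : ∀ i, B i = θ ^ (i : ℕ)) (k : ℕ) : Algebra.trace ℚ K (θ ^ k) = powerSum c k := by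
  rw [Algebra.trace_eq_matrix_trace B, map_pow, leftMulMatrix_eq_companionMatrix hθ B hB]
  rfl

theorem trace_sq_eq {c : Fin n → ℚ} {θ : K}
    (hθ : aeval θ (monicPoly c) = 0) (B : Module.Basis (Fin n) ℚ K)
    (hB : ∀ i, B i = θ ^ (i : ℕ)) (x : K) : Algebra.trace ℚ K (x ^ 2) =
      ∑ l, ∑ j, B.repr x l * B.repr x j * powerSum c (l + j) := by
  conv_lhs => rw [← B.sum_repr x, sq, Finset.sum_mul_sum, map_sum]
  refine Finset.sum_congr rfl fun l _ => ?_
  rw [map_sum]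
  refine Finset.sum_congr rfl fun j _ => ?_
  rw [smul_mul_smul_comm, map_smul, hB, hB, ← pow_add, trace_pow_eq_powerSum hθ B hB, smul_eq_mul]

end Companion

section Transport

theorem structAdd_equiv {α β : Type*} [c : CommRing β] (e : α ≃ β) (x y : α) :
    structAdd e.commRing x y = e.symm (e x + e y) := rfl

theorem structMul_equiv {α β : Type*} [c : CommRing β] (e : α ≃ β) (x y : α) :
    structMul e.commRing x y = e.symm (e x * e y) := rfl

theorem structIsDomain_equiv {α β : Type*} [c : CommRing β] [IsDomain β] (e : α ≃ β) :
    StructIsDomain e.commRing := by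
  let := e.commRing
  exact (e.ringEquiv).toMulEquiv.isDomain β

theorem structIso_equiv {α β : Type*} [c : CommRing β] (e : α ≃ β) :
    StructIso e.commRing c := by
  let := e.commRing
  exact ⟨e.ringEquiv⟩

theorem StructIso.symm {α β : Type*} {c : CommRing α} {d : CommRing β} (h : StructIso c d) :
    StructIso d c := h.map RingEquiv.symm

theorem StructIso.trans {α β γ : Type*} {c : CommRing α} {d : CommRing β} {e : CommRing γ}
    (h : StructIso c d) (h' : StructIso d e) : StructIso c e :=
  h.elim fun f => h'.map fun g => f.trans g

variable {K : Type*} [Field K] [Algebra ℚ K] {n : ℕ}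

theorem exists_structure_of_basis (b : Module.Basis (Fin n) ℚ K) (S : Subring K)
    (hS : ∀ x, x ∈ S ↔ ∀ i, ∃ z : ℤ, b.repr x i = z) :
    ∃ c : CommRing (Fin n → ℤ), (∀ x y, structAdd c x y = x + y) ∧ StructIsDomain c ∧
      (structDisc n c : ℚ) = (Matrix.of fun i j => Algebra.trace ℚ K (b i * b j)).det ∧
      StructIso c S.toCommRing := by
  have hrepr : ∀ (z : Fin n → ℤ) i, b.repr (∑ j, (z j : ℚ) • b j) i = z i := fun z i => by
    rw [b.repr_sum_self]
  let e₀ : (Fin n → ℤ) → S := fun z => ⟨∑ j, (z j : ℚ) • b j, (hS _).2 fun i => ⟨z i, hrepr z i⟩⟩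
  have he₀ : Function.Bijective e₀ := by
    constructor
    · intro z w h
      have h' : ∑ j, (z j : ℚ) • b j = ∑ j, (w j : ℚ) • b j := congrArg Subtype.val h
      ext i
      have := hrepr z i
      rw [h', hrepr w i] at this
      exact_mod_cast this.symm
    · rintro ⟨x, hx⟩
      choose z hz using (hS x).1 hx
      refine ⟨z, Subtype.ext ?_⟩
      simp only [e₀, ← hz]
      exact b.sum_repr x
  let e := Equiv.ofBijective e₀ he₀
  have he : ∀ z, (e z : K) = ∑ j, (z j : ℚ) • b j := fun z => rfl
  have hsymm : ∀ (x : S) i, ((e.symm x i : ℤ) : ℚ) = b.repr x i := fun x i => by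
    rw [← hrepr, ← he, e.apply_symm_apply]
  have hsingle : ∀ i, (e (Pi.single i 1) : K) = b i := fun i => by
    rw [he, Finset.sum_eq_single i] <;> simp +contextual
  refine ⟨e.commRing, fun x y => ?_, structIsDomain_equiv e, ?_, structIso_equiv e⟩
  · rw [structAdd_equiv, Equiv.symm_apply_eq]
    apply Subtype.ext
    simp [he, add_smul, Finset.sum_add_distrib]
  · rw [structDisc, ← eq_intCast (Int.castRingHom ℚ), RingHom.map_det]
    congr 1
    ext i j
    simp only [RingHom.mapMatrix_apply, Matrix.map_apply, Matrix.of_apply, Int.coe_castRingHom,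
      Int.cast_sum, structMul_equiv, hsymm, Equiv.apply_symm_apply, Subring.coe_mul, hsingle]
    rw [Algebra.trace_eq_matrix_trace b, Matrix.trace]
    simp only [Matrix.diag_apply, Algebra.leftMulMatrix_eq_repr_mul]

end Transport

section DivOrderBasis

open Polynomial

variable {K : Type*} [Field K] [Algebra ℚ K] {n : ℕ} {c : Fin n → ℤ} {θ : K}

theorem aeval_eq_sum_smul_basis (hθ : aeval θ (monicPoly c) = 0) {B : Module.Basis (Fin n) ℚ K}
    (hB : ∀ i, B i = θ ^ (i : ℕ)) (g : ℤ[X]) :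
    aeval θ g = ∑ i : Fin n, ((g %ₘ monicPoly c).coeff i : ℚ) • B i := by
  have h := modByMonic_add_div g (monicPoly c)
  by_cases hn : n = 0
  · subst hn
    have : Subsingleton K := (Module.Basis.repr B).toEquiv.subsingleton
    exact Subsingleton.elim _ _
  have hd : (g %ₘ monicPoly c).natDegree < n := by
    have := natDegree_modByMonic_lt g (monicPoly_monic c)
      (fun h => hn (by rw [← monicPoly_natDegree c, h, natDegree_one]))
    rwa [monicPoly_natDegree] at this
  conv_lhs => rw [← h, map_add, map_mul, hθ, zero_mul, add_zero, aeval_eq_sum_range' hd,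
    ← Fin.sum_univ_eq_sum_range fun i => (g %ₘ monicPoly c).coeff i • θ ^ i]
  refine Finset.sum_congr rfl fun i _ => ?_
  rw [hB, Algebra.smul_def, Algebra.smul_def]
  simp

theorem repr_aeval_of_natDegree_lt (hθ : aeval θ (monicPoly c) = 0)
    {B : Module.Basis (Fin n) ℚ K} (hB : ∀ i, B i = θ ^ (i : ℕ)) {g : ℤ[X]}
    (hg : g.natDegree < n) (i : Fin n) : B.repr (aeval θ g) i = g.coeff i := by
  have : g %ₘ monicPoly c = g := by
    rw [modByMonic_eq_self_iff (monicPoly_monic c)]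
    exact degree_lt_degree (by rwa [monicPoly_natDegree])
  rw [aeval_eq_sum_smul_basis hθ hB, this, B.repr_sum_self]

theorem aeval_monicPoly_cast (hθ : aeval θ (monicPoly c) = 0) :
    aeval θ (monicPoly fun i => (c i : ℚ)) = 0 := by
  have := monicPoly_map (Int.castRingHom ℚ) c
  simp only [eq_intCast] at this
  rw [← this, ← algebraMap_int_eq, aeval_map_algebraMap, hθ]

variable [CharZero K] {q : ℤ[X]} {p r s b : ℤ} {hp : p ≠ 0}

theorem quotient_natDegree (hn : 2 ≤ n) (hq : monicPoly c = (X - C r) * q + C (p ^ 2 * s)) :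
    q.natDegree + 1 = n ∧ q.leadingCoeff = 1 := by
  have hm := monicPoly_monic c
  have hd := monicPoly_natDegree c
  have hq0 : q ≠ 0 := by
    rintro rfl
    rw [hq, mul_zero, zero_add, natDegree_C] at hd
    omega
  have h1 : ((X - C r) * q).natDegree = 1 + q.natDegree := by
    rw [(monic_X_sub_C r).natDegree_mul' hq0, natDegree_X_sub_C]
  have h2 : monicPoly c - C (p ^ 2 * s) = (X - C r) * q := by rw [hq]; ring
  have h3 : (monicPoly c - C (p ^ 2 * s)).natDegree = n := by
    rw [natDegree_sub_C, hd]
  have h4 : q.natDegree + 1 = n := by rw [← h3, h2, h1, add_comm]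
  refine ⟨h4, ?_⟩
  have h5 : (monicPoly c - C (p ^ 2 * s)).leadingCoeff = 1 := by
    rw [leadingCoeff, h3, coeff_sub, coeff_C, if_neg (by omega), sub_zero]
    have := hm.coeff_natDegree
    rwa [hd] at this
  rw [h2, leadingCoeff_mul, leadingCoeff_X_sub_C, one_mul] at h5
  exact h5

theorem quotient_coeff_last (hn : 2 ≤ n) (hq : monicPoly c = (X - C r) * q + C (p ^ 2 * s))
    {i : Fin n} (hi : (i : ℕ) + 1 = n) : q.coeff i = 1 := by
  obtain ⟨h, h'⟩ := quotient_natDegree hn hq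
  have : (i : ℕ) = q.natDegree := by omega
  rw [this]; exact h'

theorem quotient_coeff_penultimate (hn : 2 ≤ n)
    (hq : monicPoly c = (X - C r) * q + C (p ^ 2 * s)) (hc : ∀ i : Fin n, (i : ℕ) + 1 = n → c i = 0)
    {i : Fin n} (hi : (i : ℕ) + 2 = n) : q.coeff i = r := by
  have h1 := monicPoly_coeff c ⟨n - 1, by omega⟩
  rw [hc _ (by simp; omega)] at h1
  have h2 := quotient_coeff_last hn hq (i := ⟨n - 1, by omega⟩) (by simp; omega)
  obtain ⟨m, rfl⟩ : ∃ m, n = m + 2 := ⟨n - 2, by omega⟩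
  have hi' : (i : ℕ) = m := by omega
  simp only [show m + 2 - 1 = m + 1 by omega] at h1 h2
  rw [hq, coeff_add, coeff_C, if_neg (by omega), sub_mul, coeff_sub, coeff_X_mul, coeff_C_mul,
    h2] at h1
  rw [hi']
  linarith

theorem mem_divOrder_repr (hθ : aeval θ (monicPoly c) = 0)
    {B : Module.Basis (Fin n) ℚ K} (hB : ∀ i, B i = θ ^ (i : ℕ)) (hn : 2 ≤ n)
    (hq : monicPoly c = (X - C r) * q + C (p ^ 2 * s))
    {hf : aeval θ ((X - C r) * q + C (p ^ 2 * s)) = 0} {hb : q.eval r = p * b} {x : K}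
    (hx : x ∈ divOrder q p r s b θ hp hf hb) :
    ∃ (z : Fin n → ℤ) (k : ℤ), ∀ i, B.repr x i = z i + k * q.coeff i / p := by
  obtain ⟨g, k, rfl⟩ := mem_divOrder.1 hx
  refine ⟨fun i => (g %ₘ monicPoly c).coeff i, k, fun i => ?_⟩
  have h1 : (k : K) * (aeval θ q / (p : K)) = ((k : ℚ) / p) • aeval θ q := by
    rw [Algebra.smul_def]
    simp
    ring
  have h2 : q.natDegree < n := by have := (quotient_natDegree hn hq).1; omega
  rw [h1, map_add, map_smul, Finsupp.add_apply, Finsupp.smul_apply,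
    repr_aeval_of_natDegree_lt hθ hB h2, aeval_eq_sum_smul_basis hθ hB g, B.repr_sum_self,
    smul_eq_mul]
  ring

/-- The family `1, θ, …, θ ^ (n - 2), q(θ) / p`. -/
def divFamily (n : ℕ) (q : ℤ[X]) (p : ℤ) (θ : K) (i : Fin n) : K :=
  if (i : ℕ) + 1 = n then aeval θ q / (p : K) else θ ^ (i : ℕ)

theorem det_toMatrix_divFamily (hθ : aeval θ (monicPoly c) = 0)
    {B : Module.Basis (Fin n) ℚ K} (hB : ∀ i, B i = θ ^ (i : ℕ)) (hn : 2 ≤ n)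
    (hq : monicPoly c = (X - C r) * q + C (p ^ 2 * s)) :
    (B.toMatrix (divFamily n q p θ)).det = (p : ℚ)⁻¹ := by
  have h2 : q.natDegree < n := by have := (quotient_natDegree hn hq).1; omega
  have hent : ∀ i j, B.toMatrix (divFamily n q p θ) i j =
      if (j : ℕ) + 1 = n then (q.coeff i : ℚ) / p else if j = i then 1 else 0 := by
    intro i j
    rw [Module.Basis.toMatrix_apply, divFamily]
    split_ifs with h h'
    · have h1 : aeval θ q / (p : K) = ((p : ℚ)⁻¹) • aeval θ q := by
        rw [Algebra.smul_def]
        simp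
        ring
      rw [h1, map_smul, Finsupp.smul_apply, repr_aeval_of_natDegree_lt hθ hB h2, smul_eq_mul]
      ring
    · rw [← hB, h', B.repr_self, Finsupp.single_eq_same]
    · rw [← hB, B.repr_self, Finsupp.single_eq_of_ne (Ne.symm h')]
  rw [Matrix.det_of_isUpperTriangular]
  · rw [Finset.prod_eq_single ⟨n - 1, by omega⟩]
    · rw [hent, if_pos (by simp; omega), quotient_coeff_last hn hq (by simp; omega)]
      simp
    · intro i _ hi
      rw [hent, if_neg, if_pos rfl]
      intro h
      exact hi (Fin.ext (by simp; omega))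
    · simp
  · intro i j hij
    have hij' : j < i := hij
    rw [hent, if_neg (by omega), if_neg hij'.ne]

theorem exists_basis_divFamily (hθ : aeval θ (monicPoly c) = 0) (hp : p ≠ 0)
    {B : Module.Basis (Fin n) ℚ K} (hB : ∀ i, B i = θ ^ (i : ℕ)) (hn : 2 ≤ n)
    (hq : monicPoly c = (X - C r) * q + C (p ^ 2 * s)) :
    ∃ b' : Module.Basis (Fin n) ℚ K, ⇑b' = divFamily n q p θ := by
  have h : IsUnit (B.det (divFamily n q p θ)) := by
    rw [Module.Basis.det_apply, det_toMatrix_divFamily hθ hB hn hq]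
    exact isUnit_iff_ne_zero.2 (inv_ne_zero (Int.cast_ne_zero.2 hp))
  obtain ⟨h1, h2⟩ := (Module.Basis.is_basis_iff_det B).2 h
  exact ⟨Module.Basis.mk h1 h2.ge, Module.Basis.coe_mk _ _⟩

theorem mem_divOrder_iff (hθ : aeval θ (monicPoly c) = 0)
    {B : Module.Basis (Fin n) ℚ K} (hB : ∀ i, B i = θ ^ (i : ℕ)) (hn : 2 ≤ n)
    (hq : monicPoly c = (X - C r) * q + C (p ^ 2 * s))
    {hf : aeval θ ((X - C r) * q + C (p ^ 2 * s)) = 0} {hb : q.eval r = p * b}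
    {b' : Module.Basis (Fin n) ℚ K} (hb' : ⇑b' = divFamily n q p θ) (x : K) :
    x ∈ divOrder q p r s b θ hp hf hb ↔ ∀ i, ∃ z : ℤ, b'.repr x i = z := by
  have hpK : (p : K) ≠ 0 := Int.cast_ne_zero.2 hp
  have hdeg := (quotient_natDegree hn hq).1
  have hspan := b'.mem_span_iff_repr_mem ℤ x
  simp only [Set.mem_range, algebraMap_int_eq, eq_intCast] at hspan
  have hspan' : (∀ i, ∃ z : ℤ, b'.repr x i = z) ↔ x ∈ Submodule.span ℤ (Set.range b') := by
    rw [hspan]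
    exact forall_congr' fun i => exists_congr fun z => eq_comm
  rw [hspan']
  have hω : aeval θ q / (p : K) ∈ Submodule.span ℤ (Set.range b') :=
    Submodule.subset_span ⟨⟨n - 1, by omega⟩, by rw [hb', divFamily, if_pos (by simp; omega)]⟩
  have hlow : ∀ i, i + 1 < n → θ ^ i ∈ Submodule.span ℤ (Set.range b') := fun i hi =>
    Submodule.subset_span ⟨⟨i, by omega⟩, by rw [hb', divFamily, if_neg (by simp; omega)]⟩
  constructor
  · intro hx
    obtain ⟨g, k, rfl⟩ := mem_divOrder.1 hx
    have hall : ∀ i < n, θ ^ i ∈ Submodule.span ℤ (Set.range b') := by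
      intro i hi
      by_cases hi' : i + 1 < n
      · exact hlow i hi'
      · have hi2 : i = q.natDegree := by omega
        have h1 : θ ^ i = p • (aeval θ q / (p : K)) -
            ∑ j ∈ Finset.range q.natDegree, q.coeff j • θ ^ j := by
          have h2 : aeval θ q = _ := aeval_eq_sum_range θ (p := q)
          rw [Finset.sum_range_succ, coeff_natDegree, (quotient_natDegree hn hq).2, one_smul,
            ← hi2] at h2
          rw [zsmul_eq_mul, mul_div_cancel₀ _ hpK, h2, ← hi2]
          ring
        rw [h1]
        refine Submodule.sub_mem _ (Submodule.smul_mem _ _ hω) (Submodule.sum_mem _ fun j hj => ?_)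
        refine Submodule.smul_mem _ _ (hlow j ?_)
        have := Finset.mem_range.1 hj
        omega
    rw [aeval_eq_sum_smul_basis hθ hB g]
    refine Submodule.add_mem _ (Submodule.sum_mem _ fun i _ => ?_) ?_
    · rw [Int.cast_smul_eq_zsmul, hB]
      exact Submodule.smul_mem _ _ (hall i i.2)
    · rw [← zsmul_eq_mul]
      exact Submodule.smul_mem _ _ hω
  · intro hx
    have : Submodule.span ℤ (Set.range b') ≤
        AddSubgroup.toIntSubmodule (divOrder q p r s b θ hp hf hb).toAddSubgroup := by
      rw [Submodule.span_le]
      rintro _ ⟨i, rfl⟩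
      rw [hb', divFamily]
      split_ifs
      · exact div_mem_divOrder (hp := hp) (hf := hf) (hb := hb)
      · exact pow_mem (root_mem_divOrder (hp := hp) (hf := hf) (hb := hb)) _
    exact this hx

theorem det_trace_divFamily (hθ : aeval θ (monicPoly c) = 0) (hp : p ≠ 0)
    {B : Module.Basis (Fin n) ℚ K} (hB : ∀ i, B i = θ ^ (i : ℕ)) (hn : 2 ≤ n)
    (hq : monicPoly c = (X - C r) * q + C (p ^ 2 * s)) :
    (Matrix.of fun i j => Algebra.trace ℚ K (divFamily n q p θ i * divFamily n q p θ j)).det *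
      p ^ 2 = (powerSumMatrix fun i => (c i : ℚ)).det := by
  have h1 : Matrix.vecMul B ((B.toMatrix (divFamily n q p θ)).map (algebraMap ℚ K)) =
      divFamily n q p θ := by
    ext j
    rw [← B.sum_repr (divFamily n q p θ j)]
    simp only [Matrix.vecMul, dotProduct, Matrix.map_apply, Module.Basis.toMatrix_apply,
      Algebra.smul_def, mul_comm]
  have h2 := Algebra.discr_of_matrix_vecMul (A := ℚ) B (B.toMatrix (divFamily n q p θ))
  rw [h1, det_toMatrix_divFamily hθ hB hn hq] at h2
  have h3 : Algebra.discr ℚ (divFamily n q p θ) =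
      (Matrix.of fun i j =>
        Algebra.trace ℚ K (divFamily n q p θ i * divFamily n q p θ j)).det := rfl
  have h4 : Algebra.discr ℚ B = (powerSumMatrix fun i => (c i : ℚ)).det := by
    rw [Algebra.discr]
    congr 1
    ext i j
    rw [Algebra.traceMatrix_apply, Algebra.traceForm_apply, hB, hB, ← pow_add,
      trace_pow_eq_powerSum (aeval_monicPoly_cast hθ) B hB]
    rfl
  have hpQ : (p : ℚ) ≠ 0 := Int.cast_ne_zero.2 hp
  rw [← h3, h2, h4]
  field_simp

end DivOrderBasis

section Rigidity

open Polynomial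

theorem isFractionRing_of_basis_mem {K : Type*} [Field K] [Algebra ℚ K] {n : ℕ}
    (B : Module.Basis (Fin n) ℚ K) (S : Subring K) (hS : ∀ i, B i ∈ S) : IsFractionRing S K := by
  have : CharZero K := algebraRat.charZero K
  refine IsFractionRing.of_field S K fun x => ?_
  obtain ⟨d, hd⟩ := IsLocalization.exist_integer_multiples_of_finite (nonZeroDivisors ℤ)
    (B.repr x)
  choose z hz using hd
  have hd0 : ((d : ℤ) : K) ≠ 0 := Int.cast_ne_zero.2 (nonZeroDivisors.coe_ne_zero d)
  have hx : ((d : ℤ) : K) * x = ∑ i, (z i : K) * B i := by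
    conv_lhs => rw [← B.sum_repr x]
    rw [Finset.mul_sum]
    refine Finset.sum_congr rfl fun i _ => ?_
    have h := congrArg (algebraMap ℚ K) (hz i)
    simp only [algebraMap_int_eq, eq_intCast, map_intCast, zsmul_eq_mul, map_mul] at h
    rw [h, Algebra.smul_def, mul_assoc]
  refine ⟨⟨∑ i, (z i : K) * B i, sum_mem fun i _ => mul_mem (intCast_mem S _) (hS i)⟩,
    ⟨((d : ℤ) : K), intCast_mem S _⟩, ?_⟩
  change x = (∑ i, (z i : K) * B i) / ((d : ℤ) : K)
  rw [← hx, mul_div_cancel_left₀ _ hd0]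

/-- A presentation of an order in a number field as `ℤ[θ] + ℤ q(θ)/p`. -/
structure DivModel (n : ℕ) (c : Fin n → ℤ) (p r : ℤ) where
  K : Type
  [field : Field K]
  [charZero : CharZero K]
  [algebra : Algebra ℚ K]
  θ : K
  root : aeval θ (monicPoly c) = 0
  B : Module.Basis (Fin n) ℚ K
  B_apply : ∀ i, B i = θ ^ (i : ℕ)
  q : ℤ[X]
  s : ℤ
  b : ℤ
  ne_zero : p ≠ 0
  eq_mul : monicPoly c = (X - C r) * q + C (p ^ 2 * s)
  eval_eq : q.eval r = p * b

attribute [instance] DivModel.field DivModel.charZero DivModel.algebra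

namespace DivModel

variable {n : ℕ} {c c' : Fin n → ℤ} {p r p' r' : ℤ}

/-- The order `ℤ[θ] + ℤ q(θ)/p`. -/
def order (M : DivModel n c p r) : Subring M.K :=
  divOrder M.q p r M.s M.b M.θ M.ne_zero (M.eq_mul ▸ M.root) M.eval_eq

theorem root_mem (M : DivModel n c p r) : M.θ ∈ M.order := root_mem_divOrder

theorem div_mem (M : DivModel n c p r) : aeval M.θ M.q / (p : M.K) ∈ M.order := div_mem_divOrder

theorem isFractionRing (M : DivModel n c p r) : IsFractionRing M.order M.K :=
  isFractionRing_of_basis_mem M.B _ fun i => M.B_apply i ▸ pow_mem M.root_mem _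

theorem exists_algEquiv (M : DivModel n c p r) (M' : DivModel n c' p' r')
    (h : StructIso M.order.toCommRing M'.order.toCommRing) :
    ∃ Φ : M.K ≃ₐ[ℚ] M'.K, ∀ x, x ∈ M.order ↔ Φ x ∈ M'.order := by
  obtain ⟨φ⟩ := h
  have := M.isFractionRing
  have := M'.isFractionRing
  let Φ : M.K ≃+* M'.K := IsFractionRing.ringEquivOfRingEquiv φ
  have hΦ : ∀ a : M.order, Φ a = φ a := IsFractionRing.ringEquivOfRingEquiv_algebraMap φ
  refine ⟨Φ.toRatAlgEquiv, fun x => ⟨fun hx => ?_, fun hx => ?_⟩⟩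
  · change Φ x ∈ _
    rw [hΦ ⟨x, hx⟩]
    exact Subtype.property _
  · have hx' : Φ x ∈ M'.order := hx
    have h1 : Φ (φ.symm ⟨Φ x, hx'⟩) = Φ x := by rw [hΦ, RingEquiv.apply_symm_apply]
    rw [← Φ.injective h1]
    exact Subtype.property _

theorem trace_pow (M : DivModel n c p r) (k : ℕ) :
    Algebra.trace ℚ M.K (M.θ ^ k) = powerSum (fun i => (c i : ℚ)) k :=
  trace_pow_eq_powerSum (aeval_monicPoly_cast M.root) M.B M.B_apply k

theorem trace_pow_real (M : DivModel n c p r) (k : ℕ) :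
    ((Algebra.trace ℚ M.K (M.θ ^ k) : ℚ) : ℝ) = powerSum (fun i => (c i : ℝ)) k := by
  rw [M.trace_pow, ← eq_ratCast (Rat.castHom ℝ), ← powerSum_map]
  simp

theorem trace_sq_real (M : DivModel n c p r) (x : M.K) :
    ((Algebra.trace ℚ M.K (x ^ 2) : ℚ) : ℝ) = ∑ l, ∑ j, (M.B.repr x l : ℝ) * (M.B.repr x j : ℝ) *
      powerSum (fun i => (c i : ℝ)) (l + j) := by
  rw [trace_sq_eq (aeval_monicPoly_cast M.root) M.B M.B_apply]
  push_cast
  simp only [← M.trace_pow_real, M.trace_pow]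

end DivModel

/-- The real conditions on `X ^ n + ∑ i, c i * X ^ i` which make the root the shortest
traceless vector of the order. -/
structure IsReducedCoeff {n : ℕ} (κ D H : ℝ) (c : Fin n → ℤ) : Prop where
  last : ∀ i : Fin n, (i : ℕ) + 1 = n → c i = 0
  two : powerSum (fun i => (c i : ℝ)) 2 ≤ D * H ^ 2
  three : powerSum (fun i => (c i : ℝ)) 3 < 0
  coercive : ∀ (u : Fin n → ℝ) (i : Fin n), κ * (u i * H ^ (i : ℕ)) ^ 2 ≤
    ∑ l : Fin n, ∑ j : Fin n, u l * u j * powerSum (fun i => (c i : ℝ)) (l + j)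

theorem powerSum_zero {R : Type*} [CommRing R] {n : ℕ} (a : Fin n → R) : powerSum a 0 = n := by
  simp [powerSum]

theorem powerSum_one {R : Type*} [CommRing R] {n : ℕ} {a : Fin n → R}
    (ha : ∀ i : Fin n, (i : ℕ) + 1 = n → a i = 0) : powerSum a 1 = 0 := by
  rw [powerSum, pow_one]
  refine Finset.sum_eq_zero fun i _ => ?_
  by_cases hi : (i : ℕ) + 1 = n <;> simp [companionMatrix, hi, ha]

namespace DivModel

variable {n : ℕ} {c c' : Fin n → ℤ} {p r p' r' : ℤ} {κ D H : ℝ}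

theorem exists_eq_int_mul (hn : 4 ≤ n) (hκ : 0 < κ) (hH : 1 ≤ H) (hDH : D < κ * H ^ 2)
    (hc : IsReducedCoeff κ D H c) (hc' : IsReducedCoeff κ D H c')
    (hp' : D * (p' : ℝ) ^ 2 < κ * H ^ (2 * (n - 2)))
    (M : DivModel n c p r) (M' : DivModel n c' p' r') (Φ : M.K ≃ₐ[ℚ] M'.K)
    (hΦ : ∀ x, x ∈ M.order → Φ x ∈ M'.order) : ∃ m : ℤ, Φ M.θ = m * M'.θ := by
  have hp0 : (p' : ℝ) ≠ 0 := Int.cast_ne_zero.2 M'.ne_zero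
  have hpQ : (p' : ℚ) ≠ 0 := Int.cast_ne_zero.2 M'.ne_zero
  have hH0 : 0 < H := by linarith
  obtain ⟨z, k, hzk⟩ := mem_divOrder_repr M'.root M'.B_apply (by omega) M'.eq_mul
    (hΦ _ M.root_mem)
  have hbound : ∀ i : Fin n, κ * ((M'.B.repr (Φ M.θ) i : ℝ) * H ^ (i : ℕ)) ^ 2 ≤ D * H ^ 2 := by
    intro i
    refine (hc'.coercive (fun i => (M'.B.repr (Φ M.θ) i : ℝ)) i).trans ?_
    rw [← M'.trace_sq_real, ← map_pow, Algebra.trace_eq_of_algEquiv, M.trace_pow_real]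
    exact hc.two
  set e : Fin n := ⟨n - 1, by omega⟩ with he
  have hqe : M'.q.coeff e = 1 := quotient_coeff_last (by omega) M'.eq_mul (by simp [he]; omega)
  have hk : z e * p' + k = 0 := by
    have h1 := hbound e
    have h2 : (M'.B.repr (Φ M.θ) e : ℝ) = ((z e * p' + k : ℤ) : ℝ) / p' := by
      rw [hzk, hqe]
      push_cast
      field_simp
    rw [h2] at h1
    have h3 : κ * H ^ (2 * (n - 2)) * (((z e * p' + k : ℤ) : ℝ)) ^ 2 ≤ D * (p' : ℝ) ^ 2 := by
      have h4 : (H : ℝ) ^ (e : ℕ) = H * H ^ (n - 2) := by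
        rw [← pow_succ']; congr 1; simp [he]; omega
      rw [h4] at h1
      have h5 : κ * (((z e * p' + k : ℤ) : ℝ) / p' * (H * H ^ (n - 2))) ^ 2 =
          (κ * H ^ (2 * (n - 2)) * (((z e * p' + k : ℤ) : ℝ)) ^ 2 / (p' : ℝ) ^ 2) * H ^ 2 := by
        rw [mul_comm 2 (n - 2), pow_mul]
        ring
      rw [h5] at h1
      have h6 := le_of_mul_le_mul_right h1 (by positivity)
      rwa [div_le_iff₀ (by positivity)] at h6
    have h4 : (((z e * p' + k : ℤ) : ℝ)) ^ 2 < 1 := by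
      by_contra hcon
      have : κ * H ^ (2 * (n - 2)) * 1 ≤ κ * H ^ (2 * (n - 2)) * (((z e * p' + k : ℤ) : ℝ)) ^ 2 :=
        mul_le_mul_of_nonneg_left (not_lt.1 hcon) (by positivity)
      linarith
    have h5 : (z e * p' + k) ^ 2 < 1 := by exact_mod_cast h4
    nlinarith [sq_nonneg (z e * p' + k), (pow_eq_zero_iff (two_ne_zero)).1
      (show (z e * p' + k) ^ 2 = 0 by have := sq_nonneg (z e * p' + k); omega)]
  have h_coord : ∀ i, M'.B.repr (Φ M.θ) i = ((z i - z e * M'.q.coeff i : ℤ) : ℚ) := by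
    intro i
    have hk' : (k : ℚ) = -(z e * p') := by
      have : (z e * p' + k : ℚ) = 0 := by exact_mod_cast hk
      linarith
    rw [hzk, hk']
    push_cast
    field_simp
    ring
  have hhigh : ∀ i : Fin n, 2 ≤ (i : ℕ) → M'.B.repr (Φ M.θ) i = 0 := by
    intro i hi
    have h1 := hbound i
    set m : ℤ := z i - z e * M'.q.coeff i with hm
    rw [h_coord i, ← hm] at h1
    rw [h_coord i]
    have h2 : (((m : ℚ) : ℝ)) ^ 2 < 1 := by
      by_contra hcon
      rw [not_lt] at hcon
      have h3 : H ^ 2 ≤ H ^ (i : ℕ) := pow_le_pow_right₀ hH hi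
      have h4 : (H ^ 2) ^ 2 ≤ (((m : ℚ) : ℝ) * H ^ (i : ℕ)) ^ 2 := by
        rw [mul_pow]
        have : (H ^ 2) ^ 2 ≤ (H ^ (i : ℕ)) ^ 2 := pow_le_pow_left₀ (by positivity) h3 2
        nlinarith [sq_nonneg (H ^ (i : ℕ))]
      have h5 : D * H ^ 2 < κ * (H ^ 2) ^ 2 := by nlinarith [sq_nonneg H, pow_pos hH0 2]
      nlinarith [mul_le_mul_of_nonneg_left h4 hκ.le]
    have h3 : m ^ 2 < 1 := by exact_mod_cast h2
    have h4 : m = 0 := by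
      have := sq_nonneg m
      exact (pow_eq_zero_iff two_ne_zero).1 (by omega)
    rw [← hm, h4, Int.cast_zero]
  set i0 : Fin n := ⟨0, by omega⟩ with hi0
  set i1 : Fin n := ⟨1, by omega⟩ with hi1
  have hexp : Φ M.θ = M'.B.repr (Φ M.θ) i0 • 1 + M'.B.repr (Φ M.θ) i1 • M'.θ := by
    conv_lhs => rw [← M'.B.sum_repr (Φ M.θ)]
    rw [Finset.sum_eq_add i0 i1 (by simp [hi0, hi1])]
    · rw [M'.B_apply, M'.B_apply, pow_zero, pow_one]
    · intro i _ hi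
      have : 2 ≤ (i : ℕ) := by
        have h0 : (i : ℕ) ≠ 0 := fun h => hi.1 (Fin.ext h)
        have h1 : (i : ℕ) ≠ 1 := fun h => hi.2 (Fin.ext h)
        omega
      rw [hhigh i this, zero_smul]
    · simp
    · simp
  have hlast : ∀ {c : Fin n → ℤ}, (∀ i : Fin n, (i : ℕ) + 1 = n → c i = 0) →
      powerSum (fun i => (c i : ℚ)) 1 = 0 := fun h => powerSum_one fun i hi => by simp [h i hi]
  have htr : M'.B.repr (Φ M.θ) i0 = 0 := by
    have h1 := congrArg (Algebra.trace ℚ M'.K) hexp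
    have h2 := M.trace_pow 1
    have h3 := M'.trace_pow 1
    have h4 := M'.trace_pow 0
    rw [hlast hc.last, pow_one] at h2
    rw [hlast hc'.last, pow_one] at h3
    rw [powerSum_zero, pow_zero] at h4
    rw [Algebra.trace_eq_of_algEquiv, map_add, map_smul, map_smul, h2, h3, h4, smul_zero,
      add_zero, smul_eq_mul] at h1
    have hn0 : (n : ℚ) ≠ 0 := Nat.cast_ne_zero.2 (by omega)
    exact (mul_eq_zero.1 h1.symm).resolve_right hn0
  refine ⟨z i1 - z e * M'.q.coeff i1, ?_⟩
  rw [htr, zero_smul, zero_add, h_coord i1, Int.cast_smul_eq_zsmul, zsmul_eq_mul] at hexp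
  exact hexp

theorem root_ne_zero (hn : 2 ≤ n) (M : DivModel n c p r) : M.θ ≠ 0 := by
  have := M.B.ne_zero ⟨1, by omega⟩
  rwa [M.B_apply, pow_one] at this

theorem map_root (hn : 4 ≤ n) (hκ : 0 < κ) (hH : 1 ≤ H) (hDH : D < κ * H ^ 2)
    (hc : IsReducedCoeff κ D H c) (hc' : IsReducedCoeff κ D H c')
    (hp : D * (p : ℝ) ^ 2 < κ * H ^ (2 * (n - 2)))
    (hp' : D * (p' : ℝ) ^ 2 < κ * H ^ (2 * (n - 2)))
    (M : DivModel n c p r) (M' : DivModel n c' p' r') (Φ : M.K ≃ₐ[ℚ] M'.K)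
    (hΦ : ∀ x, x ∈ M.order ↔ Φ x ∈ M'.order) : Φ M.θ = M'.θ := by
  obtain ⟨m, hm⟩ := exists_eq_int_mul hn hκ hH hDH hc hc' hp' M M' Φ fun x => (hΦ x).1
  obtain ⟨m', hm'⟩ := exists_eq_int_mul hn hκ hH hDH hc' hc hp M' M Φ.symm fun x hx =>
    (hΦ _).2 (by rwa [AlgEquiv.apply_symm_apply])
  have h1 : m * m' = 1 := by
    have h2 := Φ.symm_apply_apply M.θ
    rw [hm, map_mul, map_intCast, hm', ← mul_assoc] at h2
    have h3 := mul_right_cancel₀ (M.root_ne_zero (by omega)) (h2.trans (one_mul _).symm)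
    exact_mod_cast h3
  rcases Int.isUnit_iff.1 (IsUnit.of_mul_eq_one _ h1) with h | h
  · rw [hm, h, Int.cast_one, one_mul]
  · exfalso
    have h2 := M.trace_pow_real 3
    have h3 := M'.trace_pow_real 3
    rw [← Algebra.trace_eq_of_algEquiv Φ, map_pow, hm, h] at h2
    have h4 : (((-1 : ℤ) : M'.K) * M'.θ) ^ 3 = -(M'.θ ^ 3) := by push_cast; ring
    rw [h4, map_neg, Rat.cast_neg, h3] at h2
    linarith [hc.three, hc'.three]

theorem coeff_eq (M : DivModel n c p r) (M' : DivModel n c' p' r') (Φ : M.K ≃ₐ[ℚ] M'.K)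
    (hΦ : Φ M.θ = M'.θ) : c = c' := by
  have h1 := congrArg Φ (aeval_monicPoly_cast M.root)
  have h2 := aeval_monicPoly_cast M'.root
  rw [← AlgEquiv.coe_toAlgHom, ← aeval_algHom_apply, AlgEquiv.coe_toAlgHom, hΦ, map_zero] at h1
  simp only [monicPoly, map_add, map_sum, map_mul, aeval_C, map_pow, aeval_X] at h1 h2
  have h3 : ∑ i, ((c i : ℚ) - c' i) • M'.B i = 0 := by
    simp only [M'.B_apply, Algebra.smul_def, map_sub, sub_mul, Finset.sum_sub_distrib]
    linear_combination h1 - h2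
  have h4 := Fintype.linearIndependent_iff.1 M'.B.linearIndependent _ h3
  ext i
  have := sub_eq_zero.1 (h4 i)
  exact_mod_cast this

theorem exists_quotient_relation (hn : 2 ≤ n) (M : DivModel n c p r) (M' : DivModel n c' p' r')
    (Φ : M.K ≃ₐ[ℚ] M'.K) (hΦ : ∀ x, x ∈ M.order → Φ x ∈ M'.order) (hθ : Φ M.θ = M'.θ) :
    ∃ (z : Fin n → ℤ) (k : ℤ), ∀ i : Fin n, (M.q.coeff i : ℚ) / p = z i + k * M'.q.coeff i / p' := by
  obtain ⟨z, k, h⟩ := mem_divOrder_repr M'.root M'.B_apply hn M'.eq_mul (hΦ _ M.div_mem)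
  refine ⟨z, k, fun i => ?_⟩
  have h0 : Φ (aeval M.θ M.q) = aeval (Φ M.θ) M.q :=
    (aeval_algHom_apply (Φ : M.K →+* M'.K).toIntAlgHom M.θ M.q).symm
  rw [← h, map_div₀, map_intCast, h0, hθ]
  have h1 : aeval M'.θ M.q / (p : M'.K) = ((p : ℚ)⁻¹) • aeval M'.θ M.q := by
    rw [Algebra.smul_def]
    simp
    ring
  have h2 : M.q.natDegree < n := by have := (quotient_natDegree hn M.eq_mul).1; omega
  rw [h1, map_smul, Finsupp.smul_apply, repr_aeval_of_natDegree_lt M'.root M'.B_apply h2,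
    smul_eq_mul]
  ring

theorem dvd_of_map (hn : 2 ≤ n) (M : DivModel n c p r) (M' : DivModel n c' p' r')
    (Φ : M.K ≃ₐ[ℚ] M'.K) (hΦ : ∀ x, x ∈ M.order → Φ x ∈ M'.order) (hθ : Φ M.θ = M'.θ) :
    p ∣ p' := by
  obtain ⟨z, k, h⟩ := exists_quotient_relation hn M M' Φ hΦ hθ
  have h1 := h ⟨n - 1, by omega⟩
  rw [quotient_coeff_last hn M.eq_mul (by simp; omega),
    quotient_coeff_last hn M'.eq_mul (by simp; omega)] at h1
  have hp : (p : ℚ) ≠ 0 := Int.cast_ne_zero.2 M.ne_zero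
  have hp' : (p' : ℚ) ≠ 0 := Int.cast_ne_zero.2 M'.ne_zero
  field_simp at h1
  refine ⟨z ⟨n - 1, by omega⟩ * p' + k, ?_⟩
  have h2 : (p' : ℚ) = p * (z ⟨n - 1, by omega⟩ * p' + k) := by push_cast at h1; linarith
  exact_mod_cast h2

theorem rigid (hn : 4 ≤ n) (hκ : 0 < κ) (hH : 1 ≤ H) (hDH : D < κ * H ^ 2)
    (hc : IsReducedCoeff κ D H c) (hc' : IsReducedCoeff κ D H c')
    (hp : D * (p : ℝ) ^ 2 < κ * H ^ (2 * (n - 2)))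
    (hp' : D * (p' : ℝ) ^ 2 < κ * H ^ (2 * (n - 2)))
    (hr : 0 ≤ r ∧ r < p) (hr' : 0 ≤ r' ∧ r' < p')
    (M : DivModel n c p r) (M' : DivModel n c' p' r')
    (h : StructIso M.order.toCommRing M'.order.toCommRing) : c = c' ∧ p = p' ∧ r = r' := by
  obtain ⟨Φ, hΦ⟩ := M.exists_algEquiv M' h
  have hθ := map_root hn hκ hH hDH hc hc' hp hp' M M' Φ hΦ
  have hpp : p = p' := by
    refine Int.dvd_antisymm (by omega) (by omega)
      (dvd_of_map (by omega) M M' Φ (fun x => (hΦ x).1) hθ)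
      (dvd_of_map (by omega) M' M Φ.symm (fun x hx => (hΦ _).2 ?_) ?_)
    · rwa [AlgEquiv.apply_symm_apply]
    · rw [← hθ, AlgEquiv.symm_apply_apply]
  refine ⟨M.coeff_eq M' Φ hθ, hpp, ?_⟩
  subst hpp
  obtain ⟨z, k, h⟩ := exists_quotient_relation (by omega) M M' Φ (fun x => (hΦ x).1) hθ
  have h1 := h ⟨n - 1, by omega⟩
  have h2 := h ⟨n - 2, by omega⟩
  rw [quotient_coeff_last (by omega) M.eq_mul (by simp; omega),
    quotient_coeff_last (by omega) M'.eq_mul (by simp; omega)] at h1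
  rw [quotient_coeff_penultimate (by omega) M.eq_mul hc.last (by simp; omega),
    quotient_coeff_penultimate (by omega) M'.eq_mul hc'.last (by simp; omega)] at h2
  have hpQ : (p : ℚ) ≠ 0 := Int.cast_ne_zero.2 M.ne_zero
  field_simp at h1 h2
  have h1' : 1 = p * z ⟨n - 1, by omega⟩ + k := by
    have : (1 : ℚ) = p * z ⟨n - 1, by omega⟩ + k := by push_cast at h1; linarith
    exact_mod_cast this
  have h2' : r = p * z ⟨n - 2, by omega⟩ + k * r' := by exact_mod_cast h2
  have h3 : r ≡ r' [ZMOD p] := by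
    refine (Int.modEq_iff_dvd.2 ⟨z ⟨n - 1, by omega⟩ * r' - z ⟨n - 2, by omega⟩, ?_⟩)
    linear_combination r' * h1' - h2'
  rwa [Int.ModEq, Int.emod_eq_of_lt hr.1 hr.2, Int.emod_eq_of_lt hr'.1 hr'.2] at h3

end DivModel

end Rigidity

section Existence

open Polynomial

variable {n : ℕ}

theorem exists_divModel {c : Fin n → ℤ} {p r : ℤ} (hp : p ≠ 0)
    (hirr : Irreducible (monicPoly c)) (h₀ : p ^ 2 ∣ (monicPoly c).eval r)
    (h₁ : p ∣ (derivative (monicPoly c)).eval r) : Nonempty (DivModel n c p r) := by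
  have hmonic := monicPoly_monic c
  have hirr' : Irreducible ((monicPoly c).map (Int.castRingHom ℚ)) :=
    (IsPrimitive.Int.irreducible_iff_irreducible_map_cast hmonic.isPrimitive).1 hirr
  have hm' : ((monicPoly c).map (Int.castRingHom ℚ)).Monic := hmonic.map _
  have : Fact (Irreducible ((monicPoly c).map (Int.castRingHom ℚ))) := ⟨hirr'⟩
  obtain ⟨s, hs⟩ := h₀
  have heq : monicPoly c = (X - C r) * (monicPoly c /ₘ (X - C r)) + C (p ^ 2 * s) := by
    conv_lhs => rw [← modByMonic_add_div (monicPoly c) (X - C r), modByMonic_X_sub_C_eq_C_eval, hs,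
      add_comm]
  have hder : (derivative (monicPoly c)).eval r = (monicPoly c /ₘ (X - C r)).eval r := by
    conv_lhs => rw [heq]
    rw [derivative_add, derivative_C]
    simp
  obtain ⟨b, hb⟩ := h₁
  have hdim : (AdjoinRoot.powerBasis hm'.ne_zero).dim = n := by
    rw [AdjoinRoot.powerBasis_dim, hmonic.natDegree_map, monicPoly_natDegree]
  exact ⟨{
    K := AdjoinRoot ((monicPoly c).map (Int.castRingHom ℚ))
    charZero := algebraRat.charZero _
    θ := AdjoinRoot.root _
    root := by
      have h := AdjoinRoot.aeval_eq (f := (monicPoly c).map (Int.castRingHom ℚ))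
        ((monicPoly c).map (Int.castRingHom ℚ))
      rw [AdjoinRoot.mk_self] at h
      rwa [← algebraMap_int_eq, aeval_map_algebraMap] at h
    B := (AdjoinRoot.powerBasis hm'.ne_zero).basis.reindex (finCongr hdim)
    B_apply := fun i => by simp
    q := monicPoly c /ₘ (X - C r)
    s := s
    b := b
    ne_zero := hp
    eq_mul := heq
    eval_eq := hder ▸ hb }⟩

theorem DivModel.exists_structure (hn : 2 ≤ n) {c : Fin n → ℤ} {p r : ℤ}
    (M : DivModel n c p r) :
    ∃ inst : CommRing (Fin n → ℤ), (∀ x y, structAdd inst x y = x + y) ∧ StructIsDomain inst ∧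
      structDisc n inst * p ^ 2 = (powerSumMatrix c).det ∧
      StructIso inst M.order.toCommRing := by
  obtain ⟨b', hb'⟩ := exists_basis_divFamily M.root M.ne_zero M.B_apply hn M.eq_mul
  obtain ⟨inst, h1, h2, h3, h4⟩ := exists_structure_of_basis b' M.order
    (mem_divOrder_iff M.root M.B_apply hn M.eq_mul hb')
  refine ⟨inst, h1, h2, ?_, h4⟩
  have h5 := det_trace_divFamily M.root M.ne_zero M.B_apply hn M.eq_mul
  rw [hb'] at h3
  rw [← h3] at h5
  have h6 : (powerSumMatrix fun i => (c i : ℚ)).det = ((powerSumMatrix c).det : ℤ) := by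
    rw [← eq_intCast (Int.castRingHom ℚ), RingHom.map_det]
    congr 1
    ext i j
    simp only [powerSumMatrix, Matrix.of_apply, RingHom.mapMatrix_apply, Matrix.map_apply]
    rw [← powerSum_map]
    simp
  rw [h6] at h5
  exact_mod_cast h5

theorem det_powerSumMatrix_scale (a : Fin n → ℝ) {h : ℝ} (hh : h ≠ 0) :
    (powerSumMatrix fun i => h ^ (n - (i : ℕ)) * a i).det =
      h ^ (n * (n - 1)) * (powerSumMatrix a).det := by
  have h1 : (powerSumMatrix fun i => h ^ (n - (i : ℕ)) * a i) =
      Matrix.of fun i j : Fin n => h ^ (i : ℕ) *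
        (Matrix.of fun i j : Fin n => h ^ (j : ℕ) * powerSumMatrix a i j) i j := by
    ext i j
    simp only [powerSumMatrix, Matrix.of_apply, powerSum_scale a h hh]
    ring
  rw [h1, Matrix.det_mul_column, Matrix.det_mul_row, ← mul_assoc, Finset.prod_pow_eq_pow_sum,
    ← pow_add, Fin.sum_univ_eq_sum_range fun i => i, ← two_mul, mul_comm 2,
    Finset.sum_range_id_mul_two]

/-- Conditions on `(p, r, c)` guaranteeing that `X ^ n + ∑ i, c i * X ^ i` defines an order
`ℤ[θ] + ℤ q(θ)/p` of bounded discriminant with shortest traceless vector `θ`. -/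
structure IsAdmissible (a₀ : Fin n → ℝ) (ε H P : ℝ) (t : ℤ × ℤ × (Fin n → ℤ)) : Prop where
  le_p : P ≤ t.1
  p_le : t.1 ≤ 2 * P
  r_nonneg : 0 ≤ t.2.1
  r_lt : t.2.1 < t.1
  irreducible : Irreducible (monicPoly t.2.2)
  dvd_eval : t.1 ^ 2 ∣ (monicPoly t.2.2).eval t.2.1
  dvd_derivative : t.1 ∣ (derivative (monicPoly t.2.2)).eval t.2.1
  last : ∀ i : Fin n, (i : ℕ) + 1 = n → t.2.2 i = 0
  near : ∀ i, |(t.2.2 i : ℝ) - H ^ (n - (i : ℕ)) * a₀ i| ≤ ε * H ^ (n - (i : ℕ))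

theorem isReducedCoeff_of_near {a₀ : Fin n → ℝ} {ε κ D H : ℝ} (hH : 0 < H)
    (hnear : ∀ a : Fin n → ℝ, (∀ i, |a i - a₀ i| ≤ ε) → |(powerSumMatrix a).det| ≤ D ∧
      powerSum a 2 ≤ D ∧ powerSum a 3 < 0 ∧
      ∀ (w : Fin n → ℝ) (i : Fin n), κ * w i ^ 2 ≤
        ∑ l : Fin n, ∑ j : Fin n, w l * w j * powerSum a (l + j))
    {c : Fin n → ℤ} (hlast : ∀ i : Fin n, (i : ℕ) + 1 = n → c i = 0)
    (hc : ∀ i, |(c i : ℝ) - H ^ (n - (i : ℕ)) * a₀ i| ≤ ε * H ^ (n - (i : ℕ))) :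
    IsReducedCoeff κ D H c ∧ |((powerSumMatrix c).det : ℝ)| ≤ D * H ^ (n * (n - 1)) := by
  set a : Fin n → ℝ := fun i => c i / H ^ (n - (i : ℕ)) with ha
  have hca : (fun i => (c i : ℝ)) = fun i : Fin n => H ^ (n - (i : ℕ)) * a i := by
    ext i
    rw [ha]
    field_simp
  obtain ⟨h1, h2, h3, h4⟩ := hnear a fun i => by
    have hpos : 0 < H ^ (n - (i : ℕ)) := by positivity
    have : a i - a₀ i = (c i - H ^ (n - (i : ℕ)) * a₀ i) / H ^ (n - (i : ℕ)) := by
      rw [ha]; field_simp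
    rw [this, abs_div, abs_of_pos hpos, div_le_iff₀ hpos]
    exact hc i
  have hscale : ∀ k, powerSum (fun i => (c i : ℝ)) k = H ^ k * powerSum a k := fun k => by
    rw [hca, powerSum_scale a H hH.ne']
  refine ⟨⟨hlast, ?_, ?_, fun u i => ?_⟩, ?_⟩
  · rw [hscale, mul_comm]
    exact mul_le_mul_of_nonneg_right h2 (by positivity)
  · rw [hscale]
    exact mul_neg_of_pos_of_neg (by positivity) h3
  · refine (h4 (fun i => u i * H ^ (i : ℕ)) i).trans (le_of_eq ?_)
    refine Finset.sum_congr rfl fun l _ => Finset.sum_congr rfl fun j _ => ?_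
    rw [hscale]
    ring
  · have h5 : ((powerSumMatrix c).det : ℝ) = (powerSumMatrix fun i => (c i : ℝ)).det := by
      rw [← eq_intCast (Int.castRingHom ℝ), RingHom.map_det]
      congr 1
      ext i j
      simp only [powerSumMatrix, Matrix.of_apply, RingHom.mapMatrix_apply, Matrix.map_apply]
      rw [← powerSum_map]
      simp
    rw [h5, hca, det_powerSumMatrix_scale a hH.ne', abs_mul, abs_of_pos (by positivity), mul_comm]
    exact mul_le_mul_of_nonneg_right h1 (by positivity)

theorem exists_family (hn : 4 ≤ n) {a₀ : Fin n → ℝ} {ε κ D H P Y : ℝ} (hκ : 0 < κ) (hD : 0 < D)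
    (hnear : ∀ a : Fin n → ℝ, (∀ i, |a i - a₀ i| ≤ ε) → |(powerSumMatrix a).det| ≤ D ∧
      powerSum a 2 ≤ D ∧ powerSum a 3 < 0 ∧
      ∀ (w : Fin n → ℝ) (i : Fin n), κ * w i ^ 2 ≤
        ∑ l : Fin n, ∑ j : Fin n, w l * w j * powerSum a (l + j))
    (hH : 1 ≤ H) (hDH : D < κ * H ^ 2) (hP : 0 < P)
    (hPH : D * (2 * P) ^ 2 < κ * H ^ (2 * (n - 2))) (hY : D * H ^ (n * (n - 1)) ≤ Y * P ^ 2)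
    (T : Finset (ℤ × ℤ × (Fin n → ℤ))) (hT : ∀ t ∈ T, IsAdmissible a₀ ε H P t) :
    ∃ inst : Fin T.card → CommRing (Fin n → ℤ),
      (∀ i, ∀ x y : Fin n → ℤ, structAdd (inst i) x y = x + y) ∧
      (∀ i, StructIsDomain (inst i)) ∧
      (∀ i, (|structDisc n (inst i)| : ℝ) ≤ Y) ∧
      (∀ i j, i ≠ j → ¬ StructIso (inst i) (inst j)) := by
  have key : ∀ t : T, ∃ inst : CommRing (Fin n → ℤ),
      (∀ x y : Fin n → ℤ, structAdd inst x y = x + y) ∧ StructIsDomain inst ∧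
      (|structDisc n inst| : ℝ) ≤ Y ∧
      ∃ M : DivModel n t.1.2.2 t.1.1 t.1.2.1, StructIso inst M.order.toCommRing := by
    rintro ⟨⟨p, r, c⟩, ht⟩
    have ha := hT _ ht
    have hle : P ≤ (p : ℝ) := ha.le_p
    have hp0 : 0 < (p : ℝ) := hP.trans_le hle
    have hpz : p ≠ 0 := by rintro rfl; simp at hp0
    obtain ⟨M⟩ := exists_divModel hpz ha.irreducible ha.dvd_eval ha.dvd_derivative
    obtain ⟨inst, h1, h2, h3, h4⟩ := M.exists_structure (by omega)
    refine ⟨inst, h1, h2, ?_, M, h4⟩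
    have h5 := (isReducedCoeff_of_near (by linarith) hnear ha.last ha.near).2
    have h6 : (structDisc n inst : ℝ) * (p : ℝ) ^ 2 = ((powerSumMatrix c).det : ℝ) := by
      exact_mod_cast h3
    simp only at h5
    rw [← h6, abs_mul, abs_of_pos (pow_pos hp0 2)] at h5
    have h7 : |(structDisc n inst : ℝ)| * P ^ 2 ≤ |(structDisc n inst : ℝ)| * (p : ℝ) ^ 2 :=
      mul_le_mul_of_nonneg_left (pow_le_pow_left₀ hP.le hle 2) (abs_nonneg _)
    exact le_of_mul_le_mul_right (h7.trans (h5.trans hY)) (by positivity)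
  choose inst h1 h2 h3 M h4 using key
  refine ⟨fun i => inst (T.equivFin.symm i), fun i => h1 _, fun i => h2 _, fun i => h3 _,
    fun i j hij hiso => hij ?_⟩
  have hbound : ∀ t : T, D * ((t.1.1 : ℤ) : ℝ) ^ 2 < κ * H ^ (2 * (n - 2)) := fun t => by
    refine lt_of_le_of_lt (mul_le_mul_of_nonneg_left ?_ hD.le) hPH
    exact pow_le_pow_left₀ (hP.le.trans (hT _ t.2).le_p) (hT _ t.2).p_le 2
  have hred : ∀ t : T, IsReducedCoeff κ D H t.1.2.2 := fun t =>
    (isReducedCoeff_of_near (by linarith) hnear (hT _ t.2).last (hT _ t.2).near).1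
  obtain ⟨e1, e2, e3⟩ := DivModel.rigid hn hκ hH hDH (hred _) (hred _) (hbound _) (hbound _)
    ⟨(hT _ (Subtype.property _)).r_nonneg, (hT _ (Subtype.property _)).r_lt⟩
    ⟨(hT _ (Subtype.property _)).r_nonneg, (hT _ (Subtype.property _)).r_lt⟩
    (M (T.equivFin.symm i)) (M (T.equivFin.symm j))
    (((h4 _).symm.trans hiso).trans (h4 _))
  exact T.equivFin.symm.injective (Subtype.ext (Prod.ext e2 (Prod.ext e3 e1)))

end Existence

section Center

open Polynomial

theorem irreducible_monicPoly {n : ℕ} (hn : 0 < n) {c : Fin n → ℤ} (hc : ∀ i, 2 ∣ c i)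
    (hc0 : ¬ 4 ∣ c ⟨0, hn⟩) : Irreducible (monicPoly c) := by
  have hdeg : (monicPoly c).degree = n := by
    rw [degree_eq_natDegree (monicPoly_monic c).ne_zero, monicPoly_natDegree]
  refine irreducible_of_eisenstein_criterion (P := Ideal.span {(2 : ℤ)}) ?_ ?_ ?_ ?_ ?_
    (monicPoly_monic c).isPrimitive
  · rw [Ideal.span_singleton_prime two_ne_zero]
    exact Int.prime_two
  · rw [(monicPoly_monic c).leadingCoeff, Ideal.mem_span_singleton]
    norm_num
  · intro i hi
    rw [hdeg, Nat.cast_lt] at hi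
    rw [Ideal.mem_span_singleton]
    exact (monicPoly_coeff c ⟨i, hi⟩) ▸ hc _
  · rw [hdeg]
    exact_mod_cast hn
  · rw [Ideal.span_singleton_pow, Ideal.mem_span_singleton]
    have := monicPoly_coeff c ⟨0, hn⟩
    simp only at this
    rw [this]
    exact hc0

/-- Rounding in the lattice `4 ⟨ℓ², ℓ ℓ', ℓ'²⟩` of binary quadratic forms, for
`ℓ = u X + v` and `ℓ' = u' X + v'`. -/
theorem exists_quadratic_near {u v u' v' : ℤ} (hdet : u * v' - u' * v ≠ 0) {A B : ℝ}
    (hu : |(u : ℝ)| ≤ A) (hu' : |(u' : ℝ)| ≤ A) (hv : |(v : ℝ)| ≤ B) (hv' : |(v' : ℝ)| ≤ B)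
    (t₀ t₁ t₂ : ℝ) : ∃ α β γ : ℤ,
      |4 * (α * v ^ 2 + β * (v * v') + γ * v' ^ 2 : ℝ) - t₀| ≤ 12 * B ^ 2 ∧
      |4 * (α * (2 * u * v) + β * (u * v' + u' * v) + γ * (2 * u' * v') : ℝ) - t₁| ≤
        24 * (A * B) ∧
      |4 * (α * u ^ 2 + β * (u * u') + γ * u' ^ 2 : ℝ) - t₂| ≤ 12 * A ^ 2 := by
  have hd : (u * v' - u' * v : ℝ) ≠ 0 := by exact_mod_cast hdet
  set d : ℝ := u * v' - u' * v with hd_def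
  have hA : 0 ≤ A := (abs_nonneg _).trans hu
  have hB : 0 ≤ B := (abs_nonneg _).trans hv
  set x : ℝ := (t₂ * v' ^ 2 - t₁ * v' * u' + t₀ * u' ^ 2) / (4 * d ^ 2) with hx
  set y : ℝ := (-2 * t₂ * v * v' + t₁ * (v' * u + v * u') - 2 * t₀ * u * u') / (4 * d ^ 2) with hy
  set z : ℝ := (t₂ * v ^ 2 - t₁ * v * u + t₀ * u ^ 2) / (4 * d ^ 2) with hz
  have e₀ : t₀ = 4 * (x * v ^ 2 + y * (v * v') + z * v' ^ 2) := by
    rw [hx, hy, hz]; field_simp; rw [hd_def]; ring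
  have e₁ : t₁ = 4 * (x * (2 * u * v) + y * (u * v' + u' * v) + z * (2 * u' * v')) := by
    rw [hx, hy, hz]; field_simp; rw [hd_def]; ring
  have e₂ : t₂ = 4 * (x * u ^ 2 + y * (u * u') + z * u' ^ 2) := by
    rw [hx, hy, hz]; field_simp; rw [hd_def]; ring
  have hfl : ∀ w : ℝ, |(⌊w⌋ : ℝ) - w| ≤ 1 := fun w => by
    rw [abs_le]; constructor <;> linarith [Int.floor_le w, Int.lt_floor_add_one w]
  have main : ∀ a b c E : ℝ, |a| ≤ E → |b| ≤ E → |c| ≤ E →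
      |4 * (⌊x⌋ * a + ⌊y⌋ * b + ⌊z⌋ * c) - 4 * (x * a + y * b + z * c)| ≤ 12 * E := by
    intro a b c E ha hb hc
    have h : 4 * (⌊x⌋ * a + ⌊y⌋ * b + ⌊z⌋ * c) - 4 * (x * a + y * b + z * c) =
        4 * ((⌊x⌋ - x) * a + (⌊y⌋ - y) * b + (⌊z⌋ - z) * c) := by ring
    have hm : ∀ w a : ℝ, |a| ≤ E → |(⌊w⌋ - w) * a| ≤ E := fun w a ha => by
      rw [abs_mul]
      calc _ ≤ 1 * |a| := mul_le_mul_of_nonneg_right (hfl w) (abs_nonneg _)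
        _ ≤ E := by rwa [one_mul]
    rw [h, abs_mul, abs_of_pos (by norm_num : (0 : ℝ) < 4)]
    have := (abs_add_three ((⌊x⌋ - x) * a) ((⌊y⌋ - y) * b) ((⌊z⌋ - z) * c))
    linarith [hm x a ha, hm y b hb, hm z c hc]
  have hmul : ∀ {a b E F : ℝ}, |a| ≤ E → |b| ≤ F → |a * b| ≤ E * F := fun ha hb => by
    rw [abs_mul]
    exact mul_le_mul ha hb (abs_nonneg _) ((abs_nonneg _).trans ha)
  refine ⟨⌊x⌋, ⌊y⌋, ⌊z⌋, ?_, ?_, ?_⟩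
  · conv_lhs => rw [e₀]
    refine main _ _ _ _ ?_ ?_ ?_
    · rw [sq, sq]; exact hmul hv hv
    · rw [sq]; exact hmul hv hv'
    · rw [sq, sq]; exact hmul hv' hv'
  · conv_lhs => rw [e₁]
    refine (main _ _ _ (2 * (A * B)) ?_ ?_ ?_).trans (le_of_eq (by ring))
    · rw [mul_assoc, abs_mul, abs_of_pos (by norm_num : (0 : ℝ) < 2)]
      linarith [hmul hu hv]
    · refine (abs_add_le _ _).trans ?_
      linarith [hmul hu hv', hmul hu' hv]
    · rw [mul_assoc, abs_mul, abs_of_pos (by norm_num : (0 : ℝ) < 2)]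
      linarith [hmul hu' hv']
  · conv_lhs => rw [e₂]
    refine main _ _ _ _ ?_ ?_ ?_
    · rw [sq, sq]; exact hmul hu hu
    · rw [sq]; exact hmul hu hu'
    · rw [sq, sq]; exact hmul hu' hu'

theorem monicPoly_add {R : Type*} [CommRing R] {n : ℕ} (a b : Fin n → R) :
    monicPoly (a + b) = monicPoly a + ∑ i, C (b i) * X ^ (i : ℕ) := by
  simp only [monicPoly, Pi.add_apply, map_add, add_mul, Finset.sum_add_distrib, add_assoc]

/-- Existence of a polynomial with prescribed congruences near a given real polynomial. -/
theorem exists_center {n : ℕ} (hn : 4 ≤ n) {p r u v u' v' : ℤ} (hp : Odd p)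
    (hdet : u * v' - u' * v ≠ 0) (hr : p ∣ u * r + v) (hr' : p ∣ u' * r + v') {A B : ℝ}
    (hu : |(u : ℝ)| ≤ A) (hu' : |(u' : ℝ)| ≤ A) (hv : |(v : ℝ)| ≤ B) (hv' : |(v' : ℝ)| ≤ B)
    (t : Fin n → ℝ) : ∃ y : Fin n → ℤ, (∀ i : Fin n, (i : ℕ) + 1 = n → y i = 0) ∧
      (∀ i : Fin n, 4 ∣ y i - if (i : ℕ) = 0 then 2 else 0) ∧
      p ^ 2 ∣ (monicPoly y).eval r ∧ p ∣ (derivative (monicPoly y)).eval r ∧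
      (∀ i : Fin n, (i : ℕ) = 0 → |y i - t i| ≤ 12 * B ^ 2) ∧
      (∀ i : Fin n, (i : ℕ) = 1 → |y i - t i| ≤ 24 * (A * B)) ∧
      (∀ i : Fin n, (i : ℕ) = 2 → |y i - t i| ≤ 12 * A ^ 2) ∧
      (∀ i : Fin n, 3 ≤ (i : ℕ) → (i : ℕ) + 1 < n → |y i - t i| ≤ 4) := by
  obtain ⟨m, rfl⟩ : ∃ m, n = m + 3 := ⟨n - 3, by omega⟩
  set yh : Fin (m + 3) → ℤ := fun i =>
    if 3 ≤ (i : ℕ) ∧ (i : ℕ) + 1 < m + 3 then 4 * ⌊t i / 4⌋ else 0 with hyh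
  set E := (monicPoly yh).eval r
  set F := (derivative (monicPoly yh)).eval r
  set g₀ : ℤ := (-E + F * r) * (1 - p ^ 2) + 2 * p ^ 2 with hg₀
  set g₁ : ℤ := -F * (1 - p ^ 2) with hg₁
  obtain ⟨α, β, γ, h₀, h₁, h₂⟩ := exists_quadratic_near hdet hu hu' hv hv'
    (t ⟨0, by omega⟩ - g₀) (t ⟨1, by omega⟩ - g₁) (t ⟨2, by omega⟩)
  set Q₀ := α * v ^ 2 + β * (v * v') + γ * v' ^ 2 with hQ₀
  set Q₁ := α * (2 * u * v) + β * (u * v' + u' * v) + γ * (2 * u' * v') with hQ₁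
  set Q₂ := α * u ^ 2 + β * (u * u') + γ * u' ^ 2 with hQ₂
  set yl : Fin (m + 3) → ℤ := fun i => if (i : ℕ) = 0 then g₀ + 4 * Q₀ else
    if (i : ℕ) = 1 then g₁ + 4 * Q₁ else if (i : ℕ) = 2 then 4 * Q₂ else 0 with hyl
  have hpoly : monicPoly (yh + yl) = monicPoly yh +
      (C (g₀ + 4 * Q₀) + C (g₁ + 4 * Q₁) * X + C (4 * Q₂) * X ^ 2) := by
    rw [monicPoly_add, Fin.sum_univ_succ, Fin.sum_univ_succ, Fin.sum_univ_succ,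
      Finset.sum_eq_zero (s := (Finset.univ : Finset (Fin m)))]
    · simp only [hyl, Fin.val_succ, Fin.val_zero]
      norm_num
      ring
    · intro i _
      simp [hyl]
  obtain ⟨w, hw⟩ := hr
  obtain ⟨w', hw'⟩ := hr'
  have hp4 : (4 : ℤ) ∣ 1 - p ^ 2 := by
    obtain ⟨k, rfl⟩ := hp
    exact ⟨-(k ^ 2 + k), by ring⟩
  have hv2 : v = p * w - u * r := by linarith
  have hv2' : v' = p * w' - u' * r := by linarith
  refine ⟨yh + yl, ?_, ?_, ?_, ?_, ?_, ?_, ?_, ?_⟩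
  · intro i hi
    simp only [Pi.add_apply, hyh, hyl]
    rw [if_neg (by omega), if_neg (by omega), if_neg (by omega), if_neg (by omega), add_zero]
  · intro i
    simp only [Pi.add_apply, hyh, hyl]
    obtain ⟨e, he⟩ := hp4
    split_ifs with a1 a2 a2 a3 a4
    · omega
    · omega
    · omega
    · simp
    · refine ⟨(-E + F * r) * e - 2 * e + Q₀, ?_⟩
      rw [hg₀]
      linear_combination (-E + F * r - 2) * he
    · refine ⟨-F * e + Q₁, ?_⟩
      rw [hg₁]
      linear_combination (-F) * he
    · exact ⟨Q₂, by ring⟩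
    · simp
  · refine ⟨E + 2 + 4 * (α * w ^ 2 + β * (w * w') + γ * w' ^ 2), ?_⟩
    rw [hpoly]
    simp only [eval_add, eval_mul, eval_C, eval_X, eval_pow]
    change E + _ = _
    rw [hQ₀, hQ₁, hQ₂, hg₀, hg₁, hv2, hv2']
    ring
  · refine ⟨F * p + 4 * (2 * α * u * w + β * (u * w' + u' * w) + 2 * γ * u' * w'), ?_⟩
    rw [hpoly]
    simp only [derivative_add, derivative_mul, derivative_C, derivative_X, derivative_X_pow,
      eval_add, eval_mul, eval_C, eval_X, eval_pow, eval_zero, eval_one]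
    change F + _ = _
    rw [hQ₁, hQ₂, hg₁, hv2, hv2']
    push_cast
    ring
  · rintro ⟨i, hlt⟩ hi
    simp only at hi
    subst hi
    have : (yh + yl) ⟨0, hlt⟩ = g₀ + 4 * Q₀ := by simp [hyh, hyl]
    rw [this]
    convert h₀ using 2
    rw [hQ₀]
    push_cast
    ring
  · rintro ⟨i, hlt⟩ hi
    simp only at hi
    subst hi
    have : (yh + yl) ⟨1, hlt⟩ = g₁ + 4 * Q₁ := by simp [hyh, hyl]
    rw [this]
    convert h₁ using 2
    rw [hQ₁]
    push_cast
    ring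
  · rintro ⟨i, hlt⟩ hi
    simp only at hi
    subst hi
    have : (yh + yl) ⟨2, hlt⟩ = 4 * Q₂ := by simp [hyh, hyl]
    rw [this]
    convert h₂ using 2
    rw [hQ₂]
    push_cast
    ring
  · intro i hi hi'
    have : (yh + yl) i = 4 * ⌊t i / 4⌋ := by
      simp only [Pi.add_apply, hyh, hyl]
      rw [if_pos ⟨hi, hi'⟩, if_neg (by omega), if_neg (by omega), if_neg (by omega), add_zero]
    rw [this, abs_le]
    push_cast
    constructor <;> linarith [Int.floor_le (t i / 4), Int.lt_floor_add_one (t i / 4)]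

end Center

section Residues

/-- A primitive vector of the lattice `{(u, v) : p ∣ u r + v}` extends to a basis with small
second vector. -/
theorem exists_second_vector {p r u k : ℤ} (hp : 0 < p) (hu : 0 < u) (hc : IsCoprime u k) :
    ∃ u' v' : ℤ, u * v' - u' * (k * p - u * r) ≠ 0 ∧ p ∣ u' * r + v' ∧ 0 ≤ u' ∧ u' < u ∧
      u * |v'| ≤ p + u * |k * p - u * r| := by
  obtain ⟨a, b, hab⟩ := hc
  have hmod := Int.emod_add_mul_ediv (-b) u
  set s := -b % u with hs
  set e := -b / u with he
  have hs0 : 0 ≤ s := Int.emod_nonneg _ hu.ne'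
  have hsu : s < u := Int.emod_lt_of_pos _ hu
  have hdet : u * ((a - k * e) * p - s * r) - s * (k * p - u * r) = p := by
    have : s = -b - u * e := by linarith
    rw [this]
    linear_combination p * hab
  refine ⟨s, (a - k * e) * p - s * r, ?_, ⟨a - k * e, by ring⟩, hs0, hsu, ?_⟩
  · rw [hdet]
    exact hp.ne'
  · have h1 : u * ((a - k * e) * p - s * r) = p + s * (k * p - u * r) := by linarith
    calc u * |(a - k * e) * p - s * r| = |u * ((a - k * e) * p - s * r)| := by
          rw [abs_mul, abs_of_pos hu]
      _ ≤ |p| + |s * (k * p - u * r)| := by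
          rw [h1]
          exact abs_add_le _ _
      _ ≤ p + u * |k * p - u * r| := by
          rw [abs_of_pos hp, abs_mul, abs_of_nonneg hs0]
          gcongr

theorem exists_first_vector {p : ℤ} (hp : 0 < p) (r : ℤ) {N : ℕ} (hN : 0 < N) :
    ∃ u k : ℤ, 0 < u ∧ u ≤ N ∧ IsCoprime u k ∧ (N + 1) * |k * p - u * r| ≤ p := by
  obtain ⟨q, hq, hqN⟩ := Real.exists_rat_abs_sub_le_and_den_le ((r : ℝ) / p) hN
  have hd : (0 : ℝ) < q.den := by exact_mod_cast q.pos
  have hpR : (0 : ℝ) < p := by exact_mod_cast hp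
  refine ⟨q.den, q.num, by exact_mod_cast q.pos, by exact_mod_cast hqN, ?_, ?_⟩
  · rw [Int.isCoprime_iff_nat_coprime]
    simpa [Nat.coprime_comm] using q.reduced
  · have h1 : (q.num * p - q.den * r : ℝ) = -((r : ℝ) / p - q) * (p * q.den) := by
      have : (q : ℝ) = q.num / q.den := by exact_mod_cast (Rat.num_div_den q).symm
      rw [this]
      field_simp
      ring
    have h2 : ((N : ℝ) + 1) * |(q.num * p - q.den * r : ℝ)| ≤ p := by
      rw [h1, abs_mul, abs_neg, abs_of_pos (mul_pos hpR hd)]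
      calc ((N : ℝ) + 1) * (|(r : ℝ) / p - q| * (p * q.den))
          ≤ (N + 1) * (1 / ((N + 1) * q.den) * (p * q.den)) := by gcongr
        _ = p := by field_simp
    exact_mod_cast h2

/-- For most residues `r`, the lattice `{(u, v) : p ∣ u r + v}` has a basis in a given box. -/
theorem exists_good_residues (m : ℕ) {η δ : ℝ} (hη : 0 < η) (hη1 : η ≤ 1) (hδ : 0 < δ)
    (hδη : 4 * δ ≤ η ^ 2) : ∃ M₀ : ℝ, ∀ M : ℕ, M₀ ≤ M → ∀ p : ℕ,
      δ * M ^ (4 * (m + 3)) ≤ (p : ℝ) → (p : ℝ) ≤ 2 * (δ * M ^ (4 * (m + 3))) →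
      ∃ R : Finset ℤ, (∀ r ∈ R, 0 ≤ r ∧ r < p ∧ ∃ u v u' v' : ℤ, u * v' - u' * v ≠ 0 ∧
        (p : ℤ) ∣ u * r + v ∧ (p : ℤ) ∣ u' * r + v' ∧
        |(u : ℝ)| ≤ η * M ^ (3 * (m + 2)) ∧ |(u' : ℝ)| ≤ η * M ^ (3 * (m + 2)) ∧
        |(v : ℝ)| ≤ η * M ^ (3 * (m + 4)) ∧ |(v' : ℝ)| ≤ η * M ^ (3 * (m + 4))) ∧
      p ≤ 2 * R.card := by
  classical
  set K : ℝ := 4 * δ / η + 1 with hK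
  have hKpos : 0 < K := by positivity
  refine ⟨max (max 1 (2 / η)) (6 * K / δ), fun M hM p hp hp' => ?_⟩
  have hM1 : (1 : ℝ) ≤ M := (le_max_left _ _).trans ((le_max_left _ _).trans hM)
  have hMη : 2 / η ≤ (M : ℝ) := (le_max_right _ _).trans ((le_max_left _ _).trans hM)
  have hMK : 6 * K / δ ≤ (M : ℝ) := (le_max_right _ _).trans hM
  have hM0 : (0 : ℝ) < M := by linarith
  have hMN : 1 ≤ M := by exact_mod_cast hM1
  have hp0 : (0 : ℝ) < p := lt_of_lt_of_le (by positivity) hp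
  have hpZ : (0 : ℤ) < p := by exact_mod_cast hp0
  have hηM : 2 ≤ η * M := by rwa [div_le_iff₀' hη] at hMη
  set N := ⌊η * (M : ℝ) ^ (3 * (m + 2))⌋₊ with hN_def
  have hN : 0 < N := by
    rw [hN_def, Nat.floor_pos]
    calc (1 : ℝ) ≤ η * M := by linarith
      _ ≤ η * M ^ (3 * (m + 2)) := by
        gcongr
        exact le_self_pow₀ hM1 (by omega)
  have hNle : (N : ℝ) ≤ η * M ^ (3 * (m + 2)) := Nat.floor_le (by positivity)
  have hNlt : η * (M : ℝ) ^ (3 * (m + 2)) < N + 1 := Nat.lt_floor_add_one _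
  set V := ⌊2 * δ / η * (M : ℝ) ^ (m + 6)⌋₊ with hV_def
  have hVle : (V : ℝ) ≤ 2 * δ / η * M ^ (m + 6) := Nat.floor_le (by positivity)
  have hVp : (V : ℝ) ≤ p := by
    refine hVle.trans (le_trans ?_ hp)
    calc 2 * δ / η * (M : ℝ) ^ (m + 6) = δ * (2 / η * M ^ (m + 6)) := by ring
      _ ≤ δ * (M * M ^ (m + 6)) := by gcongr
      _ = δ * M ^ (m + 7) := by ring
      _ ≤ δ * M ^ (4 * (m + 3)) := by
        gcongr
        omega
  have hvV : ∀ v : ℤ, (N + 1 : ℤ) * |v| ≤ p → |v| ≤ V := by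
    intro v hv
    have hvR : ((N : ℝ) + 1) * |(v : ℝ)| ≤ p := by exact_mod_cast hv
    have h1 : |(v : ℝ)| ≤ 2 * δ / η * (M : ℝ) ^ (m + 6) := by
      have h2 : η * (M : ℝ) ^ (3 * (m + 2)) * |(v : ℝ)| ≤ 2 * (δ * M ^ (4 * (m + 3))) :=
        le_trans (by gcongr) (hvR.trans hp')
      have h3 : 2 * (δ * (M : ℝ) ^ (4 * (m + 3))) =
          η * M ^ (3 * (m + 2)) * (2 * δ / η * M ^ (m + 6)) := by
        field_simp
        rw [← pow_add]
        congr 1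
        omega
      rw [h3] at h2
      exact le_of_mul_le_mul_left h2 (by positivity)
    have h4 : v.natAbs ≤ V := by
      rw [hV_def]
      refine Nat.le_floor ?_
      rwa [Nat.cast_natAbs, Int.cast_abs]
    rw [Int.abs_eq_natAbs]
    exact_mod_cast h4
  set U : ℤ := (M : ℤ) ^ m with hU
  have hU1 : 1 ≤ U := one_le_pow₀ (by exact_mod_cast hMN)
  set bad : Finset ℤ := (Finset.Icc 1 U ×ˢ Finset.Icc (-U) U ×ˢ Finset.Icc (-(V : ℤ)) V).image
    fun x => (x.2.1 * p - x.2.2) / x.1 with hbad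
  refine ⟨Finset.Ico 0 (p : ℤ) \ bad, ?_, ?_⟩
  · intro r hr
    rw [Finset.mem_sdiff, Finset.mem_Ico] at hr
    obtain ⟨⟨hr0, hrp⟩, hrb⟩ := hr
    refine ⟨hr0, hrp, ?_⟩
    obtain ⟨u, k, hu0, huN, hcop, hv⟩ := exists_first_vector hpZ r hN
    have hvV' := hvV _ hv
    have hUu : U ≤ u := by
      by_contra! hlt
      refine hrb (Finset.mem_image.2 ⟨(u, k, k * p - u * r), ?_, ?_⟩)
      · rw [abs_le] at hvV'
        have hVp' : (V : ℤ) ≤ p := by exact_mod_cast hVp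
        simp only [Finset.mem_product, Finset.mem_Icc]
        refine ⟨⟨hu0, hlt.le⟩, ⟨?_, ?_⟩, hvV'.1, hvV'.2⟩
        · by_contra! hk
          nlinarith [mul_nonneg hu0.le hr0]
        · by_contra! hk
          nlinarith [mul_le_mul_of_nonneg_left hrp.le hu0.le]
      · simp only [sub_sub_cancel]
        exact Int.mul_ediv_cancel_left _ hu0.ne'
    obtain ⟨u', v', hdet, hdvd, hu'0, hu'u, hv'⟩ := exists_second_vector (r := r) hpZ hu0 hcop
    have huR : (u : ℝ) ≤ N := by exact_mod_cast huN
    have hu0R : (0 : ℝ) < u := by exact_mod_cast hu0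
    have hu'0R : (0 : ℝ) ≤ u' := by exact_mod_cast hu'0
    have hu'R : (u' : ℝ) ≤ u := by exact_mod_cast hu'u.le
    have hUuR : (M : ℝ) ^ m ≤ u := by exact_mod_cast hUu
    have hvR : |((k * p - u * r : ℤ) : ℝ)| ≤ η / 2 * M ^ (3 * (m + 4)) := by
      calc |((k * p - u * r : ℤ) : ℝ)| ≤ V := by exact_mod_cast hvV'
        _ ≤ 2 * δ / η * M ^ (m + 6) := hVle
        _ ≤ η / 2 * M ^ (3 * (m + 4)) := by
          gcongr ?_ * ?_
          · rw [div_le_div_iff₀ hη two_pos]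
            nlinarith
          · exact pow_le_pow_right₀ hM1 (by omega)
    refine ⟨u, k * p - u * r, u', v', hdet, ⟨k, by ring⟩, hdvd, ?_, ?_, ?_, ?_⟩
    · rw [abs_of_pos hu0R]
      exact huR.trans hNle
    · rw [abs_of_nonneg hu'0R]
      exact (hu'R.trans huR).trans hNle
    · refine hvR.trans ?_
      gcongr
      linarith
    · have h1 : (u : ℝ) * |(v' : ℝ)| ≤ p + u * |((k * p - u * r : ℤ) : ℝ)| := by
        exact_mod_cast hv'
      have h2 : (p : ℝ) ≤ u * (η / 2 * M ^ (3 * (m + 4))) := by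
        refine hp'.trans ?_
        calc 2 * (δ * (M : ℝ) ^ (4 * (m + 3))) = M ^ m * (2 * δ * M ^ (3 * (m + 4))) := by ring
          _ ≤ u * (η / 2 * M ^ (3 * (m + 4))) := by
            gcongr
            nlinarith
      refine le_of_mul_le_mul_left (h1.trans ?_) hu0R
      nlinarith [mul_le_mul_of_nonneg_left hvR hu0R.le]
  · have hcb : (bad.card : ℝ) ≤ p / 2 := by
      have h1 : (bad.card : ℤ) ≤ U * ((2 * U + 1) * (2 * V + 1)) := by
        have h2 : bad.card ≤ _ := Finset.card_image_le
        rw [Finset.card_product, Finset.card_product, Int.card_Icc, Int.card_Icc,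
          Int.card_Icc] at h2
        have h3 : ((U + 1 - 1).toNat : ℤ) = U := by omega
        have h4 : ((U + 1 - -U).toNat : ℤ) = 2 * U + 1 := by omega
        have h5 : (((V : ℤ) + 1 - -V).toNat : ℤ) = 2 * V + 1 := by omega
        rw [← h5, ← h4]
        nth_rw 1 [← h3]
        exact_mod_cast h2
      have h1R : (bad.card : ℝ) ≤ M ^ m * ((2 * M ^ m + 1) * (2 * V + 1)) := by
        rw [hU] at h1
        exact_mod_cast h1
      have hMm : 1 ≤ (M : ℝ) ^ m := one_le_pow₀ hM1
      have hM6 : 1 ≤ (M : ℝ) ^ (m + 6) := one_le_pow₀ hM1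
      calc (bad.card : ℝ) ≤ M ^ m * ((2 * M ^ m + 1) * (2 * V + 1)) := h1R
        _ ≤ M ^ m * ((3 * M ^ m) * (K * M ^ (m + 6))) := by
          gcongr
          · linarith
          · have : K * (M : ℝ) ^ (m + 6) = 2 * (2 * δ / η * M ^ (m + 6)) + M ^ (m + 6) := by
              rw [hK]; ring
            linarith
        _ = 3 * K * M ^ (3 * m + 6) := by ring
        _ ≤ δ * M / 2 * M ^ (3 * m + 6) := by
          rw [div_le_iff₀' hδ] at hMK
          gcongr
          linarith
        _ = δ * M ^ (3 * m + 7) / 2 := by ring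
        _ ≤ δ * M ^ (4 * (m + 3)) / 2 := by
          gcongr
          omega
        _ ≤ p / 2 := by linarith
    have h1 := Finset.le_card_sdiff bad (Finset.Ico 0 (p : ℤ))
    rw [Int.card_Ico] at h1
    have h2 : 2 * bad.card ≤ p := by
      have : (2 * bad.card : ℝ) ≤ p := by linarith
      exact_mod_cast this
    omega

end Residues

section Fiber

open Polynomial

theorem exists_residue_fiber {n : ℕ} {p : ℕ} (hp : 0 < p) (r : ℤ) (L : Fin n → ℕ) :
    ∃ S : Finset (Fin n → ℤ), (∀ z ∈ S, (∀ i, |z i| ≤ L i) ∧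
      (p : ℤ) ^ 2 ∣ (∑ i, C (z i) * X ^ (i : ℕ) : ℤ[X]).eval r ∧
      (p : ℤ) ∣ (derivative (∑ i, C (z i) * X ^ (i : ℕ) : ℤ[X])).eval r) ∧
      ∏ i, (L i + 1) ≤ p ^ 3 * S.card := by
  classical
  have : NeZero p := ⟨hp.ne'⟩
  set Q : (Fin n → ℤ) → ℤ[X] := fun z => ∑ i, C (z i) * X ^ (i : ℕ) with hQ
  have hsub : ∀ z z', Q (z - z') = Q z - Q z' := fun z z' => by
    simp only [hQ, Pi.sub_apply, map_sub, sub_mul, Finset.sum_sub_distrib]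
  set f : (Fin n → ℤ) → ZMod (p ^ 2) × ZMod p := fun z =>
    (((Q z).eval r : ℤ), ((derivative (Q z)).eval r : ℤ)) with hf
  set s : Finset (Fin n → ℤ) := Fintype.piFinset fun i => Finset.Icc 0 (L i : ℤ) with hs
  have hcs : s.card = ∏ i, (L i + 1) := by
    rw [hs, Fintype.card_piFinset]
    refine Finset.prod_congr rfl fun i _ => ?_
    rw [Int.card_Icc]
    omega
  have hct : (Finset.univ : Finset (ZMod (p ^ 2) × ZMod p)).card = p ^ 3 := by
    rw [Finset.card_univ, Fintype.card_prod, ZMod.card, ZMod.card]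
    ring
  have hpQ : (0 : ℚ) < (p : ℚ) ^ 3 := by positivity
  obtain ⟨y, -, hy⟩ := Finset.exists_le_card_fiber_of_nsmul_le_card_of_maps_to
    (s := s) (t := Finset.univ) (f := f) (b := (s.card : ℚ) / p ^ 3)
    (fun _ _ => Finset.mem_univ _) Finset.univ_nonempty (by
      rw [hct, nsmul_eq_mul]
      push_cast
      rw [mul_div_cancel₀ _ hpQ.ne'])
  set G := s.filter fun z => f z = y with hG
  have hcard : s.card ≤ p ^ 3 * G.card := by
    rw [div_le_iff₀' hpQ] at hy
    exact_mod_cast hy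
  obtain hG0 | ⟨z₀, hz₀⟩ := G.eq_empty_or_nonempty
  · refine ⟨∅, by simp, ?_⟩
    rw [hG0, Finset.card_empty, mul_zero, hcs] at hcard
    simpa using hcard
  · refine ⟨G.image fun z => z - z₀, ?_, ?_⟩
    · intro w hw
      obtain ⟨z, hz, rfl⟩ := Finset.mem_image.1 hw
      rw [hG, Finset.mem_filter, hs, Fintype.mem_piFinset] at hz hz₀
      have hzz := hz.2.trans hz₀.2.symm
      rw [hf, Prod.mk.injEq] at hzz
      refine ⟨fun i => ?_, ?_, ?_⟩
      · have h1 := Finset.mem_Icc.1 (hz.1 i)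
        have h2 := Finset.mem_Icc.1 (hz₀.1 i)
        rw [Pi.sub_apply, abs_le]
        constructor <;> linarith [h1.1, h1.2, h2.1, h2.2]
      · change _ ∣ (Q (z - z₀)).eval r
        rw [hsub, eval_sub]
        exact_mod_cast (ZMod.intCast_eq_intCast_iff_dvd_sub _ _ _).1 hzz.1.symm
      · change _ ∣ (derivative (Q (z - z₀))).eval r
        rw [hsub, derivative_sub, eval_sub]
        exact (ZMod.intCast_eq_intCast_iff_dvd_sub _ _ _).1 hzz.2.symm
    · rw [Finset.card_image_of_injective _ (sub_left_injective), ← hcs]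
      exact hcard

theorem exists_many_admissible_at {n : ℕ} (hn : 0 < n) {a₀ : Fin n → ℝ} {ε H P : ℝ} {p : ℕ}
    (hp : 0 < p) (hPp : P ≤ p) (hpP : (p : ℝ) ≤ 2 * P) {r : ℤ} (hr0 : 0 ≤ r) (hrp : r < p)
    {y : Fin n → ℤ} (hy : ∀ i : Fin n, (i : ℕ) + 1 = n → y i = 0)
    (hy4 : ∀ i : Fin n, 4 ∣ y i - if (i : ℕ) = 0 then 2 else 0)
    (heval : (p : ℤ) ^ 2 ∣ (monicPoly y).eval r)
    (hderiv : (p : ℤ) ∣ (derivative (monicPoly y)).eval r) {L : Fin n → ℕ}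
    (hL : ∀ i : Fin n, (i : ℕ) + 1 = n → L i = 0)
    (hnear : ∀ i, |(y i : ℝ) - H ^ (n - (i : ℕ)) * a₀ i| + 4 * L i ≤ ε * H ^ (n - (i : ℕ))) :
    ∃ T : Finset (Fin n → ℤ), (∀ c ∈ T, IsAdmissible a₀ ε H P (p, r, c)) ∧
      ∏ i, (L i + 1) ≤ p ^ 3 * T.card := by
  classical
  obtain ⟨S, hS, hcard⟩ := exists_residue_fiber hp r L
  refine ⟨S.image fun z => y + (4 : ℤ) • z, ?_, ?_⟩
  · intro c hc
    obtain ⟨z, hz, rfl⟩ := Finset.mem_image.1 hc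
    obtain ⟨hzL, hze, hzd⟩ := hS z hz
    have hpoly : monicPoly (y + (4 : ℤ) • z) =
        monicPoly y + C 4 * ∑ i, C (z i) * X ^ (i : ℕ) := by
      rw [monicPoly_add, Finset.mul_sum]
      congr 1
      refine Finset.sum_congr rfl fun i _ => ?_
      rw [Pi.smul_apply, smul_eq_mul, C_mul, mul_assoc]
    have h4 : ∀ i : Fin n, 4 ∣ (y + (4 : ℤ) • z) i - if (i : ℕ) = 0 then 2 else 0 := by
      intro i
      have := hy4 i
      rw [Pi.add_apply, Pi.smul_apply, smul_eq_mul]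
      omega
    refine ⟨by exact_mod_cast hPp, by exact_mod_cast hpP, hr0, hrp, ?_, ?_, ?_, ?_, ?_⟩
    · refine irreducible_monicPoly hn (fun i => ?_) ?_
      · have := h4 i
        change 2 ∣ (y + (4 : ℤ) • z) i
        split_ifs at this <;> omega
      · have := h4 ⟨0, hn⟩
        rw [if_pos rfl] at this
        intro h
        change 4 ∣ (y + (4 : ℤ) • z) ⟨0, hn⟩ at h
        omega
    · dsimp only
      rw [hpoly, eval_add, eval_mul]
      exact dvd_add heval (hze.mul_left _)
    · dsimp only
      rw [hpoly, derivative_add, derivative_C_mul, eval_add, eval_mul]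
      exact dvd_add hderiv (hzd.mul_left _)
    · intro i hi
      have h1 := hzL i
      rw [hL i hi, Nat.cast_zero, abs_nonpos_iff] at h1
      simp [hy i hi, h1]
    · intro i
      refine le_trans ?_ (hnear i)
      have h1 : |(z i : ℝ)| ≤ L i := by exact_mod_cast hzL i
      have h2 : (((y + (4 : ℤ) • z) i : ℤ) : ℝ) - H ^ (n - (i : ℕ)) * a₀ i =
          (y i - H ^ (n - (i : ℕ)) * a₀ i) + 4 * z i := by
        rw [Pi.add_apply, Pi.smul_apply, smul_eq_mul]
        push_cast
        ring
      dsimp only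
      rw [h2]
      refine (abs_add_le _ _).trans ?_
      rw [abs_mul, abs_of_pos (by norm_num : (0 : ℝ) < 4)]
      linarith
  · rwa [Finset.card_image_of_injective]
    intro z z' h
    funext i
    have := congrFun h i
    simp only [Pi.add_apply, Pi.smul_apply, smul_eq_mul] at this
    omega

theorem prod_floor_box_le (m : ℕ) {κ : ℝ} (M : ℕ) (hκ : 0 ≤ κ) {L : Fin (m + 1) → ℕ}
    (hL : ∀ i : Fin m, L i.castSucc = ⌊κ * ((M : ℝ) ^ 6) ^ (m + 1 - (i : ℕ))⌋₊) :
    κ ^ m * (M : ℝ) ^ (3 * (m * (m + 3))) ≤ ((∏ i, (L i + 1) : ℕ) : ℝ) := by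
  have hsum : ∑ i ∈ Finset.range m, 6 * (m + 1 - i) = 3 * (m * (m + 3)) := by
    rw [← Finset.sum_range_reflect]
    have : ∀ k, ∑ i ∈ Finset.range k, 6 * (i + 2) = 3 * (k * (k + 3)) := by
      intro k
      induction k with
      | zero => simp
      | succ k ih => rw [Finset.sum_range_succ, ih]; ring
    rw [← this]
    refine Finset.sum_congr rfl fun i hi => ?_
    rw [Finset.mem_range] at hi
    omega
  have hprod : κ ^ m * (M : ℝ) ^ (3 * (m * (m + 3))) =
      ∏ i : Fin m, κ * ((M : ℝ) ^ 6) ^ (m + 1 - (i : ℕ)) := by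
    rw [Finset.prod_mul_distrib, Finset.prod_const, Finset.card_univ, Fintype.card_fin, ← hsum,
      ← Finset.prod_pow_eq_pow_sum, Finset.prod_range]
    simp only [pow_mul]
  rw [hprod, Fin.prod_univ_castSucc]
  push_cast
  have h1 : ∏ i : Fin m, κ * ((M : ℝ) ^ 6) ^ (m + 1 - (i : ℕ)) ≤
      ∏ i : Fin m, ((L i.castSucc : ℝ) + 1) := by
    refine Finset.prod_le_prod (fun i _ => by positivity) fun i _ => ?_
    rw [hL]
    exact (Nat.lt_floor_add_one _).le
  refine h1.trans (le_mul_of_one_le_right ?_ ?_)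
  · positivity
  · linarith [Nat.cast_nonneg (α := ℝ) (L (Fin.last m))]

end Fiber

section Count

open Polynomial

theorem exists_finset_prod_of_fibers {α β : Type*} (s : Finset α) (Q : α → β → Prop) (b : ℝ)
    (h : ∀ a ∈ s, ∃ t : Finset β, (∀ y ∈ t, Q a y) ∧ b ≤ t.card) :
    ∃ T : Finset (α × β), (∀ x ∈ T, Q x.1 x.2) ∧ s.card * b ≤ T.card := by
  classical
  choose! t ht hb using h
  refine ⟨(s.sigma t).map (Equiv.sigmaEquivProd α β).toEmbedding, ?_, ?_⟩
  · intro x hx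
    obtain ⟨⟨a, y⟩, hy, rfl⟩ := Finset.mem_map.1 hx
    rw [Finset.mem_sigma] at hy
    exact ht a hy.1 y hy.2
  · rw [Finset.card_map, Finset.card_sigma, Nat.cast_sum, ← nsmul_eq_mul, ← Finset.sum_const]
    exact Finset.sum_le_sum hb

theorem exists_many_admissible_of_residue (m : ℕ) {a₀ : Fin (m + 4) → ℝ}
    (ha₀ : ∀ i : Fin (m + 4), (i : ℕ) + 1 = m + 4 → a₀ i = 0) {ε η : ℝ} (hε : 0 < ε)
    (hη : 48 * η ^ 2 ≤ ε) {M : ℕ} (hM : 1 ≤ M) (hMε : 8 / ε ≤ M) {P : ℝ} {p : ℕ} (hp : Odd p)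
    (hPp : P ≤ p) (hpP : (p : ℝ) ≤ 2 * P) {r : ℤ} (hr0 : 0 ≤ r) (hrp : r < p)
    {u v u' v' : ℤ} (hdet : u * v' - u' * v ≠ 0) (hr : (p : ℤ) ∣ u * r + v)
    (hr' : (p : ℤ) ∣ u' * r + v')
    (hu : |(u : ℝ)| ≤ η * M ^ (3 * (m + 2))) (hu' : |(u' : ℝ)| ≤ η * M ^ (3 * (m + 2)))
    (hv : |(v : ℝ)| ≤ η * M ^ (3 * (m + 4))) (hv' : |(v' : ℝ)| ≤ η * M ^ (3 * (m + 4))) :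
    ∃ T : Finset (Fin (m + 4) → ℤ), (∀ c ∈ T, IsAdmissible a₀ ε ((M : ℝ) ^ 6) P (p, r, c)) ∧
      (ε / 8) ^ (m + 3) * (M : ℝ) ^ (3 * ((m + 3) * (m + 6))) / (2 * P) ^ 3 ≤ T.card := by
  have hM1 : (1 : ℝ) ≤ M := by exact_mod_cast hM
  have hp0 : 0 < p := hp.pos
  have hp0R : (0 : ℝ) < p := by exact_mod_cast hp0
  have hP : 0 < P := by linarith
  set H : ℝ := (M : ℝ) ^ 6 with hH
  obtain ⟨y, hy, hy4, heval, hderiv, h0, h1, h2, h3⟩ := exists_center (n := m + 4) (by omega)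
    (p := p) (by exact_mod_cast hp) hdet hr hr' hu hu' hv hv'
    (fun i => H ^ (m + 4 - (i : ℕ)) * a₀ i)
  set L : Fin (m + 4) → ℕ := fun i =>
    if (i : ℕ) + 1 < m + 4 then ⌊ε / 8 * H ^ (m + 4 - (i : ℕ))⌋₊ else 0 with hL
  obtain ⟨T, hT, hcard⟩ := exists_many_admissible_at (a₀ := a₀) (ε := ε) (H := H) (L := L)
    (by omega) hp0 hPp hpP hr0 hrp hy hy4 heval hderiv
    (fun i hi => by simp only [hL]; rw [if_neg (by omega)]) (by
      intro i
      have hHi : 0 ≤ H ^ (m + 4 - (i : ℕ)) := by positivity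
      by_cases hi : (i : ℕ) + 1 < m + 4
      · have hLi : (L i : ℝ) ≤ ε / 8 * H ^ (m + 4 - (i : ℕ)) := by
          simp only [hL]
          rw [if_pos hi]
          exact Nat.floor_le (by positivity)
        suffices h : |(y i : ℝ) - H ^ (m + 4 - (i : ℕ)) * a₀ i| ≤
            ε / 2 * H ^ (m + 4 - (i : ℕ)) by linarith
        obtain hi0 | hi0 | hi0 | hi0 : (i : ℕ) = 0 ∨ (i : ℕ) = 1 ∨ (i : ℕ) = 2 ∨ 3 ≤ (i : ℕ) := by
          omega
        · refine (h0 i hi0).trans ?_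
          have e : 12 * (η * (M : ℝ) ^ (3 * (m + 4))) ^ 2 =
              12 * η ^ 2 * H ^ (m + 4 - (i : ℕ)) := by
            rw [hi0, hH, Nat.sub_zero]
            ring
          rw [e]
          gcongr
          nlinarith
        · refine (h1 i hi0).trans ?_
          have e : 24 * (η * (M : ℝ) ^ (3 * (m + 2)) * (η * (M : ℝ) ^ (3 * (m + 4)))) =
              24 * η ^ 2 * H ^ (m + 4 - (i : ℕ)) := by
            rw [hi0, hH, show m + 4 - 1 = m + 3 by omega]
            ring
          rw [e]
          gcongr
          linarith
        · refine (h2 i hi0).trans ?_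
          have e : 12 * (η * (M : ℝ) ^ (3 * (m + 2))) ^ 2 =
              12 * η ^ 2 * H ^ (m + 4 - (i : ℕ)) := by
            rw [hi0, hH, show m + 4 - 2 = m + 2 by omega]
            ring
          rw [e]
          gcongr
          nlinarith
        · refine (h3 i hi0 hi).trans ?_
          calc (4 : ℝ) = ε / 2 * (8 / ε) := by field_simp; norm_num
            _ ≤ ε / 2 * M := by gcongr
            _ ≤ ε / 2 * H ^ (m + 4 - (i : ℕ)) := by
              rw [hH, ← pow_mul]
              gcongr
              exact le_self_pow₀ hM1 (by omega)
      · have hi' : (i : ℕ) + 1 = m + 4 := by omega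
        have hLi : L i = 0 := by
          simp only [hL]
          rw [if_neg hi]
        rw [hy i hi', ha₀ i hi', hLi]
        simp only [Int.cast_zero, mul_zero, sub_zero, abs_zero, Nat.cast_zero, add_zero]
        positivity)
  refine ⟨T, hT, ?_⟩
  have hbox := prod_floor_box_le (m + 3) M (κ := ε / 8) (by positivity) (L := L) (fun i => by
    simp only [hL, Fin.val_castSucc]
    rw [if_pos (by omega)])
  rw [div_le_iff₀ (by positivity)]
  calc (ε / 8) ^ (m + 3) * (M : ℝ) ^ (3 * ((m + 3) * (m + 6))) ≤ _ := hbox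
    _ ≤ ((p ^ 3 * T.card : ℕ) : ℝ) := by exact_mod_cast hcard
    _ = T.card * (p : ℝ) ^ 3 := by push_cast; ring
    _ ≤ T.card * (2 * P) ^ 3 := by gcongr

theorem exists_many_odd {P : ℝ} (hP : 6 ≤ P) :
    ∃ s : Finset ℤ, (∀ p ∈ s, ∃ q : ℕ, (q : ℤ) = p ∧ Odd q ∧ P ≤ q ∧ (q : ℝ) ≤ 2 * P) ∧
      P / 4 ≤ s.card := by
  classical
  refine ⟨(Finset.Icc ⌈P / 2⌉₊ (⌈P / 2⌉₊ + ⌊P / 4⌋₊)).image fun j : ℕ => 2 * (j : ℤ) + 1, ?_, ?_⟩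
  · intro p hp
    obtain ⟨j, hj, rfl⟩ := Finset.mem_image.1 hp
    obtain ⟨hj1, hj2⟩ := Finset.mem_Icc.1 hj
    have h1 : P / 2 ≤ j := Nat.ceil_le.1 hj1
    have h2 : (j : ℝ) ≤ ⌈P / 2⌉₊ + ⌊P / 4⌋₊ := by exact_mod_cast hj2
    have h3 : (⌈P / 2⌉₊ : ℝ) < P / 2 + 1 := Nat.ceil_lt_add_one (by linarith)
    have h4 : (⌊P / 4⌋₊ : ℝ) ≤ P / 4 := Nat.floor_le (by linarith)
    refine ⟨2 * j + 1, by push_cast; rfl, ⟨j, rfl⟩, ?_, ?_⟩ <;> push_cast <;> linarith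
  · rw [Finset.card_image_of_injective _ (fun a b h => by simpa using h), Nat.card_Icc]
    have h4 : P / 4 < ⌊P / 4⌋₊ + 1 := Nat.lt_floor_add_one _
    have : ⌈P / 2⌉₊ + ⌊P / 4⌋₊ + 1 - ⌈P / 2⌉₊ = ⌊P / 4⌋₊ + 1 := by omega
    rw [this]
    push_cast
    exact h4.le

theorem exists_many_admissible (m : ℕ) {a₀ : Fin (m + 4) → ℝ}
    (ha₀ : ∀ i : Fin (m + 4), (i : ℕ) + 1 = m + 4 → a₀ i = 0) {ε δ₀ : ℝ} (hε : 0 < ε)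
    (hδ₀ : 0 < δ₀) : ∃ δ, 0 < δ ∧ δ ≤ δ₀ ∧ ∃ c : ℝ, 0 < c ∧ ∃ M₀ : ℝ, ∀ M : ℕ, M₀ ≤ M →
      ∃ T : Finset (ℤ × ℤ × (Fin (m + 4) → ℤ)),
        (∀ t ∈ T, IsAdmissible a₀ ε ((M : ℝ) ^ 6) (δ * M ^ (4 * (m + 3))) t) ∧
        c * (M : ℝ) ^ ((3 * m + 14) * (m + 3)) ≤ T.card := by
  obtain ⟨η, hη, hη1, hηε⟩ : ∃ η : ℝ, 0 < η ∧ η ≤ 1 ∧ 48 * η ^ 2 ≤ ε := by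
    refine ⟨min 1 (ε / 48), by positivity, min_le_left _ _, ?_⟩
    have h1 := min_le_left 1 (ε / 48)
    have h2 := min_le_right 1 (ε / 48)
    have h3 : 0 < min 1 (ε / 48) := by positivity
    nlinarith
  set δ := min δ₀ (η ^ 2 / 4) with hδ_def
  have hδ : 0 < δ := by positivity
  have hδη : 4 * δ ≤ η ^ 2 := by linarith [min_le_right δ₀ (η ^ 2 / 4)]
  obtain ⟨M₁, hM₁⟩ := exists_good_residues m hη hη1 hδ hδη
  refine ⟨δ, hδ, min_le_left _ _, (ε / 8) ^ (m + 3) / (64 * δ), by positivity,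
    max (max 1 M₁) (max (6 / δ) (8 / ε)), fun M hM => ?_⟩
  have hM1 : (1 : ℝ) ≤ M := (le_max_left _ _).trans ((le_max_left _ _).trans hM)
  have hMM₁ : M₁ ≤ (M : ℝ) := (le_max_right _ _).trans ((le_max_left _ _).trans hM)
  have hMδ : 6 / δ ≤ (M : ℝ) := (le_max_left _ _).trans ((le_max_right _ _).trans hM)
  have hMε : 8 / ε ≤ (M : ℝ) := (le_max_right _ _).trans ((le_max_right _ _).trans hM)
  have hMN : 1 ≤ M := by exact_mod_cast hM1
  set P : ℝ := δ * (M : ℝ) ^ (4 * (m + 3)) with hP_def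
  have hP6 : 6 ≤ P := by
    rw [div_le_iff₀' hδ] at hMδ
    refine hMδ.trans ?_
    rw [hP_def]
    gcongr
    exact le_self_pow₀ hM1 (by omega)
  set W : ℝ := (ε / 8) ^ (m + 3) * (M : ℝ) ^ (3 * ((m + 3) * (m + 6))) / (2 * P) ^ 3 with hW
  have hW0 : 0 ≤ W := by positivity
  obtain ⟨s, hs, hscard⟩ := exists_many_odd hP6
  obtain ⟨T, hT, hTcard⟩ := exists_finset_prod_of_fibers s
    (fun p (x : ℤ × (Fin (m + 4) → ℤ)) => IsAdmissible a₀ ε ((M : ℝ) ^ 6) P (p, x))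
    (P / 2 * W) (by
      intro p hp
      obtain ⟨q, rfl, hq, hPq, hqP⟩ := hs p hp
      obtain ⟨R, hR, hRcard⟩ := hM₁ M hMM₁ q hPq hqP
      obtain ⟨T, hT, hTcard⟩ := exists_finset_prod_of_fibers R
        (fun r (x : Fin (m + 4) → ℤ) => IsAdmissible a₀ ε ((M : ℝ) ^ 6) P (q, r, x)) W (by
          intro r hr
          obtain ⟨hr0, hrq, u, v, u', v', hdet, hd, hd', hu, hu', hv, hv'⟩ := hR r hr
          exact exists_many_admissible_of_residue m ha₀ hε hηε hMN hMε hq hPq hqP hr0 hrq hdet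
            hd hd' hu hu' hv hv')
      refine ⟨T, hT, le_trans ?_ hTcard⟩
      gcongr
      have : (q : ℝ) ≤ 2 * R.card := by exact_mod_cast hRcard
      linarith)
  refine ⟨T, hT, le_trans (le_trans (le_of_eq (b := P / 4 * (P / 2 * W)) ?_) ?_) hTcard⟩
  · have hM0 : (M : ℝ) ≠ 0 := by positivity
    have hP0 : P ≠ 0 := by positivity
    have e : P / 4 * (P / 2 * W) =
        (ε / 8) ^ (m + 3) * (M : ℝ) ^ (3 * ((m + 3) * (m + 6))) / (64 * P) := by
      rw [hW]
      field_simp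
      norm_num
    rw [e, hP_def]
    field_simp
    rw [← pow_add]
    congr 1
    ring
  · gcongr

end Count

theorem exists_scale {E F : ℕ} (hE : 0 < E) {C c : ℝ} (hC : 0 < C) (hc : 0 < c) (M₀ : ℝ) :
    ∃ c' : ℝ, 0 < c' ∧ ∃ X₀ : ℝ, 0 < X₀ ∧ ∀ X : ℝ, X₀ ≤ X → ∃ M : ℕ, M₀ ≤ M ∧
      C * (M : ℝ) ^ E ≤ X ∧ c' * X ^ ((F : ℝ) / E) ≤ c * (M : ℝ) ^ F := by
  have hm : 0 < max M₀ 1 := lt_max_of_lt_right one_pos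
  refine ⟨c * (1 / 2) ^ F * (1 / C) ^ ((F : ℝ) / E), by positivity,
    C * (max M₀ 1 + 1) ^ E, by positivity, fun X hX => ?_⟩
  have hX0 : 0 < X := lt_of_lt_of_le (by positivity) hX
  have hXC : 0 < X / C := by positivity
  set ρ : ℝ := (X / C) ^ ((1 : ℝ) / E) with hρ
  have hER : (E : ℝ) ≠ 0 := by exact_mod_cast hE.ne'
  have hρ0 : 0 < ρ := Real.rpow_pos_of_pos hXC _
  have hρE : ρ ^ E = X / C := by
    rw [hρ, ← Real.rpow_natCast, ← Real.rpow_mul hXC.le, one_div_mul_cancel hER, Real.rpow_one]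
  have hρF : ρ ^ F = (1 / C) ^ ((F : ℝ) / E) * X ^ ((F : ℝ) / E) := by
    rw [← Real.mul_rpow (by positivity) hX0.le, hρ, ← Real.rpow_natCast,
      ← Real.rpow_mul hXC.le]
    congr 1 <;> ring
  have hρM : max M₀ 1 + 1 ≤ ρ := by
    refine le_of_pow_le_pow_left₀ hE.ne' hρ0.le ?_
    rw [hρE, le_div_iff₀' hC]
    exact hX
  have hfl : (⌊ρ⌋₊ : ℝ) ≤ ρ := Nat.floor_le hρ0.le
  have hlt : ρ < ⌊ρ⌋₊ + 1 := Nat.lt_floor_add_one _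
  refine ⟨⌊ρ⌋₊, by linarith [le_max_left M₀ 1], ?_, ?_⟩
  · calc C * (⌊ρ⌋₊ : ℝ) ^ E ≤ C * ρ ^ E := by gcongr
      _ = X := by rw [hρE]; field_simp
  · calc c * (1 / 2) ^ F * (1 / C) ^ ((F : ℝ) / E) * X ^ ((F : ℝ) / E) = c * (1 / 2 * ρ) ^ F := by
          rw [mul_pow, hρF]
          ring
      _ ≤ c * (⌊ρ⌋₊ : ℝ) ^ F := by
        gcongr
        linarith [le_max_right M₀ 1]

/-- For `n ≥ 4` there are `c_n > 0` and `X₀ > 0` such that for all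
`X ≥ X₀` there are at least `c_n · X^{1/2 + 1/(n − 4/3)}` pairwise non-isomorphic
integral domains that are free of rank `n` as ℤ-modules (realised here as commutative
ring structures on `ℤⁿ` with the standard addition) with `|disc| ≤ X`. -/
theorem count_rank_n_domains_lower_bound (n : ℕ) (hn : 4 ≤ n) :
    ∃ c : ℝ, 0 < c ∧ ∃ X₀ : ℝ, 0 < X₀ ∧ ∀ X : ℝ, X₀ ≤ X →
      ∃ k : ℕ, c * X ^ ((1 : ℝ) / 2 + 1 / ((n : ℝ) - 4 / 3)) ≤ (k : ℝ) ∧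
        ∃ inst : Fin k → CommRing (Fin n → ℤ),
          (∀ i, ∀ x y : Fin n → ℤ, structAdd (inst i) x y = x + y) ∧
          (∀ i, StructIsDomain (inst i)) ∧
          (∀ i, (|structDisc n (inst i)| : ℝ) ≤ X) ∧
          (∀ i j, i ≠ j → ¬ StructIso (inst i) (inst j)) := by
  obtain ⟨m, rfl⟩ : ∃ m, n = m + 4 := ⟨n - 4, by omega⟩
  obtain ⟨a₀, ha₀, ε, hε, κ, hκ, D, hD, hnear⟩ := exists_good_neighbourhood hn
  obtain ⟨δ, hδ, hδ₀, c, hc, M₀, hM₀⟩ := exists_many_admissible m ha₀ hε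
    (δ₀ := min 1 (κ / (8 * D))) (by positivity)
  have hδ1 : δ ≤ 1 := hδ₀.trans (min_le_left _ _)
  have hδκ : 8 * D * δ ≤ κ := by
    have := hδ₀.trans (min_le_right _ _)
    rwa [le_div_iff₀' (by positivity)] at this
  obtain ⟨c', hc', X₀, hX₀, hX⟩ := exists_scale (E := (6 * m + 16) * (m + 3))
    (F := (3 * m + 14) * (m + 3)) (by positivity) (C := D / δ ^ 2) (by positivity) hc
    (max M₀ (D / κ + 1))
  refine ⟨c', hc', X₀, hX₀, fun X hXX => ?_⟩
  obtain ⟨M, hM, hMX, hMc⟩ := hX X hXX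
  have hMD : D / κ + 1 ≤ M := (le_max_right _ _).trans hM
  have hM1 : (1 : ℝ) ≤ M := by
    have : 0 < D / κ := by positivity
    linarith
  have hDM : D < κ * M := by
    rw [← div_lt_iff₀' hκ]
    linarith
  obtain ⟨T, hT, hTcard⟩ := hM₀ M ((le_max_left _ _).trans hM)
  refine ⟨T.card, ?_, exists_family hn hκ hD hnear (one_le_pow₀ hM1) ?_ ?_ ?_ ?_ T hT⟩
  · have e : (1 : ℝ) / 2 + 1 / (((m + 4 : ℕ) : ℝ) - 4 / 3) =
        (((3 * m + 14) * (m + 3) : ℕ) : ℝ) / (((6 * m + 16) * (m + 3) : ℕ) : ℝ) := by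
      push_cast
      have h1 : (m : ℝ) + 4 - 4 / 3 = (3 * m + 8) / 3 := by ring
      have h2 : (6 * m + 16 : ℝ) = 2 * (3 * m + 8) := by ring
      rw [h1, h2]
      field_simp
      ring
    rw [e]
    exact hMc.trans hTcard
  · refine hDM.trans_le ?_
    rw [← pow_mul]
    gcongr
    exact le_self_pow₀ hM1 (by omega)
  · positivity
  · have h1 : D * (2 * (δ * (M : ℝ) ^ (4 * (m + 3)))) ^ 2 =
        4 * D * δ ^ 2 * M ^ (8 * (m + 3)) := by ring
    rw [h1, ← pow_mul]
    refine mul_lt_mul ?_ (pow_le_pow_right₀ hM1 (by omega)) (by positivity) hκ.le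
    nlinarith [mul_pos hD hδ, mul_le_mul_of_nonneg_left hδ1 (mul_pos hD hδ).le]
  · have h1 : D * ((M : ℝ) ^ 6) ^ ((m + 4) * (m + 4 - 1)) =
        D / δ ^ 2 * M ^ ((6 * m + 16) * (m + 3)) * (δ * M ^ (4 * (m + 3))) ^ 2 := by
      rw [show m + 4 - 1 = m + 3 by omega]
      field_simp
      rw [← pow_mul, ← pow_mul, ← pow_add]
      congr 1
      ring
    rw [h1]
    gcongr
end
end

section
/- Let R be a commutative ring, n ≥ 1, a_0, …, a_n ∈ R and l ∈ R. Define f(x) = Σ_{i=0}^{n} a_i x^{n-i}, write f(x + l) = Σ_{k=0}^{n} b_k x^{n-k}, and set s_i(x) = Σ_{j=0}^{i-1} a_j x^{i-j} and m_i(x) = Σ_{j=0}^{i-1} b_j x^{i-j}. Then for every 1 ≤ k ≤ n−1, the following identity holds in R[x]: m_k(x − l) + b_k = Σ_{j=0}^{k-1} binom(n−k+j−1, j) · (s_{k−j}(x) + a_{k−j}) · l^{j} + binom(n−1, k) · l^{k} · a_0. -/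
noncomputable section

/-- `s_i(x) = a_0 xⁱ + a_1 x^{i-1} + ⋯ + a_{i-1} x` for a coefficient sequence `a`. -/
def sPoly {R : Type*} [CommRing R] (a : ℕ → R) (i : ℕ) : Polynomial R :=
  ∑ j ∈ Finset.range i, Polynomial.C (a j) * Polynomial.X ^ (i - j)

/-- The coefficient `b_k` of `x^{n-k}` in `f(x + l)`, where
`f(x) = Σ_{i=0}^n a_i x^{n-i}`. -/
def bCoeff {R : Type*} [CommRing R] (n : ℕ) (a : ℕ → R) (l : R) (k : ℕ) : R :=
  ((∑ i ∈ Finset.range (n + 1), Polynomial.C (a i) * Polynomial.X ^ (n - i)).comp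
    (Polynomial.X + Polynomial.C l)).coeff (n - k)

/-- Pascal's rule for the weights attached to `S i` in the translation identity. -/
theorem choose_weight_pascal {n k i : ℕ} (hk : k + 1 < n) (hi : i ≤ k) :
    (n - i).choose (k + 1 - i) = (n - i - 1).choose (k + 1 - i) + (n - i - 1).choose (k - i) := by
  obtain ⟨p, rfl⟩ := Nat.exists_eq_add_of_le hi
  obtain ⟨q, rfl⟩ := Nat.exists_eq_add_of_lt hk
  rw [show i + p + 1 + q + 1 - i = (p + q + 1) + 1 by omega, show i + p + 1 - i = p + 1 by omega,
    show i + p - i = p by omega, Nat.choose_succ_succ, Nat.add_sub_cancel, add_comm]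

theorem horner_sum_succ {A : Type*} [CommSemiring A] (a : ℕ → A) (x : A) (k : ℕ) :
    ∑ j ∈ Finset.range (k + 2), a j * x ^ (k + 1 - j)
      = x * ∑ j ∈ Finset.range (k + 1), a j * x ^ (k - j) + a (k + 1) := by
  rw [Finset.sum_range_succ, Nat.sub_self, pow_zero, mul_one, Finset.mul_sum]
  congr 1
  refine Finset.sum_congr rfl fun j hj => ?_
  rw [Nat.sub_add_comm (Finset.mem_range_succ_iff.mp hj), pow_succ]
  ring

theorem horner_sum_translate {A : Type*} [CommRing A] (n : ℕ) (a b S : ℕ → A) (x l : A)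
    (hb : ∀ k ≤ n, b k =
      ∑ i ∈ Finset.range (k + 1), ((n - i).choose (k - i) : A) * a i * l ^ (k - i))
    (hS₀ : S 0 = a 0) (hS : ∀ i, S (i + 1) = x * S i + a (i + 1)) (k : ℕ) (hk : k < n) :
    ∑ j ∈ Finset.range (k + 1), b j * (x - l) ^ (k - j)
      = ∑ i ∈ Finset.range (k + 1), ((n - i - 1).choose (k - i) : A) * S i * l ^ (k - i) := by
  induction k with
  | zero => simp [hb, hS₀]
  | succ k ih =>
    have pascal : ∑ i ∈ Finset.range (k + 2), ((n - i).choose (k + 1 - i) : A) * S i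
          * l ^ (k + 1 - i)
        = ∑ i ∈ Finset.range (k + 2), ((n - i - 1).choose (k + 1 - i) : A) * S i * l ^ (k + 1 - i)
          + l * ∑ i ∈ Finset.range (k + 1), ((n - i - 1).choose (k - i) : A) * S i
            * l ^ (k - i) := by
      rw [Finset.sum_range_succ, Finset.sum_range_succ _ (k + 1), Finset.mul_sum,
        add_right_comm, ← Finset.sum_add_distrib]
      congr 1
      · refine Finset.sum_congr rfl fun i hi => ?_
        have hi' := Finset.mem_range_succ_iff.mp hi
        rw [choose_weight_pascal hk hi', Nat.sub_add_comm hi', pow_succ]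
        push_cast
        ring
      · simp
    have recurrence : ∑ i ∈ Finset.range (k + 2), ((n - i).choose (k + 1 - i) : A) * S i
          * l ^ (k + 1 - i)
        = b (k + 1) + x * ∑ i ∈ Finset.range (k + 1), ((n - i - 1).choose (k - i) : A) * S i
            * l ^ (k - i) := by
      rw [hb _ hk.le, Finset.sum_range_succ', Finset.sum_range_succ' _ (k + 1), Finset.mul_sum,
        add_right_comm, ← Finset.sum_add_distrib, hS₀]
      congr 1
      refine Finset.sum_congr rfl fun i _ => ?_
      rw [hS, Nat.add_sub_add_right, Nat.sub_sub]
      ring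
    rw [horner_sum_succ, ih (by omega)]
    linear_combination pascal - recurrence

theorem bCoeff_eq_sum {R : Type*} [CommRing R] (n : ℕ) (a : ℕ → R) (l : R) (k : ℕ) (hk : k ≤ n) :
    bCoeff n a l k =
      ∑ i ∈ Finset.range (k + 1), ((n - i).choose (k - i) : R) * a i * l ^ (k - i) := by
  simp only [bCoeff, Polynomial.sum_comp, Polynomial.mul_comp, Polynomial.C_comp,
    Polynomial.X_pow_comp, Polynomial.finsetSum_coeff, Polynomial.coeff_C_mul,
    Polynomial.coeff_X_add_C_pow]
  symm
  refine Finset.sum_subset_zero_on_sdiff (Finset.range_mono (by omega)) (fun i hi => ?_)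
    (fun i hi => ?_)
  · simp only [Finset.mem_sdiff, Finset.mem_range] at hi
    rw [Nat.choose_eq_zero_of_lt (by omega)]
    simp
  · have hik := Finset.mem_range_succ_iff.mp hi
    rw [← Nat.choose_symm (show k - i ≤ n - i by omega),
      show n - i - (k - i) = n - k by omega, show n - i - (n - k) = k - i by omega]
    ring

theorem sPoly_add_C {R : Type*} [CommRing R] (a : ℕ → R) (k : ℕ) :
    sPoly a k + Polynomial.C (a k)
      = ∑ j ∈ Finset.range (k + 1), Polynomial.C (a j) * Polynomial.X ^ (k - j) := by
  simp [sPoly, Finset.sum_range_succ]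

/-- With `s_i`, `m_i` as above (`m_i` built from the coefficients
`b_j` of `f(x + l)`), for every `1 ≤ k ≤ n − 1` one has, in `R[x]`:
`m_k(x − l) + b_k = Σ_{j=0}^{k-1} binom(n−k+j−1, j)·(s_{k−j}(x) + a_{k−j})·l^j
                      + binom(n−1, k)·l^k·a_0`. -/
theorem mPoly_translate_identity (R : Type*) [CommRing R] (n : ℕ) (hn : 1 ≤ n)
    (a : ℕ → R) (l : R) (k : ℕ) (hk1 : 1 ≤ k) (hk2 : k ≤ n - 1) :
    (sPoly (bCoeff n a l) k).comp (Polynomial.X - Polynomial.C l)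
        + Polynomial.C (bCoeff n a l k)
      = (∑ j ∈ Finset.range k,
          Polynomial.C (((n - k + j - 1).choose j : R))
            * (sPoly a (k - j) + Polynomial.C (a (k - j))) * Polynomial.C (l ^ j))
        + Polynomial.C (((n - 1).choose k : R)) * Polynomial.C (l ^ k)
            * Polynomial.C (a 0) := by
  have translate := horner_sum_translate n (fun i => Polynomial.C (a i))
    (fun i => Polynomial.C (bCoeff n a l i)) (fun i => sPoly a i + Polynomial.C (a i))
    Polynomial.X (Polynomial.C l) (fun k hk => by simp [bCoeff_eq_sum n a l k hk])
    (by simp [sPoly])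
    (fun i => by simp only [sPoly_add_C]; exact horner_sum_succ _ _ _) k (by omega)
  have lhs : (sPoly (bCoeff n a l) k).comp (Polynomial.X - Polynomial.C l)
        + Polynomial.C (bCoeff n a l k)
      = ∑ j ∈ Finset.range (k + 1), Polynomial.C (bCoeff n a l j)
          * (Polynomial.X - Polynomial.C l) ^ (k - j) := by
    simp [sPoly, Finset.sum_range_succ, Polynomial.sum_comp]
  refine (lhs.trans translate).trans ((Finset.sum_range_reflect _ _).symm.trans ?_)
  refine (Finset.sum_range_succ _ k).trans (congrArg₂ (· + ·) ?_ ?_)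
  · refine Finset.sum_congr rfl fun j hj => ?_
    have hj' := Finset.mem_range.mp hj
    rw [show k + 1 - 1 - j = k - j by omega, show k - (k - j) = j by omega,
      show n - (k - j) - 1 = n - k + j - 1 by omega]
    simp
  · simp [sPoly]
    ring
end
end
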